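/- Let Ω be an n-connected generalized quadrature domain of finite area with no degenerate boundary components. Then for every proper holomorphic map f of Ω onto the open unit disc 𝔻, the functions f and f' are algebraically dependent: there exists a nonzero polynomial P ∈ ℂ[X,Y] such that P(f'(z), f(z)) = 0 for all z ∈ Ω. -/

import Mathlib

open MeasureTheory Complex ComplexConjugate Metric Set

noncomputable section

/-- `f` belongs to the Bergman space `A²(Ω)`. -/
def BergmanFun (Ω : Set ℂ) (f : ℂ → ℂ) : Prop :=
  DifferentiableOn ℂ f Ω ∧ IntegrableOn (fun z => ‖f z‖ ^ 2) Ω volume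

/-- `Ω` is a finitely connected domain none of whose complementary components is a point. -/
def IsFinConnDomain (Ω : Set ℂ) : Prop :=
  IsOpen Ω ∧ IsConnected Ω ∧
  {C : Set ℂ | ∃ x ∈ Ωᶜ, C = connectedComponentIn Ωᶜ x}.Finite ∧
  ∀ x ∈ Ωᶜ, ¬ (connectedComponentIn Ωᶜ x).Subsingleton

/-- `Ω` is a quadrature domain. -/
def IsQuadratureDomain (Ω : Set ℂ) : Prop :=
  ∃ N : ℕ, 0 < N ∧ ∃ (w : Fin N → ℂ) (n : Fin N → ℕ) (c : Fin N → ℕ → ℂ),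
    (∀ j, w j ∈ Ω) ∧
    ∀ f : ℂ → ℂ, BergmanFun Ω f →
      (∫ z in Ω, f z) =
        ∑ j, ∑ k ∈ Finset.range (n j + 1), c j k * iteratedDerivWithin k f Ω (w j)

/-- `fa` is an Ahlfors map of `Ω` at `a`. -/
def IsAhlforsMap (Ω : Set ℂ) (a : ℂ) (fa : ℂ → ℂ) : Prop :=
  DifferentiableOn ℂ fa Ω ∧ (∀ z ∈ Ω, ‖fa z‖ < 1) ∧
  (deriv fa a).im = 0 ∧ 0 < (deriv fa a).re ∧
  ∀ g : ℂ → ℂ, DifferentiableOn ℂ g Ω → (∀ z ∈ Ω, ‖g z‖ < 1) →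
    ‖deriv g a‖ ≤ (deriv fa a).re

/-- `Ω` is bounded with `C^∞` smooth boundary consisting of finitely many disjoint
simple closed curves. -/
def HasSmoothBoundary (Ω : Set ℂ) : Prop :=
  Bornology.IsBounded Ω ∧
  ∃ (n : ℕ) (γ : Fin n → ℝ → ℂ),
    (∀ i, ContDiff ℝ (⊤ : ℕ∞) (γ i)) ∧
    (∀ i, Function.Periodic (γ i) (2 * Real.pi)) ∧
    (∀ i, InjOn (γ i) (Ico 0 (2 * Real.pi))) ∧
    (∀ i t, deriv (γ i) t ≠ 0) ∧
    (Pairwise fun i j => Disjoint (range (γ i)) (range (γ j))) ∧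
    frontier Ω = ⋃ i, range (γ i)

/-- Partial derivative in the `x`-direction of a real-valued function on `ℂ`. -/
def pdx (u : ℂ → ℝ) (z : ℂ) : ℝ := deriv (fun t : ℝ => u (z + (t : ℂ))) 0

/-- Partial derivative in the `y`-direction of a real-valued function on `ℂ`. -/
def pdy (u : ℂ → ℝ) (z : ℂ) : ℝ := deriv (fun t : ℝ => u (z + (t : ℂ) * Complex.I)) 0

/-- `f` is a proper holomorphic map of `Ω` onto the open unit disc. -/
def IsProperOntoDisc (Ω : Set ℂ) (f : ℂ → ℂ) : Prop :=
  DifferentiableOn ℂ f Ω ∧ f '' Ω = ball (0 : ℂ) 1 ∧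
  ∀ L : Set ℂ, L ⊆ ball (0 : ℂ) 1 → IsCompact L → IsCompact (Ω ∩ f ⁻¹' L)

/-- `g` is `(m, δ)`-close to the identity on `closure Ω`. -/
def CloseToId (Ω : Set ℂ) (m : ℕ) (δ : ℝ) (g : ℂ → ℂ) : Prop :=
  ∀ k ≤ m, ∀ z ∈ closure Ω, ‖iteratedFDeriv ℝ k (fun w => g w - w) z‖ ≤ δ

/-- `σ : [0,1] → ℂ` is a piecewise continuously differentiable curve. -/
def PiecewiseC1On01 (σ : ℝ → ℂ) : Prop :=
  ContinuousOn σ (Icc 0 1) ∧ ∃ s : Finset ℝ, ContDiffOn ℝ 1 σ (Icc (0 : ℝ) 1 \ s)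

/-- `Ω` is a generalized quadrature domain. -/
def IsGenQuadratureDomain (Ω : Set ℂ) : Prop :=
  ∃ (N M : ℕ) (w : Fin N → ℂ) (n : Fin N → ℕ) (c : Fin N → ℕ → ℂ)
    (b : Fin M → ℂ) (σ : Fin M → ℝ → ℂ),
    (∀ j, w j ∈ Ω) ∧
    (∀ m, PiecewiseC1On01 (σ m)) ∧
    (∀ m, ∀ t ∈ Icc (0 : ℝ) 1, σ m t ∈ Ω) ∧
    ∀ f : ℂ → ℂ, BergmanFun Ω f →
      (∫ z in Ω, f z) =
        (∑ j, ∑ k ∈ Finset.range (n j + 1), c j k * iteratedDerivWithin k f Ω (w j)) +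
        ∑ m, b m * ∫ t in (0 : ℝ)..1, f (σ m t) * deriv (σ m) t

open Filter Topology

theorem integrableOn_norm_rpow_ball {p : ℝ} (hp : p < 2) (R : ℝ) :
    IntegrableOn (fun z : ℂ => ‖z‖ ^ (-p)) (ball 0 R) := by
  have h := (integrableOn_fun_norm_addHaar (μ := (volume : Measure ℂ)) (E := ℂ) (F := ℝ)
    (f := fun y => y ^ (-p)) (r := R)).2
  apply h
  rw [Complex.finrank_real_complex]
  rcases le_or_gt R 0 with hR | hR
  · simp [Ioo_eq_empty (not_lt.2 hR)]
  have := (intervalIntegral.integrableOn_Ioo_rpow_iff hR (s := 1 - p)).2 (by linarith)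
  refine this.congr_fun (fun x hx => ?_) measurableSet_Ioo
  have : (0:ℝ) < x := hx.1
  simp only [smul_eq_mul]
  rw [show 1 - p = ((2 - 1 : ℕ) : ℝ) + -p by norm_num; ring, Real.rpow_add this, Real.rpow_natCast]

theorem integrableOn_norm_sub_rpow {Ω : Set ℂ} (hA : volume Ω < ⊤) {p : ℝ} (h0 : 0 ≤ p)
    (hp : p < 2) (ζ : ℂ) : IntegrableOn (fun z : ℂ => ‖z - ζ‖ ^ (-p)) Ω := by
  have h1 : IntegrableOn (fun z : ℂ => ‖z - ζ‖ ^ (-p)) (ball ζ 1) := by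
    have h := integrableOn_norm_rpow_ball hp 1
    rw [← integrable_indicator_iff measurableSet_ball] at h ⊢
    have h2 := h.comp_sub_right ζ
    refine h2.congr (ae_of_all _ fun z => ?_)
    simp [indicator, dist_eq_norm]
  have hsplit : Ω ⊆ ball ζ 1 ∪ (Ω ∩ (ball ζ 1)ᶜ) := by
    intro z hz
    by_cases h : z ∈ ball ζ 1
    · exact Or.inl h
    · exact Or.inr ⟨hz, h⟩
  refine IntegrableOn.mono_set (h1.union ?_) hsplit
  have hfin : volume (Ω ∩ (ball ζ 1)ᶜ) < ⊤ := (measure_mono inter_subset_left).trans_lt hA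
  have : IntegrableOn (fun z : ℂ => (1:ℝ)) (Ω ∩ (ball ζ 1)ᶜ) := by
    simpa [integrableOn_const_iff] using hfin
  refine Integrable.mono' this (Measurable.pow_const (by fun_prop) _).aestronglyMeasurable ?_
  have : ∀ᵐ z ∂(volume.restrict (Ω ∩ (ball ζ 1)ᶜ)), z ∈ (ball ζ 1)ᶜ := by
    have h3 : ∀ᵐ z ∂(volume.restrict (ball ζ 1)ᶜ), z ∈ (ball ζ 1)ᶜ :=
      ae_restrict_mem measurableSet_ball.compl
    exact ae_mono (Measure.restrict_mono inter_subset_right le_rfl) h3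
  filter_upwards [this] with z hz
  have hz' : 1 ≤ ‖z - ζ‖ := by simpa [dist_eq_norm] using hz
  rw [Real.norm_of_nonneg (by positivity)]
  exact Real.rpow_le_one_of_one_le_of_nonpos hz' (by linarith)

theorem integrableOn_inv_sub {Ω : Set ℂ} (hA : volume Ω < ⊤) (ζ : ℂ) :
    IntegrableOn (fun z : ℂ => (z - ζ)⁻¹) Ω := by
  have h := integrableOn_norm_sub_rpow hA zero_le_one one_lt_two ζ
  refine Integrable.mono' h (by fun_prop) (ae_of_all _ fun z => ?_)
  simp [Real.rpow_neg_one]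

theorem integral_circle_polar (r : ℝ) (hr : 0 < r) (ζ : ℂ) (hζ : ‖ζ‖ ≠ r) :
    ∫ θ in Ioo (-Real.pi) Real.pi, ((r : ℂ) * (Real.cos θ + Real.sin θ * I) - ζ)⁻¹ =
      if r < ‖ζ‖ then -(2 * Real.pi) / ζ else 0 := by
  have hpi := Real.pi_pos
  rw [← integral_Ioc_eq_integral_Ioo, ← intervalIntegral.integral_of_le (by linarith)]
  set g : ℂ → ℂ := fun z => (z * (z - ζ))⁻¹ * I⁻¹ with hg
  have hcm : ∀ θ : ℝ, (r : ℂ) * (Real.cos θ + Real.sin θ * I) = circleMap 0 r θ := by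
    intro θ
    simp [circleMap, Complex.exp_mul_I]
  have hne : ∀ θ, circleMap 0 r θ ≠ 0 := fun θ => by simp [hr.ne']
  have hper : Function.Periodic (fun θ : ℝ => (circleMap 0 r θ - ζ)⁻¹) (2 * Real.pi) := by
    intro θ
    simp only [periodic_circleMap 0 r θ]
  have h1 : ∫ θ in (-Real.pi)..Real.pi, ((r : ℂ) * (Real.cos θ + Real.sin θ * I) - ζ)⁻¹ =
      ∮ z in C(0, r), g z := by
    simp_rw [hcm]
    have := hper.intervalIntegral_add_eq (-Real.pi) 0
    rw [show -Real.pi + 2 * Real.pi = Real.pi by ring, zero_add] at this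
    rw [this, circleIntegral]
    congr 1
    ext θ
    simp only [deriv_circleMap, smul_eq_mul, hg]
    field_simp [hne θ]
  rw [h1]
  rcases eq_or_ne ζ 0 with rfl | hz0
  · simp only [norm_zero, not_lt.2 hr.le, if_false]
    have : g = fun z => I⁻¹ * (z - 0) ^ (-2 : ℤ) := by
      ext z; simp [hg]; ring
    rw [this, circleIntegral.integral_const_mul, circleIntegral.integral_sub_zpow_of_ne (by norm_num)]
    simp
  have h2 : ∮ z in C(0, r), g z = ∮ z in C(0, r), (ζ⁻¹ * I⁻¹) * ((z - ζ)⁻¹ - (z - 0)⁻¹) := by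
    apply circleIntegral.integral_congr hr.le
    intro z hz
    have hz1 : ‖z‖ = r := by simpa using hz
    have hz2 : z ≠ 0 := by rintro rfl; simp at hz1; linarith
    have hz3 : z - ζ ≠ 0 := by
      intro h; rw [sub_eq_zero] at h; exact hζ (h ▸ hz1)
    simp only [hg, sub_zero]
    field_simp
    ring
  rw [h2, circleIntegral.integral_const_mul, circleIntegral.integral_sub]
  rotate_left
  · rw [circleIntegrable_sub_inv_iff]
    right
    simp [abs_of_pos hr, hζ]
  · rw [circleIntegrable_sub_inv_iff]
    right
    simp [abs_of_pos hr, hr.ne]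
  rw [circleIntegral.integral_sub_center_inv _ hr.ne']
  split_ifs with h
  · have : ∮ z in C(0, r), (z - ζ)⁻¹ = 0 := by
      apply DiffContOnCl.circleIntegral_eq_zero hr.le
      apply DifferentiableOn.diffContOnCl
      rw [closure_ball _ hr.ne']
      intro z hz
      have : z - ζ ≠ 0 := by
        intro h'; rw [sub_eq_zero] at h'
        have : ‖z‖ ≤ r := by simpa using hz
        rw [h'] at this; linarith
      fun_prop (disch := exact this)
    rw [this]
    field_simp
    ring
  · rw [circleIntegral.integral_sub_inv_of_mem_ball]
    · simp
    · simp
      exact lt_of_le_of_ne (not_lt.1 h) hζ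

theorem integral_ball_inv_sub {R : ℝ} {ζ : ℂ} (hζ : ‖ζ‖ < R) :
    ∫ z in ball (0 : ℂ) R, (z - ζ)⁻¹ = -Real.pi * conj ζ := by
  have hR : 0 < R := (norm_nonneg _).trans_lt hζ
  set F : ℂ → ℂ := (ball (0 : ℂ) R).indicator fun z => (z - ζ)⁻¹ with hF
  have hFi : Integrable F := by
    rw [hF, integrable_indicator_iff measurableSet_ball]
    exact integrableOn_inv_sub measure_ball_lt_top ζ
  set G : ℝ × ℝ → ℂ := fun p => p.1 • F (Complex.polarCoord.symm p) with hG
  have hGi : IntegrableOn G (Ioi (0 : ℝ) ×ˢ Ioo (-Real.pi) Real.pi) := by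
    refine ⟨?_, ?_⟩
    · have hm : Measurable F := Measurable.indicator (by fun_prop) measurableSet_ball
      have : Measurable G := by
        simp only [hG, Complex.polarCoord_symm_apply]
        apply Measurable.smul measurable_fst
        apply hm.comp
        fun_prop
      exact this.aestronglyMeasurable
    · rw [HasFiniteIntegral]
      have h := Complex.lintegral_comp_polarCoord_symm (fun z => ‖F z‖ₑ)
      rw [polarCoord_target] at h
      have h2 : ∫⁻ p in Ioi (0 : ℝ) ×ˢ Ioo (-Real.pi) Real.pi, ‖G p‖ₑ = ∫⁻ p, ‖F p‖ₑ := by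
        rw [← h]
        apply setLIntegral_congr_fun (measurableSet_Ioi.prod measurableSet_Ioo)
        intro p hp
        simp only [hG, enorm_smul, smul_eq_mul]
        congr 1
        exact Real.enorm_of_nonneg (le_of_lt hp.1)
      rw [h2]
      exact hFi.2
  have hpol := Complex.integral_comp_polarCoord_symm F
  rw [polarCoord_target] at hpol
  rw [← integral_indicator measurableSet_ball, ← hF, ← hpol, Measure.volume_eq_prod,
    setIntegral_prod _ hGi]
  have key : ∀ᵐ r : ℝ, r ∈ Ioi (0 : ℝ) → (∫ θ in Ioo (-Real.pi) Real.pi, r • F (Complex.polarCoord.symm (r, θ)))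
      = (Ioo 0 ‖ζ‖).indicator (fun r : ℝ => (r : ℂ) * (-(2 * Real.pi) / ζ)) r := by
    have : ∀ᵐ r : ℝ, r ≠ ‖ζ‖ := by simp [ae_iff, measure_singleton]
    filter_upwards [this] with r hr1 hr0
    have hr0 : 0 < r := hr0
    simp only [Complex.polarCoord_symm_apply]
    by_cases hrR : r < R
    · have : ∀ θ : ℝ, F ((r : ℂ) * (Real.cos θ + Real.sin θ * I)) =
          ((r : ℂ) * (Real.cos θ + Real.sin θ * I) - ζ)⁻¹ := by
        intro θ
        apply indicator_of_mem
        have := Complex.norm_polarCoord_symm (r, θ)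
        rw [Complex.polarCoord_symm_apply] at this
        simp only [mem_ball_zero_iff, this, abs_of_pos hr0, hrR]
      simp only [this]
      rw [integral_smul, integral_circle_polar r hr0 ζ hr1.symm]
      simp only [indicator, mem_Ioo, hr0, true_and]
      split_ifs <;> simp
    · have : ∀ θ : ℝ, F ((r : ℂ) * (Real.cos θ + Real.sin θ * I)) = 0 := by
        intro θ
        apply indicator_of_notMem
        have := Complex.norm_polarCoord_symm (r, θ)
        rw [Complex.polarCoord_symm_apply] at this
        simp only [mem_ball_zero_iff, this, abs_of_pos hr0, hrR, not_false_eq_true]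
      simp only [this]
      rw [indicator_of_notMem]
      · simp
      · simp only [mem_Ioo, not_and]
        intro _
        linarith
  have e1 : ∫ x in Ioi (0:ℝ), ∫ y in Ioo (-Real.pi) Real.pi, (x, y).1 • F (Complex.polarCoord.symm (x, y))
     = ∫ r in Ioi (0:ℝ), (Ioo 0 ‖ζ‖).indicator (fun r : ℝ => (r : ℂ) * (-(2 * Real.pi) / ζ)) r :=
    setIntegral_congr_ae measurableSet_Ioi key
  rw [e1, setIntegral_indicator measurableSet_Ioo,
    inter_eq_self_of_subset_right Ioo_subset_Ioi_self, ← integral_Ioc_eq_integral_Ioo,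
    ← intervalIntegral.integral_of_le (norm_nonneg _)]
  rw [intervalIntegral.integral_mul_const, intervalIntegral.integral_ofReal, integral_id]
  rcases eq_or_ne ζ 0 with rfl | hz
  · simp
  have := Complex.mul_conj' ζ
  have h2 : ((‖ζ‖ ^ 2 : ℝ) : ℂ) = ζ * conj ζ := by rw [this]; push_cast; rfl
  push_cast at h2 ⊢
  rw [h2]
  field_simp
  simp

/-- The Cauchy transform of the area measure on `Ω`. -/
def cauchyTransform (Ω : Set ℂ) (ζ : ℂ) : ℂ := ∫ z in Ω, (z - ζ)⁻¹

theorem exists_integral_norm_sub_rpow_le {Ω : Set ℂ} (hA : volume Ω < ⊤) :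
    ∃ A : ℝ, 0 ≤ A ∧ ∀ ζ : ℂ, ∫ z in Ω, ‖z - ζ‖ ^ (-(3 / 2) : ℝ) ≤ A := by
  set g : ℂ → ℝ := (ball (0 : ℂ) 1).indicator fun z => ‖z‖ ^ (-(3 / 2) : ℝ) with hg
  have hgi : Integrable g := by
    rw [hg, integrable_indicator_iff measurableSet_ball]
    exact integrableOn_norm_rpow_ball (by norm_num) 1
  have hg0 : ∀ z, 0 ≤ g z := fun z => indicator_nonneg (fun z _ => by positivity) z
  have h1 : IntegrableOn (fun _ : ℂ => (1 : ℝ)) Ω := by simpa [integrableOn_const_iff] using hA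
  refine ⟨(∫ z in Ω, (1 : ℝ)) + ∫ z, g z, add_nonneg (by positivity) (integral_nonneg hg0),
    fun ζ => ?_⟩
  have hgs : Integrable fun z => g (z - ζ) := hgi.comp_sub_right ζ
  calc ∫ z in Ω, ‖z - ζ‖ ^ (-(3 / 2) : ℝ) ≤ ∫ z in Ω, (1 + g (z - ζ)) := by
        refine setIntegral_mono (integrableOn_norm_sub_rpow hA (by norm_num) (by norm_num) ζ)
          (h1.add hgs.integrableOn) fun z => ?_
        by_cases h : z - ζ ∈ ball (0 : ℂ) 1
        · simp [hg, indicator_of_mem h]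
        · rw [hg]
          simp only [indicator_of_notMem h, add_zero]
          apply Real.rpow_le_one_of_one_le_of_nonpos
          · simpa using h
          · norm_num
    _ = (∫ z in Ω, (1 : ℝ)) + ∫ z in Ω, g (z - ζ) := integral_add h1 hgs.integrableOn
    _ ≤ _ := by
        gcongr
        rw [← integral_sub_right_eq_self g ζ]
        exact setIntegral_le_integral hgs (ae_of_all _ fun z => hg0 _)

theorem rpow_half_mul_le {a b : ℝ} (ha : 0 ≤ a) (hb : 0 ≤ b) :
    a ^ (-(1 / 2) : ℝ) * b ^ (-1 : ℝ) ≤ a ^ (-(3 / 2) : ℝ) + b ^ (-(3 / 2) : ℝ) := by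
  rcases ha.eq_or_lt with rfl | ha
  · rw [Real.zero_rpow (by norm_num)]; simp; positivity
  rcases hb.eq_or_lt with rfl | hb
  · rw [Real.zero_rpow (x := -1) (by norm_num)]; simp; positivity
  rcases le_total a b with h | h
  · have : b ^ (-1 : ℝ) ≤ a ^ (-1 : ℝ) := Real.rpow_le_rpow_of_nonpos ha h (by norm_num)
    calc _ ≤ a ^ (-(1 / 2) : ℝ) * a ^ (-1 : ℝ) := by gcongr
      _ = a ^ (-(3 / 2) : ℝ) := by rw [← Real.rpow_add ha]; norm_num
      _ ≤ _ := by linarith [Real.rpow_nonneg hb.le (-(3 / 2) : ℝ)]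
  · have : a ^ (-(1 / 2) : ℝ) ≤ b ^ (-(1 / 2) : ℝ) :=
      Real.rpow_le_rpow_of_nonpos hb h (by norm_num)
    calc _ ≤ b ^ (-(1 / 2) : ℝ) * b ^ (-1 : ℝ) := by gcongr
      _ = b ^ (-(3 / 2) : ℝ) := by rw [← Real.rpow_add hb]; norm_num
      _ ≤ _ := by linarith [Real.rpow_nonneg ha.le (-(3 / 2) : ℝ)]

theorem norm_inv_sub_inv_le (z ζ ζ' : ℂ) (h : z ≠ ζ) (h' : z ≠ ζ') :
    ‖(z - ζ)⁻¹ - (z - ζ')⁻¹‖ ≤ ‖ζ - ζ'‖ ^ (1 / 2 : ℝ) *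
      (2 * (‖z - ζ‖ ^ (-(3 / 2) : ℝ) + ‖z - ζ'‖ ^ (-(3 / 2) : ℝ))) := by
  have ha : 0 < ‖z - ζ‖ := norm_pos_iff.2 (sub_ne_zero.2 h)
  have hb : 0 < ‖z - ζ'‖ := norm_pos_iff.2 (sub_ne_zero.2 h')
  have e : (z - ζ)⁻¹ - (z - ζ')⁻¹ = (ζ - ζ') * ((z - ζ)⁻¹ * (z - ζ')⁻¹) := by
    have := sub_ne_zero.2 h
    have := sub_ne_zero.2 h'
    field_simp
    ring
  have hd : ‖ζ - ζ'‖ ≤ ‖z - ζ‖ + ‖z - ζ'‖ := by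
    have := norm_sub_le (z - ζ') (z - ζ)
    rw [sub_sub_sub_cancel_left] at this
    linarith
  rw [e, norm_mul, norm_mul, norm_inv, norm_inv]
  set a := ‖z - ζ‖
  set b := ‖z - ζ'‖
  set d := ‖ζ - ζ'‖
  have hd0 : 0 ≤ d := norm_nonneg _
  have h1 : d = d ^ (1 / 2 : ℝ) * d ^ (1 / 2 : ℝ) := by
    rw [← Real.rpow_add_of_nonneg hd0 (by norm_num) (by norm_num)]; norm_num
  have h2 : d ^ (1 / 2 : ℝ) ≤ a ^ (1 / 2 : ℝ) + b ^ (1 / 2 : ℝ) :=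
    (Real.rpow_le_rpow hd0 hd (by norm_num)).trans
      (Real.rpow_add_le_add_rpow ha.le hb.le (by norm_num) (by norm_num))
  have hai : a⁻¹ = a ^ (-1 : ℝ) := (Real.rpow_neg_one a).symm
  have hbi : b⁻¹ = b ^ (-1 : ℝ) := (Real.rpow_neg_one b).symm
  have h3 : a ^ (1 / 2 : ℝ) * a ^ (-1 : ℝ) = a ^ (-(1 / 2) : ℝ) := by
    rw [← Real.rpow_add ha]; norm_num
  have h4 : b ^ (1 / 2 : ℝ) * b ^ (-1 : ℝ) = b ^ (-(1 / 2) : ℝ) := by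
    rw [← Real.rpow_add hb]; norm_num
  have h5 := rpow_half_mul_le ha.le hb.le
  have h6 := rpow_half_mul_le hb.le ha.le
  calc d * (a⁻¹ * b⁻¹) = d ^ (1 / 2 : ℝ) * (d ^ (1 / 2 : ℝ) * (a ^ (-1 : ℝ) * b ^ (-1 : ℝ))) := by
        rw [← mul_assoc (d ^ (1 / 2 : ℝ)), ← h1, hai, hbi]
    _ ≤ d ^ (1 / 2 : ℝ) * ((a ^ (1 / 2 : ℝ) + b ^ (1 / 2 : ℝ)) * (a ^ (-1 : ℝ) * b ^ (-1 : ℝ))) := by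
        gcongr
    _ = d ^ (1 / 2 : ℝ) * ((a ^ (1 / 2 : ℝ) * a ^ (-1 : ℝ)) * b ^ (-1 : ℝ) +
          (b ^ (1 / 2 : ℝ) * b ^ (-1 : ℝ)) * a ^ (-1 : ℝ)) := by ring
    _ ≤ _ := by
        rw [h3, h4]
        gcongr
        linarith

theorem continuous_cauchyTransform {Ω : Set ℂ} (hA : volume Ω < ⊤) :
    Continuous (cauchyTransform Ω) := by
  obtain ⟨A, hA0, hAb⟩ := exists_integral_norm_sub_rpow_le hA
  have key : ∀ ζ ζ', ‖cauchyTransform Ω ζ - cauchyTransform Ω ζ'‖ ≤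
      ‖ζ - ζ'‖ ^ (1 / 2 : ℝ) * (2 * (A + A)) := by
    intro ζ ζ'
    have hi := integrableOn_norm_sub_rpow hA (p := 3 / 2) (by norm_num) (by norm_num)
    rw [cauchyTransform, cauchyTransform, ← integral_sub (integrableOn_inv_sub hA ζ)
      (integrableOn_inv_sub hA ζ')]
    calc _ ≤ ∫ z in Ω, ‖ζ - ζ'‖ ^ (1 / 2 : ℝ) *
          (2 * (‖z - ζ‖ ^ (-(3 / 2) : ℝ) + ‖z - ζ'‖ ^ (-(3 / 2) : ℝ))) := by
          apply norm_integral_le_of_norm_le ((((hi ζ).add (hi ζ')).const_mul _).const_mul _)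
          have h1 : ∀ᵐ z : ℂ ∂(volume.restrict Ω), z ≠ ζ := ae_restrict_of_ae (by
            simp [ae_iff, measure_singleton])
          have h2 : ∀ᵐ z : ℂ ∂(volume.restrict Ω), z ≠ ζ' := ae_restrict_of_ae (by
            simp [ae_iff, measure_singleton])
          filter_upwards [h1, h2] with z hz hz'
          exact norm_inv_sub_inv_le z ζ ζ' hz hz'
      _ = ‖ζ - ζ'‖ ^ (1 / 2 : ℝ) * (2 * ((∫ z in Ω, ‖z - ζ‖ ^ (-(3 / 2) : ℝ)) +
          ∫ z in Ω, ‖z - ζ'‖ ^ (-(3 / 2) : ℝ))) := by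
          rw [integral_const_mul, integral_const_mul, integral_add (hi ζ) (hi ζ')]
      _ ≤ _ := by
          have := hAb ζ
          have := hAb ζ'
          gcongr
  rw [continuous_iff_continuousAt]
  intro ζ₀
  rw [ContinuousAt, tendsto_iff_norm_sub_tendsto_zero]
  refine squeeze_zero (fun _ => norm_nonneg _) (fun ζ => key ζ ζ₀) ?_
  have : ContinuousAt (fun ζ : ℂ => ‖ζ - ζ₀‖ ^ (1 / 2 : ℝ) * (2 * (A + A))) ζ₀ := by
    have := Real.continuous_rpow_const (q := 1 / 2) (by norm_num)
    exact ((this.comp (by fun_prop : Continuous fun ζ : ℂ => ‖ζ - ζ₀‖)).mul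
      continuous_const).continuousAt
  have h := this.tendsto
  simpa [Real.zero_rpow] using h

theorem tendsto_cauchyTransform_cocompact {Ω : Set ℂ} (hA : volume Ω < ⊤) :
    Tendsto (cauchyTransform Ω) (cocompact ℂ) (𝓝 0) := by
  obtain ⟨A, hA0, hAb⟩ := exists_integral_norm_sub_rpow_le hA
  rw [tendsto_zero_iff_norm_tendsto_zero]
  have hpt : ∀ z ζ : ℂ, ∀ M : ℝ, 0 < M → ‖(z - ζ)⁻¹‖ ≤ min ‖(z - ζ)⁻¹‖ M +
      M ^ (-(1 / 2) : ℝ) * ‖z - ζ‖ ^ (-(3 / 2) : ℝ) := by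
    intro z ζ M hM
    rcases le_total ‖(z - ζ)⁻¹‖ M with h | h
    · rw [min_eq_left h]
      have : 0 ≤ M ^ (-(1 / 2) : ℝ) * ‖z - ζ‖ ^ (-(3 / 2) : ℝ) := by positivity
      linarith
    · rw [min_eq_right h]
      have h0 : 0 < ‖(z - ζ)⁻¹‖ := hM.trans_le h
      rw [norm_inv] at h h0 ⊢
      have ha : 0 < ‖z - ζ‖ := inv_pos.1 h0
      have h2 : ‖z - ζ‖ ≤ M⁻¹ := (le_inv_comm₀ hM ha).1 h
      have h3 : ‖z - ζ‖ ^ (1 / 2 : ℝ) ≤ M ^ (-(1 / 2) : ℝ) := by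
        rw [Real.rpow_neg hM.le, ← Real.inv_rpow hM.le]
        exact Real.rpow_le_rpow ha.le h2 (by norm_num)
      have h4 : ‖z - ζ‖⁻¹ = ‖z - ζ‖ ^ (1 / 2 : ℝ) * ‖z - ζ‖ ^ (-(3 / 2) : ℝ) := by
        rw [← Real.rpow_add ha, ← Real.rpow_neg_one]; norm_num
      rw [h4]
      have : ‖z - ζ‖ ^ (1 / 2 : ℝ) * ‖z - ζ‖ ^ (-(3 / 2) : ℝ) ≤
        M ^ (-(1 / 2) : ℝ) * ‖z - ζ‖ ^ (-(3 / 2) : ℝ) := by gcongr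
      linarith
  have : (cocompact ℂ).IsCountablyGenerated := by
    rw [← Metric.cobounded_eq_cocompact, ← comap_norm_atTop]
    infer_instance
  have hmin : ∀ M : ℝ, 0 < M →
      Tendsto (fun ζ => ∫ z in Ω, min ‖(z - ζ)⁻¹‖ M) (cocompact ℂ) (𝓝 0) := by
    intro M hM
    have : Tendsto (fun ζ => ∫ z in Ω, min ‖(z - ζ)⁻¹‖ M) (cocompact ℂ)
        (𝓝 (∫ z in Ω, (0 : ℝ))) := by
      refine tendsto_integral_filter_of_dominated_convergence (fun _ => M) ?_ ?_ ?_ ?_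
      · refine .of_forall fun ζ => ?_
        apply Measurable.aestronglyMeasurable
        fun_prop
      · refine .of_forall fun ζ => ae_of_all _ fun z => ?_
        rw [Real.norm_of_nonneg (by positivity)]
        exact min_le_right _ _
      · exact integrableOn_const hA.ne
      · refine ae_of_all _ fun z => ?_
        have h1 : Tendsto (fun ζ : ℂ => (z - ζ)⁻¹) (cocompact ℂ) (𝓝 0) := by
          apply tendsto_inv₀_cobounded.comp
          rw [← Metric.cobounded_eq_cocompact]
          exact tendsto_const_sub_cobounded z
        have h2 : Tendsto (fun ζ : ℂ => min ‖(z - ζ)⁻¹‖ M) (cocompact ℂ) (𝓝 (min ‖(0 : ℂ)‖ M)) :=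
          (h1.norm).min tendsto_const_nhds
        simpa [min_eq_left hM.le] using h2
    simpa using this
  have hbound : ∀ M : ℝ, 0 < M → ∀ ζ, ‖cauchyTransform Ω ζ‖ ≤
      (∫ z in Ω, min ‖(z - ζ)⁻¹‖ M) + M ^ (-(1 / 2) : ℝ) * A := by
    intro M hM ζ
    have hi := integrableOn_norm_sub_rpow hA (p := 3 / 2) (by norm_num) (by norm_num) ζ
    have him : IntegrableOn (fun z => min ‖(z - ζ)⁻¹‖ M) Ω := by
      refine (integrableOn_inv_sub hA ζ).norm.mono'
        (Measurable.aestronglyMeasurable (by fun_prop)) (ae_of_all _ fun z => ?_)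
      rw [Real.norm_of_nonneg (by positivity)]
      exact min_le_left _ _
    calc _ ≤ ∫ z in Ω, (min ‖(z - ζ)⁻¹‖ M + M ^ (-(1 / 2) : ℝ) * ‖z - ζ‖ ^ (-(3 / 2) : ℝ)) :=
          norm_integral_le_of_norm_le (him.add (hi.const_mul _))
            (ae_of_all _ fun z => hpt z ζ M hM)
      _ = (∫ z in Ω, min ‖(z - ζ)⁻¹‖ M) +
          M ^ (-(1 / 2) : ℝ) * ∫ z in Ω, ‖z - ζ‖ ^ (-(3 / 2) : ℝ) := by
          rw [integral_add him (hi.const_mul _), integral_const_mul]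
      _ ≤ _ := by gcongr; exact hAb ζ
  rw [Metric.tendsto_nhds]
  intro ε hε
  have hM : ∃ M : ℝ, 0 < M ∧ M ^ (-(1 / 2) : ℝ) * A < ε / 2 := by
    have h1 : Tendsto (fun M : ℝ => M ^ (-(1 / 2) : ℝ) * A) atTop (𝓝 (0 * A)) :=
      (tendsto_rpow_neg_atTop (by norm_num)).mul_const A
    rw [zero_mul] at h1
    have := (h1.eventually (gt_mem_nhds (half_pos hε))).and (eventually_gt_atTop 0)
    obtain ⟨M, h, h'⟩ := this.exists
    exact ⟨M, h', h⟩
  obtain ⟨M, hM0, hM1⟩ := hM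
  filter_upwards [(hmin M hM0).eventually (gt_mem_nhds (half_pos hε))] with ζ hζ
  have := hbound M hM0 ζ
  simp only [dist_zero_right, norm_norm]
  linarith

theorem differentiableAt_integral_inv_sub {A : Set ℂ} (hA : volume A < ⊤)
    {a : ℂ} {R : ℝ} (hR : 0 < R) (hd : Disjoint A (ball a R)) (hm : MeasurableSet A) :
    DifferentiableAt ℂ (fun ζ => ∫ z in A, (z - ζ)⁻¹) a := by
  have hfar : ∀ z ∈ A, ∀ ζ ∈ ball a (R / 2), R / 2 ≤ ‖z - ζ‖ := by
    intro z hz ζ hζ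
    have h1 : R ≤ dist z a := by
      by_contra h
      exact Set.disjoint_left.1 hd hz (not_le.1 h)
    have h2 := dist_triangle z ζ a
    rw [mem_ball] at hζ
    rw [← dist_eq_norm]
    linarith
  refine (hasDerivAt_integral_of_dominated_loc_of_deriv_le (μ := volume.restrict A)
    (F := fun ζ z => (z - ζ)⁻¹) (F' := fun ζ z => ((z - ζ) ^ 2)⁻¹) (bound := fun _ => ((R / 2) ^ 2)⁻¹)
    (ball_mem_nhds a (half_pos hR)) ?_ (integrableOn_inv_sub hA a) ?_ ?_ ?_ ?_).2.differentiableAt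
  · exact .of_forall fun ζ => Measurable.aestronglyMeasurable (by fun_prop)
  · exact Measurable.aestronglyMeasurable (by fun_prop)
  · filter_upwards [ae_restrict_mem hm] with z hz ζ hζ
    have := hfar z hz ζ hζ
    rw [norm_inv, norm_pow]
    gcongr
  · exact integrableOn_const hA.ne
  · filter_upwards [ae_restrict_mem hm] with z hz ζ hζ
    have := hfar z hz ζ hζ
    have hne : z - ζ ≠ 0 := by
      rw [← norm_pos_iff]; linarith
    have h := ((hasDerivAt_id ζ).const_sub z).fun_inv hne
    simpa using h

theorem differentiableOn_cauchyTransform_add {Ω : Set ℂ} (hΩ : IsOpen Ω) (hA : volume Ω < ⊤) :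
    DifferentiableOn ℂ (fun ζ => cauchyTransform Ω ζ + Real.pi * conj ζ) Ω := by
  intro a ha
  apply DifferentiableAt.differentiableWithinAt
  obtain ⟨R, hR, hsub⟩ := Metric.isOpen_iff.1 hΩ a ha
  have hd := differentiableAt_integral_inv_sub (A := Ω \ ball a R)
    ((measure_mono sdiff_subset).trans_lt hA) hR disjoint_sdiff_left
    (hΩ.measurableSet.diff measurableSet_ball)
  refine (hd.add_const (Real.pi * conj a)).congr_of_eventuallyEq ?_
  filter_upwards [ball_mem_nhds a hR] with ζ hζ
  have h1 : cauchyTransform Ω ζ = (∫ z in ball a R, (z - ζ)⁻¹) + ∫ z in Ω \ ball a R, (z - ζ)⁻¹ := by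
    rw [cauchyTransform, ← setIntegral_union disjoint_sdiff_right
      (hΩ.measurableSet.diff measurableSet_ball)
      ((integrableOn_inv_sub hA ζ).mono_set hsub) ((integrableOn_inv_sub hA ζ).mono_set sdiff_subset),
      union_sdiff_cancel hsub]
  have h2 : ∫ z in ball a R, (z - ζ)⁻¹ = -Real.pi * conj (ζ - a) := by
    rw [← integral_ball_inv_sub (R := R) (by rwa [mem_ball, dist_eq_norm] at hζ),
      ← integral_indicator measurableSet_ball, ← integral_indicator measurableSet_ball,
      ← integral_sub_right_eq_self (fun z => indicator (ball 0 R) (fun z => (z - (ζ - a))⁻¹) z) a]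
    congr 1
    ext z
    simp [indicator, dist_eq_norm]
  rw [h1, h2, map_sub]
  ring

theorem exists_log_branch_away {Ω E : Set ℂ} (hE : IsPreconnected E) (hEΩ : E ⊆ Ωᶜ) {ζ ζ' : ℂ}
    (hζ : ζ ∈ E) (hζ' : ζ' ∈ E) {ε : ℝ} (hε : 0 < ε) :
    ∃ L : ℂ → ℂ, DifferentiableOn ℂ L {z | z ∈ Ω ∧ ε < infDist z Ωᶜ} ∧
      ∀ z ∈ {z | z ∈ Ω ∧ ε < infDist z Ωᶜ}, exp (L z) = (z - ζ') / (z - ζ) := by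
  set U := {z | z ∈ Ω ∧ ε < infDist z Ωᶜ} with hU
  have hne : ∀ z ∈ U, ∀ x ∈ E, z - x ≠ 0 := by
    intro z hz x hx h
    rw [sub_eq_zero] at h
    exact hEΩ hx (h ▸ hz.1)
  refine IsPreconnected.induction₂' hE (fun x y => ∃ L : ℂ → ℂ, DifferentiableOn ℂ L U ∧
      ∀ z ∈ U, exp (L z) = (z - y) / (z - x)) ?_ ?_ hζ hζ'
  · intro x hx
    have : ∀ᶠ y in 𝓝[E] x, dist y x < ε :=
      nhdsWithin_le_nhds (Metric.ball_mem_nhds x hε)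
    filter_upwards [this, self_mem_nhdsWithin] with y hy hyE
    have hlog : ∀ a ∈ E, ∀ b ∈ E, dist a b < ε → ∃ L : ℂ → ℂ, DifferentiableOn ℂ L U ∧
      ∀ z ∈ U, exp (L z) = (z - a) / (z - b) := by
      intro a ha b hb hab
      refine ⟨fun z => log ((z - a) / (z - b)), fun z hz => ?_, fun z hz => exp_log ?_⟩
      · have h1 := hne z hz b hb
        have h2 : (z - a) / (z - b) ∈ slitPlane := by
          have : (z - a) / (z - b) = 1 + (b - a) / (z - b) := by field_simp; ring
          rw [this]
          apply mem_slitPlane_of_norm_lt_one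
          rw [norm_div, div_lt_one (norm_pos_iff.2 h1), ← dist_eq_norm, ← dist_eq_norm, dist_comm]
          exact hab.trans (hz.2.trans_le (infDist_le_dist_of_mem (hEΩ hb)))
        apply DifferentiableAt.differentiableWithinAt
        exact DifferentiableAt.clog (f := fun z => (z - a) / (z - b))
          (by fun_prop (disch := exact h1)) h2
      · exact div_ne_zero (hne z hz a ha) (hne z hz b hb)
    exact ⟨hlog y hyE x hx hy, hlog x hx y hyE (by rwa [dist_comm])⟩
  · rintro x y w hx hy hw ⟨L, hL, hLe⟩ ⟨L', hL', hLe'⟩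
    refine ⟨fun z => L z + L' z, hL.add hL', fun z hz => ?_⟩
    rw [exp_add, hLe z hz, hLe' z hz]
    have := hne z hz y hy
    have := hne z hz x hx
    field_simp

theorem exists_log_branch {Ω E : Set ℂ} (hΩ : IsOpen Ω) (hc : IsConnected Ω)
    (hE : IsPreconnected E) (hEΩ : E ⊆ Ωᶜ) {ζ ζ' : ℂ} (hζ : ζ ∈ E) (hζ' : ζ' ∈ E) :
    ∃ L : ℂ → ℂ, DifferentiableOn ℂ L Ω ∧ ∀ z ∈ Ω, exp (L z) = (z - ζ') / (z - ζ) := by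
  obtain ⟨z₀, hz₀⟩ := hc.nonempty
  have hpc : IsPathConnected Ω := (hΩ.isConnected_iff_isPathConnected).1 hc
  have hcne : Ωᶜ.Nonempty := ⟨ζ, hEΩ hζ⟩
  set U : ℕ → Set ℂ := fun n => {z | z ∈ Ω ∧ 1 / ((n : ℝ) + 1) < infDist z Ωᶜ} with hU
  have hUo : ∀ n, IsOpen (U n) := fun n =>
    hΩ.inter (isOpen_lt continuous_const (continuous_infDist_pt _))
  have hUm : ∀ n m, n ≤ m → U n ⊆ U m := by
    intro n m hnm z hz
    refine ⟨hz.1, lt_of_le_of_lt ?_ hz.2⟩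
    gcongr
  set V : ℕ → Set ℂ := fun n => connectedComponentIn (U n) z₀ with hV
  have hVo : ∀ n, IsOpen (V n) := fun n => (hUo n).connectedComponentIn
  have hVp : ∀ n, IsPreconnected (V n) := fun n => isPreconnected_connectedComponentIn
  have hVU : ∀ n, V n ⊆ U n := fun n => connectedComponentIn_subset _ _
  have hVm : ∀ n m, n ≤ m → V n ⊆ V m := fun n m h => connectedComponentIn_mono _ (hUm n m h)
  have hVz : ∀ n, (V n).Nonempty → z₀ ∈ V n := by
    intro n h
    exact mem_connectedComponentIn (connectedComponentIn_nonempty_iff.1 h)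
  have hex : ∀ z ∈ Ω, ∃ n, z ∈ V n := by
    intro z hz
    obtain ⟨γ, hγ⟩ := hpc.joinedIn z₀ hz₀ z hz
    have hcomp : IsCompact (range γ) := isCompact_range γ.continuous
    obtain ⟨x, hx, hmin⟩ := hcomp.exists_isMinOn (range_nonempty γ)
      (continuous_infDist_pt Ωᶜ).continuousOn
    have hpos : 0 < infDist x Ωᶜ := by
      obtain ⟨t, rfl⟩ := hx
      exact (hΩ.isClosed_compl.notMem_iff_infDist_pos hcne).1 (fun h => h (hγ t))
    obtain ⟨n, hn⟩ := exists_nat_one_div_lt hpos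
    refine ⟨n, ?_⟩
    have hsub : range γ ⊆ U n := by
      rintro _ ⟨t, rfl⟩
      exact ⟨hγ t, hn.trans_le (hmin (mem_range_self t))⟩
    have hpre : IsPreconnected (range γ) := isPreconnected_range γ.continuous
    exact hpre.subset_connectedComponentIn ⟨0, γ.source⟩ hsub ⟨1, γ.target⟩
  have hne : ∀ z ∈ Ω, (z - ζ') / (z - ζ) ≠ 0 := by
    intro z hz
    apply div_ne_zero
    · intro h; rw [sub_eq_zero] at h; exact hEΩ hζ' (h ▸ hz)
    · intro h; rw [sub_eq_zero] at h; exact hEΩ hζ (h ▸ hz)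
  set ℓ := log ((z₀ - ζ') / (z₀ - ζ)) with hℓ
  have hexpℓ : exp ℓ = (z₀ - ζ') / (z₀ - ζ) := exp_log (hne z₀ hz₀)
  have hL : ∀ n, ∃ L : ℂ → ℂ, DifferentiableOn ℂ L (V n) ∧
      (∀ z ∈ V n, exp (L z) = (z - ζ') / (z - ζ)) ∧ L z₀ = ℓ := by
    intro n
    rcases (V n).eq_empty_or_nonempty with h | h
    · exact ⟨fun _ => ℓ, by simp [h], by simp [h], rfl⟩
    obtain ⟨L, hL1, hL2⟩ := exists_log_branch_away hE hEΩ hζ hζ' (ε := 1 / ((n : ℝ) + 1))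
      (by positivity)
    refine ⟨fun z => L z + (ℓ - L z₀), (hL1.mono (hVU n)).add_const _, fun z hz => ?_, by ring⟩
    rw [exp_add, exp_sub, hexpℓ, hL2 z (hVU n hz), hL2 z₀ (hVU n (hVz n h)),
      div_self (hne z₀ hz₀), mul_one]
  choose L hLd hLe hL0 using hL
  have hcons : ∀ n m, n ≤ m → ∀ z ∈ V n, L n z = L m z := by
    intro n m hnm z hz
    set h : ℂ → ℂ := fun z => L n z - L m z with hh
    have hd : DifferentiableOn ℂ h (V n) := (hLd n).sub ((hLd m).mono (hVm n m hnm))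
    have he : ∀ z ∈ V n, exp (h z) = 1 := by
      intro z hz
      rw [hh]
      simp only
      rw [exp_sub, hLe n z hz, hLe m z (hVm n m hnm hz), div_self (hne z (hVU n hz).1)]
    have hder : ∀ z ∈ V n, deriv h z = 0 := by
      intro z hz
      have h1 : HasDerivAt h (deriv h z) z :=
        ((hd z hz).differentiableAt ((hVo n).mem_nhds hz)).hasDerivAt
      have h2 := h1.cexp
      have h3 : HasDerivAt (fun z => exp (h z)) 0 z := by
        refine (hasDerivAt_const z (1 : ℂ)).congr_of_eventuallyEq ?_
        filter_upwards [(hVo n).mem_nhds hz] with w hw using he w hw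
      have h4 := h2.unique h3
      simpa [he z hz] using h4
    have hconst := (hVo n).is_const_of_deriv_eq_zero (hVp n) hd (fun z hz => hder z hz) hz
      (hVz n ⟨z, hz⟩)
    rw [hh] at hconst
    simp only [hL0, sub_self] at hconst
    exact sub_eq_zero.1 hconst
  choose! N hN using hex
  have hfin : ∀ n, ∀ z ∈ V n, L (N z) z = L n z := by
    intro n z hz
    have hz' := hN z (hVU n hz).1
    rcases le_total n (N z) with h | h
    · exact (hcons _ _ h z hz).symm
    · exact hcons _ _ h z hz'
  refine ⟨fun z => L (N z) z, fun z hz => ?_, fun z hz => hLe _ z (hN z hz)⟩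
  have hz' := hN z hz
  have h1 : DifferentiableAt ℂ (L (N z)) z := ((hLd _) z hz').differentiableAt ((hVo _).mem_nhds hz')
  refine (h1.congr_of_eventuallyEq ?_).differentiableWithinAt
  filter_upwards [(hVo _).mem_nhds hz'] with w hw using hfin _ w hw

theorem integral_curve_eq_zero_of_not_integrable {Ω : Set ℂ} {σ : ℝ → ℂ}
    (hσ : ContinuousOn σ (Icc 0 1)) (hσΩ : ∀ t ∈ Icc (0 : ℝ) 1, σ t ∈ Ω) {F : ℂ → ℂ}
    (hF : ContinuousOn F Ω) (hF0 : ∀ z ∈ Ω, F z ≠ 0)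
    (hbad : ¬ IntervalIntegrable (deriv σ) volume 0 1) :
    ∫ t in (0 : ℝ)..1, F (σ t) * deriv σ t = 0 := by
  apply intervalIntegral.integral_undef
  intro h
  apply hbad
  have hu : uIcc (0 : ℝ) 1 = Icc 0 1 := uIcc_of_le zero_le_one
  have hc : ContinuousOn (fun t => (F (σ t))⁻¹) (uIcc 0 1) := by
    rw [hu]
    exact (hF.comp hσ hσΩ).inv₀ fun t ht => hF0 _ (hσΩ t ht)
  refine (h.continuousOn_mul hc).congr_ae ?_
  refine (ae_restrict_mem measurableSet_uIoc).mono fun t ht => ?_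
  rw [uIoc_of_le zero_le_one] at ht
  have := hF0 _ (hσΩ t ⟨ht.1.le, ht.2⟩)
  simp [this]

theorem tendsto_integral_curve {Ω : Set ℂ} {σ : ℝ → ℂ}
    (hσ : ContinuousOn σ (Icc 0 1)) (hσΩ : ∀ t ∈ Icc (0 : ℝ) 1, σ t ∈ Ω) {F : ℕ → ℂ → ℂ}
    {G : ℂ → ℂ} (hΩ : IsOpen Ω) (hF : ∀ n, ContinuousOn (F n) Ω) (hG : ContinuousOn G Ω)
    (hFG : TendstoLocallyUniformlyOn F G atTop Ω)
    (hgood : IntervalIntegrable (deriv σ) volume 0 1) :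
    Tendsto (fun n => ∫ t in (0 : ℝ)..1, F n (σ t) * deriv σ t) atTop
      (𝓝 (∫ t in (0 : ℝ)..1, G (σ t) * deriv σ t)) := by
  have hK : IsCompact (σ '' Icc 0 1) := isCompact_Icc.image_of_continuousOn hσ
  have hKΩ : σ '' Icc 0 1 ⊆ Ω := by rintro _ ⟨t, ht, rfl⟩; exact hσΩ t ht
  have hu := (tendstoLocallyUniformlyOn_iff_forall_isCompact hΩ).1 hFG _ hKΩ hK
  obtain ⟨C, hC⟩ := hK.exists_bound_of_continuousOn (hG.mono hKΩ)
  rw [Metric.tendstoUniformlyOn_iff] at hu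
  have hio : uIoc (0 : ℝ) 1 = Ioc 0 1 := uIoc_of_le zero_le_one
  have hmem : ∀ t ∈ uIoc (0 : ℝ) 1, σ t ∈ σ '' Icc 0 1 := by
    intro t ht
    rw [hio] at ht
    exact ⟨t, ⟨ht.1.le, ht.2⟩, rfl⟩
  have huI : uIcc (0 : ℝ) 1 = Icc 0 1 := uIcc_of_le zero_le_one
  refine intervalIntegral.tendsto_integral_filter_of_dominated_convergence
    (fun t => (C + 1) * ‖deriv σ t‖) ?_ ?_ (hgood.norm.const_mul _) ?_
  · refine .of_forall fun n => ?_
    have hc : ContinuousOn (fun t => F n (σ t)) (uIcc 0 1) := by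
      rw [huI]
      exact (hF n).comp hσ hσΩ
    have := (hgood.continuousOn_mul hc).aestronglyMeasurable
    rwa [hio]
  · filter_upwards [hu 1 one_pos] with n hn
    refine ae_of_all _ fun t ht => ?_
    rw [norm_mul]
    gcongr
    have h1 := hn _ (hmem t ht)
    have h2 := hC _ (hmem t ht)
    rw [dist_comm, dist_eq_norm] at h1
    have := norm_le_norm_add_norm_sub (G (σ t)) (F n (σ t))
    rw [norm_sub_rev] at this
    linarith
  · refine ae_of_all _ fun t ht => Tendsto.mul_const _ ?_
    rw [Metric.tendsto_nhds]
    intro ε hε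
    filter_upwards [hu ε hε] with n hn
    rw [dist_comm]
    exact hn _ (hmem t ht)

theorem tendstoLocallyUniformlyOn_iteratedDeriv {Ω : Set ℂ} (hΩ : IsOpen Ω) {F : ℕ → ℂ → ℂ}
    {G : ℂ → ℂ} (hF : ∀ n, DifferentiableOn ℂ (F n) Ω)
    (hFG : TendstoLocallyUniformlyOn F G atTop Ω) (k : ℕ) :
    TendstoLocallyUniformlyOn (fun n => iteratedDeriv k (F n)) (iteratedDeriv k G) atTop Ω ∧
      ∀ n, DifferentiableOn ℂ (iteratedDeriv k (F n)) Ω := by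
  induction k with
  | zero => simpa using ⟨hFG, hF⟩
  | succ k ih =>
    simp only [iteratedDeriv_succ]
    exact ⟨ih.1.deriv (.of_forall ih.2) hΩ, fun n => (ih.2 n).deriv hΩ⟩

theorem tendsto_iteratedDerivWithin {Ω : Set ℂ} (hΩ : IsOpen Ω) {F : ℕ → ℂ → ℂ}
    {G : ℂ → ℂ} (hF : ∀ n, DifferentiableOn ℂ (F n) Ω)
    (hFG : TendstoLocallyUniformlyOn F G atTop Ω) (k : ℕ) {w : ℂ} (hw : w ∈ Ω) :
    Tendsto (fun n => iteratedDerivWithin k (F n) Ω w) atTop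
      (𝓝 (iteratedDerivWithin k G Ω w)) := by
  simp only [iteratedDerivWithin_of_isOpen hΩ hw]
  exact (tendstoLocallyUniformlyOn_iteratedDeriv hΩ hF hFG k).1.tendsto_at hw

theorem rpow_mul_rpow_le {a b δ p q : ℝ} (hδ : 0 < δ) (ha : 0 ≤ a) (hb : 0 ≤ b)
    (hab : 2 * δ ≤ a + b) (hp : 0 ≤ p) (hq : 0 ≤ q) :
    a ^ (-p) * b ^ (-q) ≤ δ ^ (-p) * b ^ (-q) + δ ^ (-q) * a ^ (-p) := by
  have ha' := Real.rpow_nonneg ha (-p)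
  have hb' := Real.rpow_nonneg hb (-q)
  have h1 := Real.rpow_nonneg hδ.le (-p)
  have h2 := Real.rpow_nonneg hδ.le (-q)
  by_cases h : δ ≤ a
  · have : a ^ (-p) ≤ δ ^ (-p) := Real.rpow_le_rpow_of_nonpos hδ h (by linarith)
    nlinarith [mul_nonneg h2 ha']
  · have : b ^ (-q) ≤ δ ^ (-q) := Real.rpow_le_rpow_of_nonpos hδ (by linarith) (by linarith)
    nlinarith [mul_nonneg h1 hb']

theorem rpow_neg_le_one_add {a p : ℝ} (ha : 0 < a) (hp : 0 ≤ p) (hp1 : p ≤ 1) :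
    a ^ (-p) ≤ 1 + a ^ (-1 : ℝ) := by
  have h1 := Real.rpow_nonneg ha.le (-1 : ℝ)
  rcases le_total a 1 with h | h
  · have := Real.rpow_le_rpow_of_exponent_ge ha h (neg_le_neg hp1)
    linarith
  · have := Real.rpow_le_one_of_one_le_of_nonpos h (neg_nonpos.2 hp)
    linarith

theorem exists_bergman_approx {Ω E : Set ℂ} (hΩ : IsOpen Ω) (hc : IsConnected Ω)
    (hA : volume Ω < ⊤) (hE : IsPreconnected E) (hEΩ : E ⊆ Ωᶜ) {ζ ζ' : ℂ} (hζ : ζ ∈ E)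
    (hζ' : ζ' ∈ E) (hne : ζ ≠ ζ') :
    ∃ F : ℕ → ℂ → ℂ, (∀ n, BergmanFun Ω (F n)) ∧ (∀ n, ∀ z ∈ Ω, F n z ≠ 0) ∧
      TendstoLocallyUniformlyOn F (fun z => (z - ζ)⁻¹) atTop Ω ∧
      Tendsto (fun n => ∫ z in Ω, F n z) atTop (𝓝 (cauchyTransform Ω ζ)) := by
  obtain ⟨L, hL, hLe⟩ := exists_log_branch hΩ hc hE hEΩ hζ hζ'
  set ε : ℕ → ℝ := fun n => 1 / ((n : ℝ) + 2) with hε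
  have hε0 : ∀ n, 0 < ε n := fun n => by positivity
  have hε1 : ∀ n, ε n ≤ 1 / 2 := fun n => by
    simp only [hε]
    gcongr
    linarith [n.cast_nonneg (α := ℝ)]
  have hεt : Tendsto ε atTop (𝓝 0) := by
    have := (tendsto_const_div_atTop_nhds_zero_nat (1 : ℝ)).comp (tendsto_add_atTop_nat 2)
    refine this.congr fun n => ?_
    simp [hε]
  have hzs : ∀ z ∈ Ω, z - ζ ≠ 0 := fun z hz h => hEΩ hζ (sub_eq_zero.1 h ▸ hz)
  have hzs' : ∀ z ∈ Ω, z - ζ' ≠ 0 := fun z hz h => hEΩ hζ' (sub_eq_zero.1 h ▸ hz)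
  set F : ℕ → ℂ → ℂ := fun n z => (z - ζ)⁻¹ * exp (-(ε n) * L z) with hF
  have hFd : ∀ n, DifferentiableOn ℂ (F n) Ω := by
    intro n
    have h1 : DifferentiableOn ℂ (fun z => (z - ζ)⁻¹) Ω :=
      DifferentiableOn.inv (by fun_prop) hzs
    exact h1.mul ((hL.const_mul _).cexp)
  have hnorm : ∀ n, ∀ z ∈ Ω, ‖F n z‖ = ‖z - ζ‖ ^ (-(1 - ε n)) * ‖z - ζ'‖ ^ (-(ε n)) := by
    intro n z hz
    have ha : 0 < ‖z - ζ‖ := norm_pos_iff.2 (hzs z hz)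
    have hb : 0 < ‖z - ζ'‖ := norm_pos_iff.2 (hzs' z hz)
    have h1 : Real.exp (L z).re = ‖z - ζ'‖ / ‖z - ζ‖ := by
      rw [← norm_exp, hLe z hz, norm_div]
    have h2 : (-(ε n : ℂ) * L z).re = (L z).re * (-(ε n)) := by
      simp [mul_comm]
    simp only [hF]
    rw [norm_mul, norm_exp, h2, Real.exp_mul, h1, Real.div_rpow hb.le ha.le, norm_inv,
      ← Real.rpow_neg_one ‖z - ζ‖, div_eq_mul_inv, ← Real.rpow_neg ha.le,
      mul_comm (‖z - ζ'‖ ^ _), ← mul_assoc, ← Real.rpow_add ha]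
    congr 2
    ring
  set δ := ‖ζ - ζ'‖ / 2 with hδ
  have hδ0 : 0 < δ := half_pos (norm_pos_iff.2 (sub_ne_zero.2 hne))
  have hab : ∀ z, 2 * δ ≤ ‖z - ζ‖ + ‖z - ζ'‖ := by
    intro z
    have := norm_sub_le (z - ζ') (z - ζ)
    rw [sub_sub_sub_cancel_left] at this
    rw [hδ]
    linarith
  have hmeasF : ∀ n, AEStronglyMeasurable (F n) (volume.restrict Ω) := fun n =>
    (hFd n).continuousOn.aestronglyMeasurable hΩ.measurableSet
  refine ⟨F, fun n => ⟨hFd n, ?_⟩, fun n z hz => mul_ne_zero (inv_ne_zero (hzs z hz)) (exp_ne_zero _),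
    ?_, ?_⟩
  · have hi := integrableOn_norm_sub_rpow hA (p := 2 - 2 * ε n) (by linarith [hε1 n])
      (by linarith [hε0 n]) ζ
    have hi' := integrableOn_norm_sub_rpow hA (p := 2 * ε n) (by linarith [hε0 n])
      (by linarith [hε1 n]) ζ'
    refine Integrable.mono' ((hi'.const_mul (δ ^ (-(2 - 2 * ε n)))).add
      (hi.const_mul (δ ^ (-(2 * ε n))))) ((hmeasF n).norm.pow 2) ?_
    refine (ae_restrict_mem hΩ.measurableSet).mono fun z hz => ?_
    rw [Real.norm_of_nonneg (by positivity), hnorm n z hz, mul_pow, ← Real.rpow_natCast,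
      ← Real.rpow_natCast, ← Real.rpow_mul (norm_nonneg _), ← Real.rpow_mul (norm_nonneg _)]
    have := rpow_mul_rpow_le hδ0 (norm_nonneg (z - ζ)) (norm_nonneg (z - ζ')) (hab z)
      (p := 2 - 2 * ε n) (q := 2 * ε n) (by linarith [hε1 n]) (by linarith [hε0 n])
    have e1 : -(1 - ε n) * ((2 : ℕ) : ℝ) = -(2 - 2 * ε n) := by push_cast; ring
    have e2 : -(ε n) * ((2 : ℕ) : ℝ) = -(2 * ε n) := by push_cast; ring
    rw [e1, e2]
    exact this
  · rw [tendstoLocallyUniformlyOn_iff_forall_isCompact hΩ]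
    intro K hK hKc
    obtain ⟨B, hB⟩ := hKc.exists_bound_of_continuousOn (hL.continuousOn.mono hK)
    obtain ⟨M, hM⟩ := hKc.exists_bound_of_continuousOn (f := fun z => (z - ζ)⁻¹)
      (ContinuousOn.inv₀ (by fun_prop) fun z hz => hzs z (hK hz))
    rw [Metric.tendstoUniformlyOn_iff]
    intro η hη
    have h1 : Tendsto (fun n => ε n * B) atTop (𝓝 (0 * B)) := hεt.mul_const B
    have h2 : Tendsto (fun n => M * (2 * (ε n * B))) atTop (𝓝 (M * (2 * (0 * B)))) :=
      (h1.const_mul 2).const_mul M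
    rw [zero_mul] at h1 h2
    rw [mul_zero, mul_zero] at h2
    filter_upwards [h1.eventually (ge_mem_nhds one_pos), h2.eventually (gt_mem_nhds hη)]
      with n hn1 hn2 z hz
    have hle : ‖-(ε n : ℂ) * L z‖ ≤ ε n * B := by
      rw [norm_mul, norm_neg, norm_real, Real.norm_of_nonneg (hε0 n).le]
      exact mul_le_mul_of_nonneg_left (hB z hz) (hε0 n).le
    rw [dist_comm, dist_eq_norm]
    have : F n z - (z - ζ)⁻¹ = (z - ζ)⁻¹ * (exp (-(ε n : ℂ) * L z) - 1) := by
      simp only [hF]; ring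
    rw [this, norm_mul]
    refine lt_of_le_of_lt ?_ hn2
    have h3 := norm_exp_sub_one_le (hle.trans hn1)
    have h4 := hM z hz
    have := norm_nonneg (z - ζ)⁻¹
    gcongr
    · exact this.trans h4
    · linarith
  · have hi := integrableOn_norm_sub_rpow hA zero_le_one one_lt_two ζ
    have hi' := integrableOn_norm_sub_rpow hA zero_le_one one_lt_two ζ'
    have h1 : IntegrableOn (fun _ : ℂ => (1 : ℝ)) Ω := integrableOn_const hA.ne
    refine tendsto_integral_of_dominated_convergence
      (fun z => (1 + δ ^ (-1 : ℝ)) * (1 + ‖z - ζ'‖ ^ (-1 : ℝ)) +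
        (1 + δ ^ (-1 : ℝ)) * (1 + ‖z - ζ‖ ^ (-1 : ℝ))) hmeasF
      (((h1.add hi').const_mul _).add ((h1.add hi).const_mul _)) (fun n => ?_) ?_
    · refine (ae_restrict_mem hΩ.measurableSet).mono fun z hz => ?_
      rw [hnorm n z hz]
      have ha : 0 < ‖z - ζ‖ := norm_pos_iff.2 (hzs z hz)
      have hb : 0 < ‖z - ζ'‖ := norm_pos_iff.2 (hzs' z hz)
      have he0 := hε0 n
      have he1 := hε1 n
      refine (rpow_mul_rpow_le hδ0 ha.le hb.le (hab z) (by linarith) he0.le).trans ?_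
      have := rpow_neg_le_one_add (p := 1 - ε n) hδ0 (by linarith) (by linarith)
      have := rpow_neg_le_one_add (p := ε n) hδ0 (by linarith) (by linarith)
      have := rpow_neg_le_one_add (p := 1 - ε n) ha (by linarith) (by linarith)
      have := rpow_neg_le_one_add (p := ε n) hb (by linarith) (by linarith)
      gcongr
    · refine ae_of_all _ fun z => ?_
      have h2 : Tendsto (fun n => (z - ζ)⁻¹ * exp (-(ε n : ℂ) * L z)) atTop
          (𝓝 ((z - ζ)⁻¹ * exp (-((0 : ℝ) : ℂ) * L z))) := by
        have : Continuous fun e : ℝ => (z - ζ)⁻¹ * exp (-(e : ℂ) * L z) := by fun_prop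
        exact (this.tendsto 0).comp hεt
      simpa [hF] using h2

/-- On the complement of `K`, `h` is an entire function divided by a polynomial with zeros in
`K`. -/
def HasPolesIn (K : Set ℂ) (h : ℂ → ℂ) : Prop :=
  ∃ l : List ℂ, (∀ a ∈ l, a ∈ K) ∧ ∃ G : ℂ → ℂ, Differentiable ℂ G ∧
    ∀ ζ ∉ K, G ζ = (l.map fun a => ζ - a).prod * h ζ

/-- `g` is holomorphic off `K`, vanishes at infinity and its derivative has finitely many poles,
all in `K`. -/
def IsPotentialOff (K : Set ℂ) (g : ℂ → ℂ) : Prop :=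
  DifferentiableOn ℂ g Kᶜ ∧ Tendsto g (cocompact ℂ) (𝓝 0) ∧ HasPolesIn K (deriv g)

theorem differentiable_prod_sub (l : List ℂ) :
    Differentiable ℂ fun ζ : ℂ => (l.map fun a => ζ - a).prod := by
  induction l with
  | nil => simp
  | cons a l ih =>
    simp only [List.map_cons, List.prod_cons]
    exact (differentiable_id.sub_const a).mul ih

namespace IsPotentialOff

variable {K : Set ℂ} {g h : ℂ → ℂ}

theorem zero : IsPotentialOff K fun _ => 0 :=
  ⟨differentiableOn_const 0, tendsto_const_nhds, [], by simp, 0, by fun_prop, by simp⟩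

theorem add (hK : IsClosed K) (hg : IsPotentialOff K g) (hh : IsPotentialOff K h) :
    IsPotentialOff K fun ζ => g ζ + h ζ := by
  obtain ⟨g1, g2, l, hl, G, hG, hGe⟩ := hg
  obtain ⟨h1, h2, m, hm, H, hH, hHe⟩ := hh
  refine ⟨g1.add h1, by simpa using g2.add h2, l ++ m, ?_, fun ζ =>
    (m.map fun a => ζ - a).prod * G ζ + (l.map fun a => ζ - a).prod * H ζ,
    ((differentiable_prod_sub m).mul hG).add ((differentiable_prod_sub l).mul hH), ?_⟩
  · intro a ha
    rcases List.mem_append.1 ha with h | h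
    exacts [hl a h, hm a h]
  · intro ζ hζ
    have hn : Kᶜ ∈ 𝓝 ζ := hK.isOpen_compl.mem_nhds hζ
    rw [deriv_fun_add (g1.differentiableAt hn) (h1.differentiableAt hn), List.map_append,
      List.prod_append]
    simp only [hGe ζ hζ, hHe ζ hζ]
    ring

theorem const_mul (hg : IsPotentialOff K g) (c : ℂ) : IsPotentialOff K fun ζ => c * g ζ := by
  obtain ⟨g1, g2, l, hl, G, hG, hGe⟩ := hg
  refine ⟨g1.const_mul c, by simpa using g2.const_mul c, l, hl, fun ζ => c * G ζ,
    hG.const_mul c, fun ζ hζ => ?_⟩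
  rw [deriv_const_mul_field]
  simp only [hGe ζ hζ]
  ring

theorem sum {ι : Type*} (hK : IsClosed K) (s : Finset ι) {g : ι → ℂ → ℂ}
    (hg : ∀ i ∈ s, IsPotentialOff K (g i)) : IsPotentialOff K fun ζ => ∑ i ∈ s, g i ζ := by
  classical
  induction s using Finset.induction_on with
  | empty => simpa using zero
  | insert a s ha ih =>
    simp only [Finset.sum_insert ha]
    exact add hK (hg a (Finset.mem_insert_self a s))
      (ih fun i hi => hg i (Finset.mem_insert_of_mem hi))

theorem mono {K' : Set ℂ} (h : K ⊆ K') (hg : IsPotentialOff K g) : IsPotentialOff K' g := by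
  obtain ⟨g1, g2, l, hl, G, hG, hGe⟩ := hg
  exact ⟨g1.mono (compl_subset_compl.2 h), g2, l, fun a ha => h (hl a ha), G, hG,
    fun ζ hζ => hGe ζ fun h' => hζ (h h')⟩

end IsPotentialOff

theorem isPotentialOff_inv_pow (w : ℂ) (k : ℕ) :
    IsPotentialOff {w} fun ζ => ((w - ζ) ^ (k + 1))⁻¹ := by
  have hne : ∀ ζ ∉ ({w} : Set ℂ), w - ζ ≠ 0 := fun ζ hζ h => hζ (sub_eq_zero.1 h).symm
  refine ⟨DifferentiableOn.inv (by fun_prop) fun ζ hζ => pow_ne_zero _ (hne ζ hζ), ?_,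
    List.replicate (k + 2) w, fun a ha => List.eq_of_mem_replicate ha,
    fun _ => (-1) ^ k * (k + 1), by fun_prop, fun ζ hζ => ?_⟩
  · have h1 : Tendsto (fun ζ : ℂ => ‖(w - ζ) ^ (k + 1)‖) (cocompact ℂ) atTop := by
      simp only [norm_pow]
      refine (tendsto_pow_atTop (Nat.succ_ne_zero k)).comp ?_
      refine tendsto_atTop_mono (fun ζ => ?_)
        (tendsto_atTop_add_const_right _ (-‖w‖) (tendsto_norm_cocompact_atTop (E := ℂ)))
      have := norm_sub_norm_le ζ w
      rw [norm_sub_rev] at this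
      linarith
    rw [tendsto_zero_iff_norm_tendsto_zero]
    refine h1.inv_tendsto_atTop.congr fun ζ => ?_
    rw [Pi.inv_apply, norm_inv]
  · have h := hne ζ hζ
    have hd : HasDerivAt (fun ζ => ((w - ζ) ^ (k + 1))⁻¹)
        (-(((k + 1 : ℕ) : ℂ) * (w - ζ) ^ k * (-1)) / ((w - ζ) ^ (k + 1)) ^ 2) ζ := by
      have := (((hasDerivAt_id ζ).const_sub w).pow (k + 1)).fun_inv (pow_ne_zero _ h)
      simpa using this
    rw [hd.deriv, List.map_replicate, List.prod_replicate,
      show ζ - w = (-1) * (w - ζ) by ring, mul_pow]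
    push_cast
    field_simp
    ring

theorem isPotentialOff_curve {σ : ℝ → ℂ} (hσ : ContinuousOn σ (Icc 0 1)) {s : Finset ℝ}
    (hs : ContDiffOn ℝ 1 σ (Icc (0 : ℝ) 1 \ s)) (hi : IntervalIntegrable (deriv σ) volume 0 1) :
    IsPotentialOff (σ '' Icc 0 1) fun ζ => ∫ t in (0 : ℝ)..1, (σ t - ζ)⁻¹ * deriv σ t := by
  have hK : IsCompact (σ '' Icc 0 1) := isCompact_Icc.image_of_continuousOn hσ
  have hu : uIcc (0 : ℝ) 1 = Icc 0 1 := uIcc_of_le zero_le_one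
  have hio : uIoc (0 : ℝ) 1 = Ioc 0 1 := uIoc_of_le zero_le_one
  have hmem : ∀ t ∈ uIoc (0 : ℝ) 1, σ t ∈ σ '' Icc 0 1 := by
    intro t ht
    rw [hio] at ht
    exact ⟨t, ⟨ht.1.le, ht.2⟩, rfl⟩
  have hne : ∀ ζ ∉ σ '' Icc 0 1, ∀ t ∈ Icc (0 : ℝ) 1, σ t - ζ ≠ 0 := fun ζ hζ t ht h =>
    hζ ⟨t, ht, sub_eq_zero.1 h⟩
  have hcont : ∀ ζ ∉ σ '' Icc 0 1, ContinuousOn (fun t => (σ t - ζ)⁻¹) (uIcc 0 1) := by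
    intro ζ hζ
    rw [hu]
    exact (hσ.sub continuousOn_const).inv₀ (hne ζ hζ)
  have hintegrable : ∀ ζ ∉ σ '' Icc 0 1,
      IntervalIntegrable (fun t => (σ t - ζ)⁻¹ * deriv σ t) volume 0 1 := fun ζ hζ =>
    hi.continuousOn_mul (hcont ζ hζ)
  have hintegrable_inv : ∀ ζ ∉ σ '' Icc 0 1,
      IntervalIntegrable (fun t => ((σ t - ζ)⁻¹) ^ 2 * deriv σ t) volume 0 1 := fun ζ hζ =>
    hi.continuousOn_mul ((hcont ζ hζ).pow 2)
  have hderiv : ∀ ζ ∉ σ '' Icc 0 1,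
      HasDerivAt (fun ζ => ∫ t in (0 : ℝ)..1, (σ t - ζ)⁻¹ * deriv σ t)
        (∫ t in (0 : ℝ)..1, ((σ t - ζ)⁻¹) ^ 2 * deriv σ t) ζ := by
    intro ζ hζ
    obtain ⟨r, hr, hball⟩ := Metric.isOpen_iff.1 hK.isClosed.isOpen_compl ζ hζ
    have hsub : ∀ x ∈ ball ζ (r / 2), x ∉ σ '' Icc 0 1 := fun x hx =>
      hball (ball_subset_ball (by linarith) hx)
    have hlow : ∀ x ∈ ball ζ (r / 2), ∀ t ∈ uIoc (0 : ℝ) 1, r / 2 ≤ ‖σ t - x‖ := by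
      intro x hx t ht
      by_contra! hlt
      apply hball (a := σ t) _ (hmem t ht)
      rw [mem_ball] at hx ⊢
      rw [← dist_eq_norm] at hlt
      have := dist_triangle (σ t) x ζ
      linarith
    refine (intervalIntegral.hasDerivAt_integral_of_dominated_loc_of_deriv_le
      (F := fun ζ t => (σ t - ζ)⁻¹ * deriv σ t)
      (F' := fun ζ t => ((σ t - ζ)⁻¹) ^ 2 * deriv σ t)
      (bound := fun t => ((r / 2)⁻¹) ^ 2 * ‖deriv σ t‖) (ball_mem_nhds ζ (half_pos hr)) ?_
      (hintegrable ζ hζ) ?_ ?_ (hi.norm.const_mul _) ?_).2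
    · filter_upwards [ball_mem_nhds ζ (half_pos hr)] with x hx
      have := (hintegrable x (hsub x hx)).aestronglyMeasurable
      rwa [hio]
    · have := (hintegrable_inv ζ hζ).aestronglyMeasurable
      rwa [hio]
    · refine ae_of_all _ fun t ht x hx => ?_
      rw [norm_mul, norm_pow, norm_inv]
      have := hlow x hx t ht
      gcongr
    · refine ae_of_all _ fun t ht x hx => ?_
      have h0 : σ t - x ≠ 0 := fun h => hsub x hx (sub_eq_zero.1 h ▸ hmem t ht)
      have := (((hasDerivAt_id x).const_sub (σ t)).fun_inv h0).mul_const (deriv σ t)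
      refine this.congr_deriv ?_
      simp
  have hftc : ∀ ζ ∉ σ '' Icc 0 1,
      ∫ t in (0 : ℝ)..1, ((σ t - ζ)⁻¹) ^ 2 * deriv σ t = -(σ 1 - ζ)⁻¹ - -(σ 0 - ζ)⁻¹ := by
    intro ζ hζ
    have hc := (hcont ζ hζ).neg
    rw [hu] at hc
    refine integral_eq_of_hasDerivAt_off_countable_of_le
      (f := fun t => -(σ t - ζ)⁻¹) _ zero_le_one s.countable_toSet
      hc (fun t ht => ?_) (hintegrable_inv ζ hζ)
    have ht' : t ∈ Icc (0 : ℝ) 1 := Ioo_subset_Icc_self ht.1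
    have hnhds : Icc (0 : ℝ) 1 \ s ∈ 𝓝 t := by
      filter_upwards [Ioo_mem_nhds ht.1.1 ht.1.2, s.finite_toSet.isClosed.isOpen_compl.mem_nhds ht.2]
        with x hx hx'
      exact ⟨Ioo_subset_Icc_self hx, hx'⟩
    have hd : HasDerivAt σ (deriv σ t) t :=
      ((hs.contDiffAt hnhds).differentiableAt one_ne_zero).hasDerivAt
    have := ((hd.sub_const ζ).fun_inv (hne ζ hζ t ht')).neg
    refine this.congr_deriv ?_
    have := hne ζ hζ t ht'
    field_simp
  refine ⟨fun ζ hζ => (hderiv ζ hζ).differentiableAt.differentiableWithinAt, ?_,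
    [σ 0, σ 1], ?_, fun _ => σ 1 - σ 0 , by fun_prop, ?_⟩
  · obtain ⟨R, hR⟩ := hK.isBounded.exists_norm_le
    set I := ∫ t in (0 : ℝ)..1, ‖deriv σ t‖
    have hlim : Tendsto (fun ζ : ℂ => (‖ζ‖ - R)⁻¹ * I) (cocompact ℂ) (𝓝 (0 * I)) := by
      refine Tendsto.mul_const I (Tendsto.inv_tendsto_atTop ?_)
      exact tendsto_atTop_add_const_right _ (-R) (tendsto_norm_cocompact_atTop (E := ℂ))
    rw [zero_mul] at hlim
    refine squeeze_zero_norm' ?_ hlim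
    filter_upwards [(tendsto_norm_cocompact_atTop (E := ℂ)).eventually_gt_atTop R] with ζ hζ
    have hb : ∀ t ∈ uIoc (0 : ℝ) 1, ‖ζ‖ - R ≤ ‖σ t - ζ‖ := by
      intro t ht
      have h1 := norm_sub_norm_le ζ (σ t)
      rw [norm_sub_rev] at h1
      have := hR _ (hmem t ht)
      linarith
    rw [← intervalIntegral.integral_const_mul]
    refine intervalIntegral.norm_integral_le_of_norm_le zero_le_one (ae_of_all _ fun t ht => ?_)
      (hi.norm.const_mul _)
    rw [norm_mul, norm_inv]
    have := hb t (hio ▸ ht)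
    have h0 : 0 < ‖ζ‖ - R := by linarith
    gcongr
  · simp only [List.mem_cons, List.not_mem_nil, or_false, forall_eq_or_imp, forall_eq]
    exact ⟨⟨0, by simp, rfl⟩, ⟨1, by simp, rfl⟩⟩
  · intro ζ hζ
    rw [(hderiv ζ hζ).deriv, hftc ζ hζ]
    have h0 := hne ζ hζ 0 (by simp)
    have h1 := hne ζ hζ 1 (by simp)
    simp only [List.map_cons, List.map_nil, List.prod_cons, List.prod_nil]
    field_simp
    ring

theorem iteratedDerivWithin_inv_sub {Ω : Set ℂ} (hΩ : IsOpen Ω) {w ζ : ℂ} (hw : w ∈ Ω) (k : ℕ) :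
    iteratedDerivWithin k (fun z => (z - ζ)⁻¹) Ω w =
      ((-1) ^ k * k.factorial) * ((w - ζ) ^ (k + 1))⁻¹ := by
  rw [iteratedDerivWithin_of_isOpen hΩ hw]
  have := congrFun (iter_deriv_inv_linear_sub k (1 : ℂ) ζ) w
  rw [iteratedDeriv_eq_iterate]
  simp only [one_mul, one_pow] at this
  rw [this, mul_one, ← zpow_natCast (w - ζ), ← zpow_neg]
  congr 2
  push_cast
  ring

theorem exists_potential_eq_cauchyTransform {Ω : Set ℂ} (hΩ : IsOpen Ω) (hc : IsConnected Ω)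
    (hnd : ∀ x ∈ Ωᶜ, ¬ (connectedComponentIn Ωᶜ x).Subsingleton)
    (hA : volume Ω < ⊤) (hq : IsGenQuadratureDomain Ω) :
    ∃ K ⊆ Ω, IsCompact K ∧ ∃ Λ : ℂ → ℂ, IsPotentialOff K Λ ∧
      ∀ ζ ∈ Ωᶜ, cauchyTransform Ω ζ = Λ ζ := by
  classical
  obtain ⟨N, M, w, n, c, b, σ, hw, hσ, hσΩ, hquad⟩ := hq
  set K : Set ℂ := range w ∪ ⋃ m, σ m '' Icc 0 1 with hK
  have hKc : IsCompact K := (finite_range w).isCompact.union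
    (isCompact_iUnion fun m => isCompact_Icc.image_of_continuousOn (hσ m).1)
  have hKΩ : K ⊆ Ω := by
    rintro x (⟨j, rfl⟩ | hx)
    · exact hw j
    · obtain ⟨m, t, ht, rfl⟩ := mem_iUnion.1 hx
      exact hσΩ m t ht
  set b' : Fin M → ℂ := fun m => if IntervalIntegrable (deriv (σ m)) volume 0 1 then b m else 0
    with hb'
  refine ⟨K, hKΩ, hKc, fun ζ =>
    (∑ j, ∑ k ∈ Finset.range (n j + 1),
      (c j k * ((-1) ^ k * k.factorial)) * ((w j - ζ) ^ (k + 1))⁻¹) +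
      ∑ m, b' m * ∫ t in (0 : ℝ)..1, (σ m t - ζ)⁻¹ * deriv (σ m) t, ?_, ?_⟩
  · refine IsPotentialOff.add hKc.isClosed ?_ ?_
    · refine IsPotentialOff.sum hKc.isClosed _ fun j _ =>
        IsPotentialOff.sum hKc.isClosed _ fun k _ => IsPotentialOff.const_mul ?_ _
      refine (isPotentialOff_inv_pow (w j) k).mono ?_
      rintro x rfl
      exact Or.inl ⟨j, rfl⟩
    · refine IsPotentialOff.sum hKc.isClosed _ fun m _ => ?_
      by_cases h : IntervalIntegrable (deriv (σ m)) volume 0 1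
      · obtain ⟨s, hs⟩ := (hσ m).2
        refine IsPotentialOff.const_mul ?_ _
        exact (isPotentialOff_curve (hσ m).1 hs h).mono
          ((subset_iUnion (fun m => σ m '' Icc 0 1) m).trans subset_union_right)
      · simp only [hb', if_neg h, zero_mul]
        exact IsPotentialOff.zero
  · intro ζ hζ
    have hζE : ζ ∈ connectedComponentIn Ωᶜ ζ := mem_connectedComponentIn hζ
    have : ∃ ζ' ∈ connectedComponentIn Ωᶜ ζ, ζ ≠ ζ' := by
      by_contra! h
      exact hnd ζ hζ fun x hx y hy => (h x hx).symm.trans (h y hy)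
    obtain ⟨ζ', hζ', hne⟩ := this
    obtain ⟨F, hFb, hF0, hFl, hFi⟩ := exists_bergman_approx hΩ hc hA
      isPreconnected_connectedComponentIn (connectedComponentIn_subset _ _) hζE hζ' hne
    have hinv : ContinuousOn (fun z => (z - ζ)⁻¹) Ω :=
      ContinuousOn.inv₀ (by fun_prop) fun z hz h => hζ (sub_eq_zero.1 h ▸ hz)
    refine tendsto_nhds_unique hFi ?_
    simp only [hquad _ (hFb _)]
    refine Tendsto.add (tendsto_finsetSum _ fun j _ => tendsto_finsetSum _ fun k _ => ?_)
      (tendsto_finsetSum _ fun m _ => ?_)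
    · rw [mul_assoc, ← iteratedDerivWithin_inv_sub hΩ (hw j)]
      exact (tendsto_iteratedDerivWithin hΩ (fun n => (hFb n).1) hFl k (hw j)).const_mul _
    · by_cases h : IntervalIntegrable (deriv (σ m)) volume 0 1
      · simp only [hb', if_pos h]
        exact (tendsto_integral_curve (hσ m).1 (hσΩ m) hΩ (fun n => (hFb n).1.continuousOn) hinv
          hFl h).const_mul _
      · simp only [hb', if_neg h, zero_mul]
        refine tendsto_const_nhds.congr fun n => ?_
        rw [integral_curve_eq_zero_of_not_integrable (hσ m).1 (hσΩ m) (hFb n).1.continuousOn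
          (hF0 n) h, mul_zero]

/-- The filter of points of `Ω` at which `‖f‖` is close to `1`. -/
def boundaryFilter (Ω : Set ℂ) (f : ℂ → ℂ) : Filter ℂ :=
  comap (fun z => ‖f z‖) (𝓝[<] 1) ⊓ 𝓟 Ω

theorem mem_boundaryFilter {Ω : Set ℂ} {f : ℂ → ℂ} (hf : IsProperOntoDisc Ω f) {s : Set ℂ} :
    s ∈ boundaryFilter Ω f ↔ ∃ ρ < 1, ∀ z ∈ Ω, ρ < ‖f z‖ → z ∈ s := by
  rw [boundaryFilter, (((nhdsLT_basis (1 : ℝ)).comap _).inf_principal Ω).mem_iff]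
  refine exists_congr fun ρ => and_congr_right fun _ => ⟨fun h z hz hρ => h ⟨⟨hρ, ?_⟩, hz⟩,
    fun h z hz => h z hz.2 hz.1.1⟩
  have : f z ∈ ball (0 : ℂ) 1 := hf.2.1 ▸ mem_image_of_mem f hz
  simpa using this

theorem eventually_boundaryFilter {Ω : Set ℂ} {f : ℂ → ℂ} (hf : IsProperOntoDisc Ω f)
    {p : ℂ → Prop} :
    (∀ᶠ z in boundaryFilter Ω f, p z) ↔ ∃ ρ < 1, ∀ z ∈ Ω, ρ < ‖f z‖ → p z :=
  mem_boundaryFilter hf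

theorem eventually_mem_boundaryFilter {Ω : Set ℂ} {f : ℂ → ℂ} :
    ∀ᶠ z in boundaryFilter Ω f, z ∈ Ω :=
  mem_inf_of_right (mem_principal_self Ω)

namespace IsProperOntoDisc

variable {Ω : Set ℂ} {f : ℂ → ℂ}

theorem norm_lt (hf : IsProperOntoDisc Ω f) {z : ℂ} (hz : z ∈ Ω) : ‖f z‖ < 1 := by
  have : f z ∈ ball (0 : ℂ) 1 := hf.2.1 ▸ mem_image_of_mem f hz
  simpa using this

theorem exists_eq (hf : IsProperOntoDisc Ω f) {w : ℂ} (hw : ‖w‖ < 1) : ∃ z ∈ Ω, f z = w := by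
  have : w ∈ f '' Ω := by rw [hf.2.1]; simpa using hw
  exact this

theorem isCompact_preimage (hf : IsProperOntoDisc Ω f) {r : ℝ} (hr : r < 1) :
    IsCompact (Ω ∩ f ⁻¹' closedBall 0 r) :=
  hf.2.2 _ (closedBall_subset_ball hr) (isCompact_closedBall _ _)

theorem exists_norm_le (hf : IsProperOntoDisc Ω f) {K : Set ℂ} (hK : IsCompact K) (hKΩ : K ⊆ Ω) :
    ∃ ρ < 1, 0 ≤ ρ ∧ ∀ z ∈ K, ‖f z‖ ≤ ρ := by
  rcases K.eq_empty_or_nonempty with rfl | hne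
  · exact ⟨0, one_pos, le_rfl, by simp⟩
  · obtain ⟨z, hz, hmax⟩ := hK.exists_isMaxOn hne (hf.1.continuousOn.norm.mono hKΩ)
    exact ⟨‖f z‖, hf.norm_lt (hKΩ hz), norm_nonneg _, fun y hy => hmax hy⟩

theorem eventually_notMem (hf : IsProperOntoDisc Ω f) {K : Set ℂ} (hK : IsCompact K)
    (hKΩ : K ⊆ Ω) : ∀ᶠ z in boundaryFilter Ω f, z ∉ K := by
  obtain ⟨ρ, hρ, -, h⟩ := hf.exists_norm_le hK hKΩ
  exact (eventually_boundaryFilter hf).2 ⟨ρ, hρ, fun z _ hz hzK => (h z hzK).not_gt hz⟩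

theorem tendsto_norm (_hf : IsProperOntoDisc Ω f) :
    Tendsto (fun z => ‖f z‖) (boundaryFilter Ω f) (𝓝 1) :=
  (tendsto_comap.mono_left inf_le_left).mono_right nhdsWithin_le_nhds

theorem isOpen_inter_ball (hf : IsProperOntoDisc Ω f) (hΩ : IsOpen Ω) {t : Set ℂ}
    (ht : IsOpen t) : IsOpen (Ω ∩ f ⁻¹' t) :=
  hf.1.continuousOn.isOpen_inter_preimage hΩ ht

theorem norm_le_of_eventually (hf : IsProperOntoDisc Ω f) (hΩ : IsOpen Ω) {G : ℂ → ℂ}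
    (hG : DifferentiableOn ℂ G Ω) {M : ℝ}
    (h : ∀ ε > 0, ∀ᶠ z in boundaryFilter Ω f, ‖G z‖ ≤ M + ε) : ∀ z ∈ Ω, ‖G z‖ ≤ M := by
  intro z hz
  refine le_of_forall_pos_le_add fun ε hε => ?_
  obtain ⟨ρ, hρ, hb⟩ := (eventually_boundaryFilter hf).1 (h ε hε)
  obtain ⟨r, hr, hr1⟩ := exists_between (max_lt hρ (hf.norm_lt hz))
  have hK := hf.isCompact_preimage hr1
  set U := Ω ∩ f ⁻¹' ball 0 r with hU
  have hUo : IsOpen U := hf.isOpen_inter_ball hΩ isOpen_ball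
  have hsub : U ⊆ Ω ∩ f ⁻¹' closedBall 0 r :=
    inter_subset_inter_right _ (preimage_mono ball_subset_closedBall)
  have hcl : closure U ⊆ Ω ∩ f ⁻¹' closedBall 0 r := closure_minimal hsub hK.isClosed
  refine Complex.norm_le_of_forall_mem_frontier_norm_le (hK.isBounded.subset hsub)
    (hG.mono (hcl.trans inter_subset_left)).diffContOnCl (fun y hy => ?_)
    (subset_closure (show z ∈ U from ⟨hz, ?_⟩))
  · rw [hUo.frontier_eq] at hy
    have hy1 := hcl hy.1
    refine hb y hy1.1 ?_
    have : r ≤ ‖f y‖ := by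
      by_contra! hlt
      exact hy.2 ⟨hy1.1, by simpa using hlt⟩
    exact ((le_max_left _ _).trans_lt hr).trans_le this
  · simpa using (le_max_right _ _).trans_lt hr

end IsProperOntoDisc

/-- Near the boundary of `Ω`, `g` is the quotient of a holomorphic function on `Ω` by a nonzero
polynomial in `f`. -/
def IsEventuallyQuot (Ω : Set ℂ) (f g : ℂ → ℂ) : Prop :=
  ∃ (G : ℂ → ℂ) (q : Polynomial ℂ), DifferentiableOn ℂ G Ω ∧ q ≠ 0 ∧
    ∀ᶠ z in boundaryFilter Ω f, G z = q.eval (f z) * g z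

theorem isBounded_of_potential {Ω K : Set ℂ} (hΩ : IsOpen Ω) {S V : ℂ → ℂ}
    (hK : IsCompact K) (hS : ∀ z, S z = conj z + V z) (hV : ContinuousOn V Kᶜ)
    (hV0 : ∀ z ∉ Ω, V z = 0) (hVt : Tendsto V (cocompact ℂ) (𝓝 0))
    (hSd : DifferentiableOn ℂ S (Ω \ K)) : Bornology.IsBounded Ω := by
  have h1 : ∀ᶠ z in cocompact ℂ, ‖V z‖ < 1 / 2 := by
    have := hVt.norm
    rw [norm_zero] at this
    exact this.eventually_lt_const (by norm_num)
  rw [← Metric.cobounded_eq_cocompact] at h1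
  have h2 : ∀ᶠ z in Bornology.cobounded ℂ, z ∉ K := hK.isBounded
  obtain ⟨R, -, hR⟩ := (Metric.hasBasis_cobounded_compl_closedBall (0 : ℂ)).eventually_iff.1
    (h1.and h2)
  refine (isBounded_closedBall (x := (0 : ℂ)) (r := R + 1)).subset ?_
  by_contra hnot
  obtain ⟨ζ, hζ, hζR⟩ := not_subset.1 hnot
  rw [mem_closedBall, dist_zero_right, not_le] at hζR
  have hfar : ∀ z ∈ closedBall ζ 1, ‖V z‖ < 1 / 2 ∧ z ∉ K := by
    intro z hz
    apply hR
    rw [mem_compl_iff, mem_closedBall, dist_zero_right, not_le]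
    rw [mem_closedBall, dist_comm, dist_eq_norm] at hz
    have := norm_sub_norm_le ζ z
    linarith
  obtain ⟨d, hd, hdΩ⟩ := Metric.isOpen_iff.1 hΩ ζ hζ
  set c := V ζ with hc
  set G : ℂ → ℂ := fun z => 2 * (conj c - (z - ζ)) * (S z - conj ζ) with hG
  have hre : ∀ z, (G z).re ≤ ‖V z‖ ^ 2 - ‖z - ζ‖ ^ 2 + ‖c‖ ^ 2 := by
    intro z
    have hVz : V z = (S z - conj ζ) - conj (z - ζ) := by rw [hS]; simp
    have hGz : G z = 2 * (conj c - (z - ζ)) * (S z - conj ζ) := rfl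
    rw [hVz, hGz]
    generalize S z - conj ζ = s
    generalize z - ζ = y
    simp only [← Complex.normSq_eq_norm_sq, Complex.normSq_apply]
    simp
    nlinarith [sq_nonneg (s.re - c.re), sq_nonneg (s.im - c.im)]
  have hGζ : (G ζ).re = 2 * ‖c‖ ^ 2 := by
    have : S ζ - conj ζ = c := by rw [hS]; simp [hc]
    simp only [hG]
    rw [this, ← Complex.normSq_eq_norm_sq, Complex.normSq_apply]
    simp
    ring
  set η := min (d ^ 2) (3 / 4) with hη
  have hη0 : 0 < η := lt_min (by positivity) (by norm_num)
  set U := ball ζ 1 ∩ Ω with hU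
  have hUcl : closure U ⊆ closedBall ζ 1 :=
    (closure_mono inter_subset_left).trans closure_ball_subset_closedBall
  have hScont : ContinuousOn S Kᶜ := by
    have : S = fun z => conj z + V z := funext hS
    rw [this]
    exact continuous_conj.continuousOn.add hV
  have hdiff : DiffContOnCl ℂ (fun z => exp (G z)) U := by
    constructor
    · have : DifferentiableOn ℂ S U := hSd.mono fun z hz =>
        ⟨hz.2, (hfar z (ball_subset_closedBall hz.1)).2⟩
      simp only [hG]
      fun_prop
    · have : ContinuousOn S (closure U) := hScont.mono fun z hz => (hfar z (hUcl hz)).2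
      simp only [hG]
      fun_prop
  have hmain := Complex.norm_le_of_forall_mem_frontier_norm_le
    (isBounded_ball.subset inter_subset_left) hdiff (C := Real.exp (‖c‖ ^ 2 - η)) (fun y hy => ?_)
    (subset_closure (show ζ ∈ U from ⟨mem_ball_self one_pos, hζ⟩))
  · rw [norm_exp, Real.exp_le_exp, hGζ] at hmain
    nlinarith [sq_nonneg ‖c‖]
  · rw [norm_exp, Real.exp_le_exp]
    refine (hre y).trans ?_
    rw [(isOpen_ball.inter hΩ).frontier_eq] at hy
    have hyb := hUcl hy.1
    by_cases hyΩ : y ∈ Ω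
    · have h3 : ‖y - ζ‖ = 1 := by
        refine le_antisymm (by simpa [dist_eq_norm] using hyb) ?_
        by_contra! hlt
        exact hy.2 ⟨by simpa [dist_eq_norm] using hlt, hyΩ⟩
      have := (hfar y hyb).1
      have := min_le_right (d ^ 2) (3 / 4)
      rw [h3]
      nlinarith [norm_nonneg (V y)]
    · have h3 : d ≤ ‖y - ζ‖ := by
        by_contra! hlt
        exact hyΩ (hdΩ (by simpa [dist_eq_norm] using hlt))
      have := min_le_left (d ^ 2) (3 / 4)
      rw [hV0 y hyΩ, norm_zero]
      nlinarith

theorem exists_schwarz_function {Ω : Set ℂ} (hΩ : IsFinConnDomain Ω) (hA : volume Ω < ⊤)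
    (hq : IsGenQuadratureDomain Ω) {f : ℂ → ℂ} (hf : IsProperOntoDisc Ω f) :
    Bornology.IsBounded Ω ∧ ∃ S : ℂ → ℂ, ∃ r < 1, 0 ≤ r ∧
      DifferentiableOn ℂ S (Ω ∩ {z | r < ‖f z‖}) ∧
      Tendsto (fun z => conj z - S z) (boundaryFilter Ω f) (𝓝 0) ∧
      IsEventuallyQuot Ω f (deriv S) := by
  obtain ⟨hΩo, hΩc, -, hnd⟩ := hΩ
  obtain ⟨K, hKΩ, hK, Λ, ⟨hΛd, hΛt, hΛp⟩, hΛ⟩ :=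
    exists_potential_eq_cauchyTransform hΩo hΩc hnd hA hq
  have hπ : (Real.pi : ℂ) ≠ 0 := ofReal_ne_zero.2 Real.pi_ne_zero
  set V : ℂ → ℂ := fun z => (cauchyTransform Ω z - Λ z) / Real.pi with hV
  set H : ℂ → ℂ := fun z => cauchyTransform Ω z + Real.pi * conj z with hH
  have hHd : DifferentiableOn ℂ H Ω := differentiableOn_cauchyTransform_add hΩo hA
  set S : ℂ → ℂ := fun z => conj z + V z with hS
  have hSe : S = fun z => (H z - Λ z) / Real.pi := by
    funext z
    simp only [hS, hV, hH]
    field_simp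
    ring
  have hVc : ContinuousOn V Kᶜ :=
    ((continuous_cauchyTransform hA).continuousOn.sub hΛd.continuousOn).div_const _
  have hV0 : ∀ z ∉ Ω, V z = 0 := fun z hz => by simp [hV, hΛ z hz]
  have hVt : Tendsto V (cocompact ℂ) (𝓝 0) := by
    simpa using ((tendsto_cauchyTransform_cocompact hA).sub hΛt).div_const (Real.pi : ℂ)
  have hSd : DifferentiableOn ℂ S (Ω \ K) := by
    rw [hSe]
    exact ((hHd.mono sdiff_subset).sub (hΛd.mono fun z hz => hz.2)).div_const _
  have hbdd := isBounded_of_potential hΩo hK (fun z => rfl) hVc hV0 hVt hSd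
  obtain ⟨r, hr, hr0, hrK⟩ := hf.exists_norm_le hK hKΩ
  refine ⟨hbdd, S, r, hr, hr0, hSd.mono fun z hz => ⟨hz.1, fun h => (hrK z h).not_gt hz.2⟩, ?_, ?_⟩
  · rw [Metric.tendsto_nhds]
    intro ε hε
    set N : Set ℂ := Kᶜ ∩ V ⁻¹' ball 0 ε
    have hN : IsOpen N := hVc.isOpen_inter_preimage hK.isClosed.isOpen_compl isOpen_ball
    have hc : IsCompact (closure Ω \ N) := hbdd.isCompact_closure.diff hN
    have hsub : closure Ω \ N ⊆ Ω := by
      intro z hz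
      by_contra hzΩ
      exact hz.2 ⟨fun h => hzΩ (hKΩ h), by simpa [hV0 z hzΩ] using hε⟩
    filter_upwards [hf.eventually_notMem hc hsub, eventually_mem_boundaryFilter] with z hz hzΩ
    have : z ∈ N := by
      by_contra h
      exact hz ⟨subset_closure hzΩ, h⟩
    simpa [hS] using this.2
  · obtain ⟨l, hl, G0, hG0, hG0e⟩ := hΛp
    refine ⟨fun z => ((l.map fun a => f z - f a).prod * deriv H z -
      (l.map fun a => dslope f a z).prod * G0 z) / Real.pi,
      (l.map fun a => Polynomial.X - Polynomial.C (f a)).prod, ?_, ?_, ?_⟩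
    · have h1 : DifferentiableOn ℂ (fun z => (l.map fun a => f z - f a).prod) Ω := by
        clear hG0e hl
        induction l with
        | nil => simp
        | cons a l ih =>
          simp only [List.map_cons, List.prod_cons]
          exact (hf.1.sub_const _).mul ih
      have h2 : DifferentiableOn ℂ (fun z => (l.map fun a => dslope f a z).prod) Ω := by
        clear hG0e h1
        induction l with
        | nil => simp
        | cons a l ih =>
          simp only [List.map_cons, List.prod_cons]
          refine DifferentiableOn.mul ?_ (ih fun b hb => hl b (List.mem_cons_of_mem _ hb))
          exact (Complex.differentiableOn_dslope
            (hΩo.mem_nhds (hKΩ (hl a List.mem_cons_self)))).2 hf.1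
      exact ((h1.mul (hHd.deriv hΩo)).sub (h2.mul hG0.differentiableOn)).div_const _
    · refine List.prod_ne_zero fun h => ?_
      obtain ⟨a, -, ha⟩ := List.mem_map.1 h
      exact Polynomial.X_sub_C_ne_zero _ ha
    · filter_upwards [hf.eventually_notMem hK hKΩ, eventually_mem_boundaryFilter] with z hz hzΩ
      have hd : deriv S z = (deriv H z - deriv Λ z) / Real.pi := by
        rw [hSe, deriv_div_const, deriv_fun_sub (hHd.differentiableAt (hΩo.mem_nhds hzΩ))
          (hΛd.differentiableAt (hK.isClosed.isOpen_compl.mem_nhds hz))]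
      have hev : (l.map fun a => Polynomial.X - Polynomial.C (f a)).prod.eval (f z) =
          (l.map fun a => f z - f a).prod := by
        rw [Polynomial.eval_list_prod, List.map_map]
        congr 2
        funext a
        simp
      have hfac : (l.map fun a => f z - f a).prod =
          (l.map fun a => z - a).prod * (l.map fun a => dslope f a z).prod := by
        rw [← List.prod_map_mul]
        congr 2
        funext a
        rw [← smul_eq_mul, sub_smul_dslope]
      rw [hev, hd, hG0e z hz, hfac]
      ring

theorem vandermonde_mulVec_adjugate_hankel {d : ℕ} (x h : Fin d → ℂ)
    (M : Matrix (Fin d) (Fin d) ℂ) (t : Fin d → ℂ)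
    (hM : ∀ k l, M k l = ∑ i, x i ^ ((k : ℕ) + l)) (ht : ∀ k, t k = ∑ i, h i * x i ^ (k : ℕ))
    (j : Fin d) : ∑ l, (M.adjugate.mulVec t) l * x j ^ (l : ℕ) = M.det * h j := by
  set V := Matrix.vandermonde x with hV
  have hMV : M = V.transpose * V := by
    ext k l
    rw [hM, Matrix.mul_apply]
    simp [hV, Matrix.vandermonde_apply, pow_add]
  have htV : t = V.transpose.mulVec h := by
    ext k
    rw [ht]
    simp [hV, Matrix.mulVec, dotProduct, Matrix.vandermonde_apply, mul_comm]
  have key : V.mulVec (M.adjugate.mulVec t) = M.det • h := by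
    rw [hMV, htV, Matrix.adjugate_mul_distrib, Matrix.mulVec_mulVec, Matrix.mulVec_mulVec,
      Matrix.mul_assoc V, Matrix.mul_assoc V.adjugate, Matrix.adjugate_mul, Matrix.mul_smul,
      Matrix.mul_smul, Matrix.mul_one, Matrix.mul_adjugate, Matrix.det_mul]
    simp [Matrix.smul_mulVec, smul_smul]
  have := congrFun key j
  rw [Pi.smul_apply, smul_eq_mul] at this
  rw [← this]
  simp [hV, Matrix.mulVec, dotProduct, Matrix.vandermonde_apply, mul_comm]

theorem det_hankel_ne_zero {d : ℕ} {x : Fin d → ℂ} (hx : Function.Injective x)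
    (M : Matrix (Fin d) (Fin d) ℂ) (hM : ∀ k l, M k l = ∑ i, x i ^ ((k : ℕ) + l)) :
    M.det ≠ 0 := by
  have hMV : M = (Matrix.vandermonde x).transpose * Matrix.vandermonde x := by
    ext k l
    rw [hM, Matrix.mul_apply]
    simp [Matrix.vandermonde_apply, pow_add]
  rw [hMV, Matrix.det_mul, Matrix.det_transpose]
  have := Matrix.det_vandermonde_ne_zero_iff.2 hx
  exact mul_ne_zero this this

theorem finite_zeros_of_isCompact {U K : Set ℂ} (hU : IsOpen U) (hc : IsPreconnected U)
    {h : ℂ → ℂ} (hh : DifferentiableOn ℂ h U) (hne : ∃ z ∈ U, h z ≠ 0) (hK : IsCompact K)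
    (hKU : K ⊆ U) : {z ∈ K | h z = 0}.Finite := by
  by_contra hinf
  obtain ⟨a, haK, ha⟩ := Set.Infinite.exists_accPt_of_subset_isCompact hinf hK
    (fun z hz => hz.1)
  obtain ⟨z, hz, hz0⟩ := hne
  refine hz0 ((hh.analyticOnNhd hU).eqOn_zero_of_preconnected_of_frequently_eq_zero hc
    (hKU haK) ?_ hz)
  rw [accPt_iff_frequently_nhdsNE] at ha
  exact ha.mono fun y hy => hy.2

theorem exists_eq_prod_mul {U K : Set ℂ} (hU : IsOpen U) (hc : IsPreconnected U)
    {h : ℂ → ℂ} (hh : DifferentiableOn ℂ h U) (hne : ∃ z ∈ U, h z ≠ 0) (hK : IsCompact K)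
    (hKU : K ⊆ U) : ∃ (l : List ℂ) (e : ℂ → ℂ), (∀ a ∈ l, a ∈ K) ∧ DifferentiableOn ℂ e U ∧
      (∀ z ∈ U, h z = (l.map fun a => z - a).prod * e z) ∧ ∀ z ∈ K, e z ≠ 0 := by
  have hfin := finite_zeros_of_isCompact hU hc hh hne hK hKU
  induction hn : {z ∈ K | h z = 0}.ncard using Nat.strong_induction_on generalizing h with
  | _ n ih =>
  rcases Set.eq_empty_or_nonempty {z ∈ K | h z = 0} with hemp | ⟨a, haK, ha⟩
  · exact ⟨[], h, by simp, hh, by simp, fun z hz h0 =>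
      (hemp ▸ (⟨hz, h0⟩ : z ∈ {z ∈ K | h z = 0}) : z ∈ (∅ : Set ℂ))⟩
  have haU := hKU haK
  have han : AnalyticAt ℂ h a := hh.analyticAt (hU.mem_nhds haU)
  have hnz : ¬ ∀ᶠ z in 𝓝 a, h z = 0 := by
    intro hev
    obtain ⟨z, hz, hz0⟩ := hne
    exact hz0 ((hh.analyticOnNhd hU).eqOn_zero_of_preconnected_of_eventuallyEq_zero hc haU hev hz)
  obtain ⟨m, g, hg, hga, hgh⟩ := han.exists_eventuallyEq_pow_smul_nonzero_iff.2 hnz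
  set e := Function.update (fun z => h z / (z - a) ^ m) a (g a) with he
  have hm : m ≠ 0 := by
    rintro rfl
    have := hgh.self_of_nhds
    rw [ha] at this
    simp at this
    exact hga this.symm
  have hea : e a = g a := Function.update_self ..
  have hez : ∀ z, z ≠ a → e z = h z / (z - a) ^ m := fun z hz => Function.update_of_ne hz ..
  have heg : e =ᶠ[𝓝 a] g := by
    filter_upwards [hgh] with z hz
    by_cases hza : z = a
    · rw [hza, hea]
    · rw [hez z hza, hz, smul_eq_mul, mul_div_cancel_left₀ _ (pow_ne_zero _ (sub_ne_zero.2 hza))]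
  have hed : DifferentiableOn ℂ e U := by
    intro z hz
    apply DifferentiableAt.differentiableWithinAt
    by_cases hza : z = a
    · rw [hza]
      exact hg.differentiableAt.congr_of_eventuallyEq heg
    · have h1 : DifferentiableAt ℂ (fun z => h z / (z - a) ^ m) z :=
        (hh.differentiableAt (hU.mem_nhds hz)).div (by fun_prop)
          (pow_ne_zero _ (sub_ne_zero.2 hza))
      refine h1.congr_of_eventuallyEq ?_
      filter_upwards [isOpen_ne.mem_nhds hza] with y hy using hez y hy
  have hhe : ∀ z, h z = (z - a) ^ m * e z := by
    intro z
    by_cases hza : z = a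
    · rw [hza, ha, sub_self, zero_pow hm, zero_mul]
    · rw [hez z hza, mul_div_cancel₀ _ (pow_ne_zero _ (sub_ne_zero.2 hza))]
  have hne' : ∃ z ∈ U, e z ≠ 0 := ⟨a, haU, hea ▸ hga⟩
  have hss : {z ∈ K | e z = 0} ⊂ {z ∈ K | h z = 0} := by
    refine ⟨fun z hz => ⟨hz.1, by rw [hhe, hz.2, mul_zero]⟩, fun hsub => ?_⟩
    have := (hsub ⟨haK, ha⟩ : a ∈ {z ∈ K | e z = 0}).2
    exact hga (hea ▸ this)
  obtain ⟨l, e', hl, he', hprod, he0⟩ := ih _ (hn ▸ Set.ncard_lt_ncard hss hfin) hed hne'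
    (hfin.subset hss.1) rfl
  refine ⟨List.replicate m a ++ l, e', ?_, he', fun z hz => ?_, he0⟩
  · intro b hb
    rcases List.mem_append.1 hb with hb | hb
    · rwa [List.eq_of_mem_replicate hb]
    · exact hl b hb
  · rw [hhe z, hprod z hz, List.map_append, List.prod_append, List.map_replicate,
      List.prod_replicate, mul_assoc]

theorem differentiableOn_conj_inv_conj {B : ℂ → ℂ} {s t : Set ℂ} (hs : IsOpen s)
    (hB : DifferentiableOn ℂ B s) (ht0 : ∀ w ∈ t, w ≠ 0)
    (hts : ∀ w ∈ t, (conj w)⁻¹ ∈ s) : DifferentiableOn ℂ (fun w => conj (B (conj w)⁻¹)) t := by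
  intro w hw
  apply DifferentiableAt.differentiableWithinAt
  have h1 : DifferentiableAt ℂ B (conj w⁻¹) := by
    rw [map_inv₀]
    exact hB.differentiableAt (hs.mem_nhds (hts w hw))
  have h2 : DifferentiableAt ℂ (conj ∘ B ∘ conj) w⁻¹ := by
    have := h1.conj_conj
    rwa [conj_conj] at this
  have h3 := h2.comp w (differentiableAt_inv (ht0 w hw))
  refine h3.congr_of_eventuallyEq (.of_forall fun y => ?_)
  simp

theorem eq_zero_of_tendsto_zero_annulus {g : ℂ → ℂ} {R : ℝ}
    (hg : DifferentiableOn ℂ g {w | 1 < ‖w‖ ∧ ‖w‖ < R})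
    (h0 : ∀ ε > 0, ∃ r > 1, ∀ w : ℂ, 1 < ‖w‖ → ‖w‖ < r → ‖g w‖ ≤ ε) :
    ∀ w, 1 < ‖w‖ → ‖w‖ < R → g w = 0 := by
  intro w hw hwR
  obtain ⟨R', hwR', hR'⟩ := exists_between hwR
  have hsubA : ∀ r > 1, {z : ℂ | r ≤ ‖z‖ ∧ ‖z‖ ≤ R'} ⊆ {w | 1 < ‖w‖ ∧ ‖w‖ < R} :=
    fun r hr z hz => ⟨(show 1 < r from hr).trans_le hz.1, hz.2.trans_lt hR'⟩
  have hcomp : IsCompact {z : ℂ | ‖z‖ = R'} := by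
    have : {z : ℂ | ‖z‖ = R'} = sphere 0 R' := by ext; simp
    rw [this]
    exact isCompact_sphere _ _
  obtain ⟨C, hC⟩ := hcomp.exists_bound_of_continuousOn (hg.continuousOn.mono fun z hz =>
    ⟨(hw.trans hwR').trans_eq (Eq.symm hz), (le_of_eq hz).trans_lt hR'⟩)
  have hR'0 : 0 < R' := by linarith
  have hw0 : 0 < ‖w‖ := by linarith
  have key : ∀ n : ℕ, ‖g w‖ ≤ ‖w‖ ^ n * (C * (R' ^ n)⁻¹) := by
    intro n
    refine le_of_forall_pos_le_add fun ε hε => ?_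
    set ε' := ε / ‖w‖ ^ n with hε'
    have hε'0 : 0 < ε' := by positivity
    obtain ⟨r0, hr0, hb⟩ := h0 ε' hε'0
    obtain ⟨r, hr1, hr⟩ := exists_between (lt_min hr0 hw)
    set U := {z : ℂ | r < ‖z‖ ∧ ‖z‖ < R'} with hU
    have hUo : IsOpen U := (isOpen_lt continuous_const continuous_norm).inter
      (isOpen_lt continuous_norm continuous_const)
    have hcl : closure U ⊆ {z : ℂ | r ≤ ‖z‖ ∧ ‖z‖ ≤ R'} := by
      refine closure_minimal (fun z hz => ⟨hz.1.le, hz.2.le⟩) ?_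
      exact (isClosed_le continuous_const continuous_norm).inter
        (isClosed_le continuous_norm continuous_const)
    have hd : DifferentiableOn ℂ (fun z => g z * (z ^ n)⁻¹) (closure U) := by
      refine (hg.mono (hcl.trans (hsubA r hr1))).mul
        (DifferentiableOn.inv (by fun_prop) fun z hz => pow_ne_zero _ ?_)
      have := (hcl hz).1
      exact norm_pos_iff.1 (by linarith)
    have hC0 : 0 ≤ C := by
      have h := hC (R' : ℂ) (by simp [abs_of_pos hR'0])
      exact (norm_nonneg _).trans h
    have hmain := Complex.norm_le_of_forall_mem_frontier_norm_le
      (isBounded_ball.subset (t := ball (0 : ℂ) R') fun z hz => by simpa using hz.2)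
      hd.diffContOnCl (C := ε' + C * (R' ^ n)⁻¹) (fun y hy => ?_)
      (subset_closure (show w ∈ U from ⟨hr.trans_le (min_le_right _ _), hwR'⟩))
    · rw [norm_mul, norm_inv, norm_pow, ← div_eq_mul_inv, div_le_iff₀ (by positivity)] at hmain
      refine hmain.trans (le_of_eq ?_)
      rw [hε']
      field_simp
      ring
    · rw [hUo.frontier_eq] at hy
      have hyc := hcl hy.1
      rw [norm_mul, norm_inv, norm_pow]
      have hy1 : 1 < ‖y‖ := hr1.trans_le hyc.1
      rcases hyc.2.eq_or_lt with hyR | hyR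
      · have := hC y hyR
        rw [hyR]
        have : ‖g y‖ * (R' ^ n)⁻¹ ≤ C * (R' ^ n)⁻¹ := by gcongr
        linarith
      · have hyr : ‖y‖ = r := by
          refine le_antisymm ?_ hyc.1
          by_contra! hlt
          exact hy.2 ⟨hlt, hyR⟩
        have h1 := hb y hy1 (by rw [hyr]; exact hr.trans_le (min_le_left _ _))
        have h2 : (‖y‖ ^ n)⁻¹ ≤ 1 := inv_le_one_of_one_le₀ (one_le_pow₀ hy1.le)
        have h3 : ‖g y‖ * (‖y‖ ^ n)⁻¹ ≤ ε' * 1 := by gcongr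
        have h4 : 0 ≤ C * (R' ^ n)⁻¹ := by positivity
        linarith
  have hlim : Tendsto (fun n : ℕ => ‖w‖ ^ n * (C * (R' ^ n)⁻¹)) atTop (𝓝 (C * 0)) := by
    have := (tendsto_pow_atTop_nhds_zero_of_lt_one (r := ‖w‖ / R') (by positivity)
      ((div_lt_one hR'0).2 hwR')).const_mul C
    refine this.congr fun n => ?_
    rw [div_pow]
    ring
  rw [mul_zero] at hlim
  exact norm_le_zero_iff.1 (ge_of_tendsto' hlim key)

theorem norm_inv_conj (w : ℂ) : ‖(conj w)⁻¹‖ = ‖w‖⁻¹ := by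
  rw [norm_inv, RCLike.norm_conj]

theorem norm_sub_inv_conj_le {w : ℂ} (hw : 1 < ‖w‖) : ‖w - (conj w)⁻¹‖ ≤ 2 * (‖w‖ - 1) := by
  have h0 : w ≠ 0 := norm_pos_iff.1 (by linarith)
  have hc : conj w ≠ 0 := (map_ne_zero _).2 h0
  have h1 : w - (conj w)⁻¹ = ((‖w‖ ^ 2 - 1 : ℝ) : ℂ) * (conj w)⁻¹ := by
    field_simp
    rw [mul_conj, Complex.normSq_eq_norm_sq]
    push_cast
    ring
  rw [h1, norm_mul, norm_inv_conj, norm_real, Real.norm_of_nonneg (by nlinarith),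
    ← div_eq_mul_inv, div_le_iff₀ (by linarith)]
  nlinarith

/-- If the boundary values of `conj Z` and `B` on the unit circle agree, then `Z` extends across
the circle, by reflection of `B`. -/
theorem exists_extension_of_reflection {Z B : ℂ → ℂ} {r₀ R : ℝ} (h0 : 0 < r₀) (hR1 : 1 < R)
    (hR : R < r₀⁻¹) (hZ : DifferentiableOn ℂ Z (ball 0 1))
    (hB : DifferentiableOn ℂ B {w | r₀ < ‖w‖ ∧ ‖w‖ < 1})
    (hZB : ∀ ε > 0, ∃ r < 1, ∀ w : ℂ, r < ‖w‖ → ‖w‖ < 1 → ‖conj (Z w) - B w‖ ≤ ε) :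
    ∃ F : ℂ → ℂ, DifferentiableOn ℂ F (ball 0 R) ∧ (∀ w, ‖w‖ < 1 → F w = Z w) ∧
      ∀ w, R⁻¹ < ‖w‖ → ‖w‖ < 1 → B w = conj (F (conj w)⁻¹) := by
  set Bs : ℂ → ℂ := fun w => conj (B (conj w)⁻¹) with hBs
  have hopen : IsOpen {w : ℂ | r₀ < ‖w‖ ∧ ‖w‖ < 1} :=
    (isOpen_lt continuous_const continuous_norm).inter (isOpen_lt continuous_norm continuous_const)
  have hopen' : IsOpen {w : ℂ | 1 < ‖w‖ ∧ ‖w‖ < r₀⁻¹} :=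
    (isOpen_lt continuous_const continuous_norm).inter (isOpen_lt continuous_norm continuous_const)
  have hBd : DifferentiableOn ℂ Bs {w | 1 < ‖w‖ ∧ ‖w‖ < r₀⁻¹} := by
    refine differentiableOn_conj_inv_conj hopen hB (fun w hw => norm_pos_iff.1
      (by linarith [hw.1])) fun w hw => ?_
    rw [Set.mem_ofPred_eq, norm_inv_conj]
    exact ⟨(lt_inv_comm₀ h0 (by linarith [hw.1])).2 hw.2, inv_lt_one_of_one_lt₀ hw.1⟩
  obtain ⟨R₁, hRR, hR₁⟩ := exists_between hR
  have hR₁0 : 0 < R₁ := by linarith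
  have hnear : ∀ ε > 0, ∃ r > 1, ∀ w : ℂ, 1 < ‖w‖ → ‖w‖ < r → ‖Bs w - Z (conj w)⁻¹‖ ≤ ε := by
    intro ε hε
    obtain ⟨r, hr, hb⟩ := hZB ε hε
    obtain ⟨s, hs, hs1⟩ := exists_between (max_lt hr one_pos)
    have hs0 : 0 < s := (le_max_right _ _).trans_lt hs
    refine ⟨s⁻¹, (one_lt_inv₀ hs0).2 hs1, fun w hw hws => ?_⟩
    have h2 : r < ‖(conj w)⁻¹‖ := by
      rw [norm_inv_conj]
      exact ((le_max_left _ _).trans_lt hs).trans ((lt_inv_comm₀ hs0 (by linarith)).2 hws)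
    have h3 : ‖(conj w)⁻¹‖ < 1 := by
      rw [norm_inv_conj]
      exact inv_lt_one_of_one_lt₀ hw
    have := hb _ h2 h3
    rw [← RCLike.norm_conj, map_sub, conj_conj, norm_sub_rev] at this
    exact this
  have hsub : ∀ r > 1, ∀ z ∈ closedBall (0 : ℂ) R₁ \ ball 0 r, 1 < ‖z‖ ∧ ‖z‖ < r₀⁻¹ := by
    intro r hr z hz
    simp only [Set.mem_sdiff, mem_closedBall, dist_zero_right, mem_ball, not_lt] at hz
    exact ⟨by linarith, by linarith⟩
  have hci : CircleIntegrable Bs 0 R₁ := by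
    refine ContinuousOn.circleIntegrable hR₁0.le (hBd.continuousOn.mono fun z hz => ?_)
    have : ‖z‖ = R₁ := by simpa using hz
    exact ⟨by linarith, by linarith⟩
  set F : ℂ → ℂ := fun w => (2 * Real.pi * I : ℂ)⁻¹ • ∮ ζ in C(0, R₁), (ζ - w)⁻¹ • Bs ζ with hF
  have hFd : DifferentiableOn ℂ F (ball 0 R₁) := by
    have := (hasFPowerSeriesOn_cauchy_integral (R := ⟨R₁, hR₁0.le⟩) hci hR₁0).differentiableOn
    exact this.mono (Metric.eball_coe (x := (0 : ℂ)) (ε := ⟨R₁, hR₁0.le⟩)).ge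
  have hann : ∀ r > 1, r ≤ R₁ → ∀ w : ℂ, ‖w‖ < 1 →
      F w = (2 * Real.pi * I : ℂ)⁻¹ • ∮ ζ in C(0, r), (ζ - w)⁻¹ • Bs ζ := by
    intro r hr hrR w hw
    simp only [hF]
    congr 1
    have hne : ∀ z : ℂ, 1 < ‖z‖ → z - w ≠ 0 := fun z hz h => by
      rw [sub_eq_zero.1 h] at hz
      linarith
    have hdd : ∀ z : ℂ, 1 < ‖z‖ ∧ ‖z‖ < r₀⁻¹ → DifferentiableAt ℂ (fun ζ => (ζ - w)⁻¹ • Bs ζ) z :=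
      fun z hz => ((differentiableAt_id.sub_const w).inv (hne z hz.1)).smul
        (hBd.differentiableAt (hopen'.mem_nhds hz))
    refine Complex.circleIntegral_eq_of_differentiable_on_annulus_off_countable
      (by linarith) hrR countable_empty
      (fun z hz => (hdd z (hsub r hr z hz)).continuousAt.continuousWithinAt) fun z hz => ?_
    refine hdd z (hsub r hr z ⟨ball_subset_closedBall hz.1.1, fun h => hz.1.2
      (ball_subset_closedBall h)⟩)
  have hFZ : ∀ w, ‖w‖ < 1 → F w = Z w := by
    intro w hw
    have hw0 : 0 < 1 - ‖w‖ := by linarith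
    rw [← sub_eq_zero, ← norm_le_zero_iff]
    refine le_of_forall_pos_le_add fun ε hε => ?_
    rw [zero_add]
    obtain ⟨r, hr, hb⟩ := hnear (ε * (1 - ‖w‖) / R₁) (by positivity)
    have hZc : Tendsto (fun s : ℝ => ‖F w - Z (w / (s : ℂ) ^ 2)‖) (𝓝[>] 1) (𝓝 ‖F w - Z w‖) := by
      have h1 : ContinuousAt (fun s : ℝ => w / (s : ℂ) ^ 2) 1 :=
        ContinuousAt.div (by fun_prop) (by fun_prop) (by simp)
      have h2 : ContinuousAt Z w :=
        (hZ.differentiableAt (isOpen_ball.mem_nhds (by simpa using hw))).continuousAt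
      have h3 : ContinuousAt (fun s : ℝ => Z (w / (s : ℂ) ^ 2)) 1 := by
        refine ContinuousAt.comp (g := Z) (f := fun s : ℝ => w / (s : ℂ) ^ 2) ?_ h1
        simpa using h2
      have h4 := h3.tendsto
      simp only [ofReal_one, one_pow, div_one] at h4
      exact ((tendsto_const_nhds.sub h4).norm).mono_left nhdsWithin_le_nhds
    refine le_of_tendsto hZc ?_
    filter_upwards [Ioo_mem_nhdsGT (lt_min hr (hR1.trans hRR))] with s hs
    have hs1 := hs.1
    have hs0 : 0 < s := by linarith
    have hsr := hs.2.trans_le (min_le_left _ _)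
    have hsR := hs.2.trans_le (min_le_right _ _)
    have hZs : DifferentiableOn ℂ (fun ζ => Z (ζ / (s : ℂ) ^ 2)) (closedBall 0 s) := by
      refine hZ.comp (by fun_prop) fun z hz => ?_
      simp only [mem_closedBall, dist_zero_right, mem_ball] at hz ⊢
      rw [norm_div, norm_pow, norm_real, Real.norm_of_nonneg hs0.le, div_lt_one (by positivity)]
      nlinarith
    have hcauchy := hZs.circleIntegral_sub_inv_smul (w := w) (by simp; linarith)
    have hZint : (2 * Real.pi * I : ℂ)⁻¹ • (∮ ζ in C(0, s), (ζ - w)⁻¹ • Z (ζ / (s : ℂ) ^ 2)) =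
        Z (w / (s : ℂ) ^ 2) := by
      rw [hcauchy, smul_smul, inv_mul_cancel₀ two_pi_I_ne_zero, one_smul]
    have hne : ∀ z ∈ sphere (0 : ℂ) s, z - w ≠ 0 := fun z hz h => by
      have : ‖z‖ = s := by simpa using hz
      rw [sub_eq_zero.1 h] at this
      linarith
    have hinv : ContinuousOn (fun ζ : ℂ => (ζ - w)⁻¹) (sphere 0 s) :=
      ContinuousOn.inv₀ (by fun_prop) hne
    rw [hann s hs1 hsR.le w hw, ← hZint, ← smul_sub, ← circleIntegral.integral_sub]
    · refine (circleIntegral.norm_two_pi_i_inv_smul_integral_le_of_norm_le_const hs0.le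
        (C := (1 - ‖w‖)⁻¹ * (ε * (1 - ‖w‖) / R₁)) fun z hz => ?_).trans ?_
      · have hzs : ‖z‖ = s := by simpa using hz
        rw [← smul_sub, norm_smul, norm_inv]
        have h5 : 1 - ‖w‖ ≤ ‖z - w‖ := by
          have := norm_sub_norm_le z w
          linarith
        have h6 : z / (s : ℂ) ^ 2 = (conj z)⁻¹ := by
          have hz0 : z ≠ 0 := norm_pos_iff.1 (by linarith)
          have hc : conj z ≠ 0 := (map_ne_zero _).2 hz0
          rw [← hzs]
          have := Complex.mul_conj z
          rw [Complex.normSq_eq_norm_sq] at this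
          push_cast at this
          rw [← this]
          field_simp
        have h7 := hb z (by linarith) (by linarith)
        rw [h6]
        gcongr
      · have e1 : s * ((1 - ‖w‖)⁻¹ * (ε * (1 - ‖w‖) / R₁)) = ε * (s / R₁) := by field_simp
        rw [e1]
        have : s / R₁ ≤ 1 := (div_le_one hR₁0).2 hsR.le
        nlinarith
    · refine ContinuousOn.circleIntegrable hs0.le (hinv.smul (hBd.continuousOn.mono fun z hz => ?_))
      have : ‖z‖ = s := by simpa using hz
      exact ⟨by linarith, by linarith⟩
    · exact ContinuousOn.circleIntegrable hs0.le
        (hinv.smul (hZs.continuousOn.mono sphere_subset_closedBall))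
  refine ⟨F, hFd.mono (ball_subset_ball hRR.le), hFZ, fun w hw hw1 => ?_⟩
  have hwpos : 0 < ‖w‖ := (inv_pos.2 (by linarith)).trans hw
  have hzero := eq_zero_of_tendsto_zero_annulus (g := fun w => F w - Bs w) (R := R) ?_ ?_ (conj w)⁻¹ ?_ ?_
  · have h8 : F (conj w)⁻¹ = Bs (conj w)⁻¹ := sub_eq_zero.1 hzero
    rw [h8, hBs]
    simp
  · refine (hFd.mono fun z hz => ?_).sub (hBd.mono fun z hz => ⟨hz.1, hz.2.trans hR⟩)
    simpa using hz.2.trans hRR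
  · intro ε hε
    have huc := (isCompact_closedBall (0 : ℂ) R).uniformContinuousOn_of_continuous
      (hFd.continuousOn.mono (closedBall_subset_ball hRR))
    rw [Metric.uniformContinuousOn_iff] at huc
    obtain ⟨δ, hδ, hu⟩ := huc (ε / 2) (half_pos hε)
    obtain ⟨r, hr, hb⟩ := hnear (ε / 2) (half_pos hε)
    refine ⟨min (min r R) (1 + δ / 2), lt_min (lt_min hr hR1) (by linarith), fun z hz hzr => ?_⟩
    have hz1 := hzr.trans_le ((min_le_left _ _).trans (min_le_left _ _))
    have hz2 := hzr.trans_le ((min_le_left _ _).trans (min_le_right _ _))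
    have hz3 := hzr.trans_le (min_le_right _ _)
    have hv : ‖(conj z)⁻¹‖ < 1 := by
      rw [norm_inv_conj]
      exact inv_lt_one_of_one_lt₀ hz
    have h9 := hu z (by simpa using hz2.le) (conj z)⁻¹
      (by rw [mem_closedBall, dist_zero_right]; linarith) (by
        rw [dist_eq_norm]
        have := norm_sub_inv_conj_le hz
        linarith)
    rw [dist_eq_norm, hFZ _ hv] at h9
    have h10 := hb z hz hz1
    have : F z - Bs z = (F z - Z (conj z)⁻¹) - (Bs z - Z (conj z)⁻¹) := by ring
    rw [this]
    exact (norm_sub_le _ _).trans (by linarith)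
  · rw [norm_inv_conj]
    exact (one_lt_inv₀ hwpos).2 hw1
  · rw [norm_inv_conj]
    exact (inv_lt_comm₀ hwpos (by linarith)).2 hw

/-- The points of the disc over which `f` has no critical point. -/
def regularValues (Ω : Set ℂ) (f : ℂ → ℂ) : Set ℂ :=
  ball 0 1 \ f '' {z ∈ Ω | deriv f z = 0}

/-- The functions `s i` parametrize, without repetition, the fibre of `f` over `w`, and are local
inverses of `f`. -/
def IsFibreEnum (Ω : Set ℂ) (f : ℂ → ℂ) {d : ℕ} (s : Fin d → ℂ → ℂ) (w : ℂ) : Prop :=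
  Function.Injective (fun i => s i w) ∧ range (fun i => s i w) = Ω ∩ f ⁻¹' {w} ∧
    ∀ i, HasDerivAt (s i) (deriv f (s i w))⁻¹ w

namespace IsProperOntoDisc

variable {Ω : Set ℂ} {f : ℂ → ℂ}

theorem finite_fibre (hf : IsProperOntoDisc Ω f) (hΩ : IsOpen Ω) (hc : IsPreconnected Ω) {w : ℂ}
    (hw : ‖w‖ < 1) : (Ω ∩ f ⁻¹' {w}).Finite := by
  have hne : ∃ z ∈ Ω, f z - w ≠ 0 := by
    obtain ⟨v, hv, hvw⟩ : ∃ v : ℂ, ‖v‖ < 1 ∧ v ≠ w := by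
      by_cases h : w = 0
      · exact ⟨1 / 2, by norm_num, by rw [h]; norm_num⟩
      · exact ⟨0, by simp, Ne.symm h⟩
    obtain ⟨z, hz, rfl⟩ := hf.exists_eq hv
    exact ⟨z, hz, sub_ne_zero.2 hvw⟩
  refine (finite_zeros_of_isCompact hΩ hc (hf.1.sub_const w) hne (hf.isCompact_preimage hw)
    inter_subset_left).subset fun z hz => ⟨⟨hz.1, ?_⟩, sub_eq_zero.2 hz.2⟩
  have : f z = w := hz.2
  simp [this]

theorem exists_deriv_ne_zero (hf : IsProperOntoDisc Ω f) (hΩ : IsOpen Ω)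
    (hc : IsPreconnected Ω) : ∃ z ∈ Ω, deriv f z ≠ 0 := by
  by_contra! h
  obtain ⟨z, hz, hz0⟩ := hf.exists_eq (w := 0) (by simp)
  obtain ⟨z', hz', hz1⟩ := hf.exists_eq (w := 1 / 2) (by norm_num)
  have := hΩ.is_const_of_deriv_eq_zero hc hf.1 h hz hz'
  rw [hz0, hz1] at this
  norm_num at this

theorem finite_criticalValues (hf : IsProperOntoDisc Ω f) (hΩ : IsOpen Ω)
    (hc : IsPreconnected Ω) {r : ℝ} (hr : r < 1) :
    (f '' {z ∈ Ω | deriv f z = 0} ∩ closedBall 0 r).Finite := by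
  refine ((finite_zeros_of_isCompact hΩ hc (hf.1.deriv hΩ) (hf.exists_deriv_ne_zero hΩ hc)
    (hf.isCompact_preimage hr) inter_subset_left).image f).subset ?_
  rintro _ ⟨⟨z, ⟨hz, h0⟩, rfl⟩, hzr⟩
  exact ⟨z, ⟨⟨hz, hzr⟩, h0⟩, rfl⟩

theorem countable_criticalValues (hf : IsProperOntoDisc Ω f) (hΩ : IsOpen Ω)
    (hc : IsPreconnected Ω) : (f '' {z ∈ Ω | deriv f z = 0}).Countable := by
  refine (countable_iUnion fun n : ℕ => (hf.finite_criticalValues hΩ hc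
    (r := 1 - 1 / (n + 1 : ℝ)) (by linarith [Nat.one_div_pos_of_nat (α := ℝ) (n := n)])).countable).mono ?_
  rintro _ ⟨z, hz, rfl⟩
  obtain ⟨n, hn⟩ := exists_nat_one_div_lt (sub_pos.2 (hf.norm_lt hz.1))
  exact mem_iUnion.2 ⟨n, ⟨z, hz, rfl⟩, by rw [mem_closedBall_zero_iff]; linarith⟩

theorem eventually_mem_regularValues (hf : IsProperOntoDisc Ω f) (hΩ : IsOpen Ω)
    (hc : IsPreconnected Ω) {w : ℂ} (hw : ‖w‖ < 1) :
    ∀ᶠ v in 𝓝[≠] w, v ∈ regularValues Ω f := by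
  obtain ⟨r, hr, hr1⟩ := exists_between hw
  have h1 : ∀ᶠ v in 𝓝[≠] w, v ∉ f '' {z ∈ Ω | deriv f z = 0} ∩ closedBall 0 r := by
    have hfin := (hf.finite_criticalValues hΩ hc hr1).subset
      (sdiff_subset (s := f '' {z ∈ Ω | deriv f z = 0} ∩ closedBall 0 r) (t := {w}))
    have := hfin.isClosed.isOpen_compl.mem_nhds (x := w) (by simp)
    filter_upwards [nhdsWithin_le_nhds this, self_mem_nhdsWithin] with v hv hvw h
    exact hv ⟨h, hvw⟩
  have h2 : ∀ᶠ v in 𝓝[≠] w, ‖v‖ < r :=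
    nhdsWithin_le_nhds ((isOpen_lt continuous_norm continuous_const).mem_nhds hr)
  filter_upwards [h1, h2] with v hv hvr
  exact ⟨by simpa using hvr.trans hr1, fun h => hv ⟨h, by simpa using hvr.le⟩⟩

theorem isOpen_regularValues (hf : IsProperOntoDisc Ω f) (hΩ : IsOpen Ω)
    (hc : IsPreconnected Ω) : IsOpen (regularValues Ω f) := by
  refine isOpen_iff_mem_nhds.2 fun w hw => ?_
  have := hf.eventually_mem_regularValues hΩ hc (w := w) (by simpa using hw.1)
  rw [eventually_nhdsWithin_iff] at this
  filter_upwards [this] with v hv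
  by_cases h : v = w
  · exact h ▸ hw
  · exact hv h

theorem isPreconnected_regularValues (hf : IsProperOntoDisc Ω f) (hΩ : IsOpen Ω)
    (hc : IsPreconnected Ω) : IsPreconnected (regularValues Ω f) := by
  set φ : ℂ ≃ₜ ball (0 : ℂ) 1 := Homeomorph.unitBall
  set g : ℂ → ℂ := fun z => φ z
  have hg : Function.Injective g := Subtype.val_injective.comp φ.injective
  have hcount : (g ⁻¹' (f '' {z ∈ Ω | deriv f z = 0})).Countable :=
    (hf.countable_criticalValues hΩ hc).preimage hg
  have h1 : IsPreconnected (g ⁻¹' (f '' {z ∈ Ω | deriv f z = 0}))ᶜ :=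
    (hcount.isConnected_compl_of_one_lt_rank (by simp)).isPreconnected
  have h2 := h1.image g (continuous_subtype_val.comp φ.continuous).continuousOn
  convert h2 using 1
  ext w
  constructor
  · rintro ⟨hw, hn⟩
    refine ⟨φ.symm ⟨w, hw⟩, ?_, by simp [g]⟩
    simpa [g] using hn
  · rintro ⟨z, hz, rfl⟩
    exact ⟨(φ z).2, hz⟩

theorem exists_isFibreEnum (hf : IsProperOntoDisc Ω f) (hΩ : IsOpen Ω) (hc : IsPreconnected Ω)
    {w₀ : ℂ} (hw₀ : w₀ ∈ regularValues Ω f) :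
    ∃ s : Fin (Ω ∩ f ⁻¹' {w₀}).ncard → ℂ → ℂ, ∀ᶠ w in 𝓝 w₀, IsFibreEnum Ω f s w := by
  have hw1 : ‖w₀‖ < 1 := by simpa using hw₀.1
  have hfin := hf.finite_fibre hΩ hc hw1
  set Φ := Ω ∩ f ⁻¹' {w₀}
  have : Finite Φ := hfin
  set e : Φ ≃ Fin Φ.ncard := Finite.equivFinOfCardEq rfl
  set a : Fin Φ.ncard → ℂ := fun i => e.symm i
  have ha (i) : a i ∈ Ω ∧ f (a i) = w₀ := (e.symm i).2
  have hainj : Function.Injective a := Subtype.val_injective.comp e.symm.injective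
  have hasurj (z) (hz : z ∈ Ω) (hzw : f z = w₀) : ∃ i, a i = z :=
    ⟨e ⟨z, hz, hzw⟩, by simp [a]⟩
  have hd (i) : deriv f (a i) ≠ 0 := fun h => hw₀.2 ⟨a i, ⟨(ha i).1, h⟩, (ha i).2⟩
  have hs (i) : HasStrictDerivAt f (deriv f (a i)) (a i) :=
    (hf.1.analyticAt (hΩ.mem_nhds (ha i).1)).hasStrictDerivAt
  have key (i) : ∃ (g : ℂ → ℂ) (U : Set ℂ), IsOpen U ∧ a i ∈ U ∧ (∀ z ∈ U, g (f z) = z) ∧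
      g w₀ = a i ∧ ContinuousAt g w₀ ∧ ∀ᶠ w in 𝓝 w₀, f (g w) = w ∧ g w ∈ Ω ∧
        HasDerivAt g (deriv f (g w))⁻¹ w := by
    set φ := ((hs i).hasStrictFDerivAt_equiv (hd i)).toOpenPartialHomeomorph f with hφ
    have hco : (φ : ℂ → ℂ) = f := rfl
    have hsrc : a i ∈ φ.source :=
      ((hs i).hasStrictFDerivAt_equiv (hd i)).mem_toOpenPartialHomeomorph_source
    have hg0 : φ.symm w₀ = a i := by
      rw [← (ha i).2, ← hco]; exact φ.left_inv hsrc
    have htgt : w₀ ∈ φ.target := by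
      rw [← (ha i).2, ← hco]; exact φ.map_source hsrc
    have hcont := φ.symm.continuousAt (x := w₀) htgt
    have hfg : ∀ᶠ w in 𝓝 w₀, f (φ.symm w) = w := by
      filter_upwards [φ.open_target.mem_nhds htgt] with w hw using φ.right_inv hw
    have hΩev : ∀ᶠ w in 𝓝 w₀, φ.symm w ∈ Ω :=
      hcont.eventually_mem (hΩ.mem_nhds (by rw [hg0]; exact (ha i).1))
    have hdev : ∀ᶠ w in 𝓝 w₀, deriv f (φ.symm w) ≠ 0 := by
      have h1 : ContinuousAt (deriv f) (φ.symm w₀) := by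
        rw [hg0]
        exact ((hf.1.deriv hΩ).differentiableAt (hΩ.mem_nhds (ha i).1)).continuousAt
      exact (h1.comp hcont).eventually_ne (by simp only [Function.comp, hg0]; exact hd i)
    refine ⟨φ.symm, φ.source, φ.open_source, hsrc, fun z hz => φ.left_inv hz, hg0, hcont, ?_⟩
    filter_upwards [hfg, hfg.eventually_nhds, hΩev, hdev, φ.open_target.mem_nhds htgt]
      with w h1 h2 h3 h4 h5
    exact ⟨h1, h3, HasDerivAt.of_local_left_inverse (φ.symm.continuousAt h5)
      (hf.1.differentiableAt (hΩ.mem_nhds h3)).hasDerivAt h4 h2⟩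
  choose s U hUo haU hUs hs0 hsc hsev using key
  refine ⟨s, ?_⟩
  have hinj : ∀ᶠ w in 𝓝 w₀, ∀ i j, i ≠ j → s i w ≠ s j w := by
    refine eventually_all.2 fun i => eventually_all.2 fun j => ?_
    by_cases hij : i = j
    · simp [hij]
    · have : s i w₀ - s j w₀ ≠ 0 := by
        rw [hs0, hs0]
        exact sub_ne_zero.2 fun h => hij (hainj h)
      filter_upwards [((hsc i).sub (hsc j)).eventually_ne this] with w hw _
        using sub_ne_zero.1 hw
  obtain ⟨r, hr, hr1⟩ := exists_between hw1
  have hcov : ∀ᶠ w in 𝓝 w₀, ∀ z ∈ Ω, f z = w → ∃ i, s i w = z := by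
    have hK := (hf.isCompact_preimage hr1).diff (isOpen_iUnion hUo)
    have hK' : IsCompact (f '' ((Ω ∩ f ⁻¹' closedBall 0 r) \ ⋃ i, U i)) :=
      hK.image_of_continuousOn (hf.1.continuousOn.mono (sdiff_subset.trans inter_subset_left))
    have hn : w₀ ∉ f '' ((Ω ∩ f ⁻¹' closedBall 0 r) \ ⋃ i, U i) := by
      rintro ⟨z, ⟨⟨hz, -⟩, hzU⟩, hzw⟩
      obtain ⟨i, rfl⟩ := hasurj z hz hzw
      exact hzU (mem_iUnion.2 ⟨i, haU i⟩)
    filter_upwards [hK'.isClosed.isOpen_compl.mem_nhds hn,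
      (isOpen_lt continuous_norm continuous_const).mem_nhds hr] with w hw hwr z hz hzw
    by_contra! h
    refine hw ⟨z, ⟨⟨hz, by simpa [hzw] using le_of_lt hwr⟩, fun hU => ?_⟩, hzw⟩
    obtain ⟨i, hi⟩ := mem_iUnion.1 hU
    exact h i (hzw ▸ hUs i z hi)
  filter_upwards [hinj, hcov, eventually_all.2 hsev] with w h1 h2 h3
  refine ⟨fun i j hij => by_contra fun h => h1 i j h hij, ?_, fun i => (h3 i).2.2⟩
  ext z
  constructor
  · rintro ⟨i, rfl⟩
    exact ⟨(h3 i).2.1, (h3 i).1⟩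
  · rintro ⟨hz, hzw⟩
    exact h2 z hz hzw

theorem exists_isFibreEnum_uniform (hf : IsProperOntoDisc Ω f) (hΩ : IsOpen Ω)
    (hc : IsPreconnected Ω) : ∃ d : ℕ, ∀ w₀ ∈ regularValues Ω f,
      ∃ s : Fin d → ℂ → ℂ, ∀ᶠ w in 𝓝 w₀, IsFibreEnum Ω f s w := by
  have hcont : ContinuousOn (fun w => (Ω ∩ f ⁻¹' {w}).ncard) (regularValues Ω f) := by
    intro w₀ hw₀
    obtain ⟨s, hs⟩ := hf.exists_isFibreEnum hΩ hc hw₀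
    refine ContinuousAt.continuousWithinAt ?_
    refine (continuousAt_const (y := (Ω ∩ f ⁻¹' {w₀}).ncard)).congr ?_
    filter_upwards [hs] with w hw
    rw [← hw.2.1, ← image_univ, ncard_image_of_injective _ hw.1]
    simp
  have hconst {w v} (hw : w ∈ regularValues Ω f) (hv : v ∈ regularValues Ω f) :=
    (hf.isPreconnected_regularValues hΩ hc).constant hcont hw hv
  rcases (regularValues Ω f).eq_empty_or_nonempty with h | ⟨v, hv⟩
  · exact ⟨0, by simp [h]⟩
  · refine ⟨(Ω ∩ f ⁻¹' {v}).ncard, fun w₀ hw₀ => ?_⟩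
    have := hconst hv hw₀
    rw [this]
    exact hf.exists_isFibreEnum hΩ hc hw₀

end IsProperOntoDisc

theorem differentiableOn_of_bddAbove_off_discrete {W R : Set ℂ} {t : ℂ → ℂ} (hW : IsOpen W)
    (hR : IsOpen R) (hWR : ∀ w ∈ W, ∀ᶠ v in 𝓝[≠] w, v ∈ R) (ht : DifferentiableOn ℂ t (W ∩ R))
    (hb : ∀ w ∈ W, ∃ C, ∀ᶠ v in 𝓝[≠] w, ‖t v‖ ≤ C) :
    ∃ T : ℂ → ℂ, DifferentiableOn ℂ T W ∧ ∀ w ∈ W ∩ R, T w = t w := by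
  have heq : ∀ w ∈ W ∩ R, limUnder (𝓝[≠] w) t = t w := fun w hw =>
    ((ht.differentiableAt ((hW.inter hR).mem_nhds hw)).continuousAt.tendsto.mono_left
      nhdsWithin_le_nhds).limUnder_eq
  refine ⟨fun w => limUnder (𝓝[≠] w) t, fun w hw => ?_, heq⟩
  obtain ⟨C, hC⟩ := hb w hw
  have hev : ∀ᶠ v in 𝓝[≠] w, v ∈ W ∩ R ∧ ‖t v‖ ≤ C := by
    filter_upwards [nhdsWithin_le_nhds (hW.mem_nhds hw), hWR w hw, hC] with v h1 h2 h3
    exact ⟨⟨h1, h2⟩, h3⟩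
  rw [eventually_nhdsWithin_iff, Metric.eventually_nhds_iff_ball] at hev
  obtain ⟨ε, hε, hball⟩ := hev
  have hmem : ball w ε ∈ 𝓝 w := ball_mem_nhds w hε
  have hd : DifferentiableOn ℂ t (ball w ε \ {w}) :=
    ht.mono fun v hv => (hball v hv.1 hv.2).1
  have hbd : BddAbove (norm ∘ t '' (ball w ε \ {w})) := by
    refine ⟨C, ?_⟩
    rintro _ ⟨v, hv, rfl⟩
    exact (hball v hv.1 hv.2).2
  have h1 := Complex.differentiableOn_update_limUnder_of_bddAbove hmem hd hbd
  have h2 := h1.differentiableAt hmem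
  refine (h2.congr_of_eventuallyEq ?_).differentiableWithinAt
  filter_upwards [hmem] with v hv
  by_cases h : v = w
  · rw [h, Function.update_self]
  · rw [Function.update_of_ne h]
    exact heq v (hball v hv h).1

/-- The sum of `g` over the fibre of `f` at `w`. -/
def fibreSum (Ω : Set ℂ) (f g : ℂ → ℂ) (w : ℂ) : ℂ := ∑ᶠ z ∈ Ω ∩ f ⁻¹' {w}, g z

theorem IsFibreEnum.fibreSum_eq {Ω : Set ℂ} {f : ℂ → ℂ} {d : ℕ} {s : Fin d → ℂ → ℂ} {w : ℂ}
    (h : IsFibreEnum Ω f s w) (g : ℂ → ℂ) : fibreSum Ω f g w = ∑ i, g (s i w) := by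
  rw [fibreSum, ← h.2.1, finsum_mem_range h.1, finsum_eq_sum_of_fintype]

theorem IsFibreEnum.mem {Ω : Set ℂ} {f : ℂ → ℂ} {d : ℕ} {s : Fin d → ℂ → ℂ} {w : ℂ}
    (h : IsFibreEnum Ω f s w) (i : Fin d) : s i w ∈ Ω ∧ f (s i w) = w := by
  have : s i w ∈ Ω ∩ f ⁻¹' {w} := h.2.1 ▸ mem_range_self i
  exact this

theorem IsFibreEnum.exists_eq {Ω : Set ℂ} {f : ℂ → ℂ} {d : ℕ} {s : Fin d → ℂ → ℂ} {w : ℂ}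
    (h : IsFibreEnum Ω f s w) {z : ℂ} (hz : z ∈ Ω) (hw : f z = w) : ∃ i, s i w = z := by
  have : z ∈ range (fun i => s i w) := h.2.1 ▸ ⟨hz, hw⟩
  exact this

theorem IsFibreEnum.hasDerivAt_fibreSum {Ω : Set ℂ} {f g : ℂ → ℂ} {d : ℕ} {s : Fin d → ℂ → ℂ}
    {w : ℂ} (h : ∀ᶠ v in 𝓝 w, IsFibreEnum Ω f s v)
    (hg : ∀ i, DifferentiableAt ℂ g (s i w)) :
    HasDerivAt (fibreSum Ω f g) (∑ i, deriv g (s i w) / deriv f (s i w)) w := by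
  have h1 : HasDerivAt (fun v => ∑ i, g (s i v)) (∑ i, deriv g (s i w) / deriv f (s i w)) w := by
    refine HasDerivAt.fun_sum fun i _ => ?_
    rw [div_eq_mul_inv]
    exact (hg i).hasDerivAt.comp w (h.self_of_nhds.2.2 i)
  refine h1.congr_of_eventuallyEq ?_
  filter_upwards [h] with v hv using hv.fibreSum_eq g

namespace IsProperOntoDisc

variable {Ω : Set ℂ} {f : ℂ → ℂ}

theorem eventually_map_mem_regularValues (hf : IsProperOntoDisc Ω f) (hΩ : IsOpen Ω)
    (hc : IsPreconnected Ω) {z : ℂ} (hz : z ∈ Ω) :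
    ∀ᶠ v in 𝓝[≠] z, v ∈ Ω ∧ f v ∈ regularValues Ω f := by
  have h1 := (hf.finite_fibre hΩ hc (hf.norm_lt hz)).subset
    (sdiff_subset (s := Ω ∩ f ⁻¹' {f z}) (t := {z}))
  have h2 := h1.isClosed.isOpen_compl.mem_nhds (x := z) (by simp)
  have h3 := hf.eventually_mem_regularValues hΩ hc (hf.norm_lt hz)
  rw [eventually_nhdsWithin_iff] at h3
  have h4 := (hf.1.differentiableAt (hΩ.mem_nhds hz)).continuousAt.eventually h3
  filter_upwards [nhdsWithin_le_nhds (hΩ.mem_nhds hz), nhdsWithin_le_nhds h2,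
    nhdsWithin_le_nhds h4, self_mem_nhdsWithin] with v hv h5 h6 h7
  exact ⟨hv, h6 fun h => h5 ⟨⟨hv, h⟩, h7⟩⟩

theorem exists_fibreSum_extension (hf : IsProperOntoDisc Ω f) (hΩ : IsOpen Ω)
    (hc : IsPreconnected Ω) {W : Set ℂ} (hW : IsOpen W) (hW1 : W ⊆ ball 0 1) {g : ℂ → ℂ}
    (hg : DifferentiableOn ℂ g (Ω ∩ f ⁻¹' W)) :
    ∃ T : ℂ → ℂ, DifferentiableOn ℂ T W ∧
      ∀ w ∈ W ∩ regularValues Ω f, T w = fibreSum Ω f g w := by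
  obtain ⟨d, hd⟩ := hf.exists_isFibreEnum_uniform hΩ hc
  have hWo : IsOpen (Ω ∩ f ⁻¹' W) := hf.isOpen_inter_ball hΩ hW
  refine differentiableOn_of_bddAbove_off_discrete hW (hf.isOpen_regularValues hΩ hc)
    (fun w hw => hf.eventually_mem_regularValues hΩ hc (by simpa using hW1 hw)) ?_ ?_
  · rintro w ⟨hw, hwR⟩
    obtain ⟨s, hs⟩ := hd w hwR
    refine (IsFibreEnum.hasDerivAt_fibreSum hs fun i => ?_).differentiableAt.differentiableWithinAt
    have := hs.self_of_nhds.mem i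
    exact hg.differentiableAt (hWo.mem_nhds ⟨this.1, by rw [mem_preimage, this.2]; exact hw⟩)
  · intro w hw
    obtain ⟨ε, hε, hball⟩ := Metric.nhds_basis_closedBall.mem_iff.1 (hW.mem_nhds hw)
    have hK : IsCompact (Ω ∩ f ⁻¹' closedBall w ε) :=
      hf.2.2 _ (hball.trans hW1) (isCompact_closedBall w ε)
    obtain ⟨C, hC⟩ := hK.exists_bound_of_continuousOn
      (hg.continuousOn.mono (inter_subset_inter_right _ (preimage_mono hball)))
    refine ⟨d * C, ?_⟩
    filter_upwards [hf.eventually_mem_regularValues hΩ hc (by simpa using hW1 hw),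
      nhdsWithin_le_nhds (closedBall_mem_nhds w hε)] with v hv hvε
    obtain ⟨s, hs⟩ := hd v hv
    rw [hs.self_of_nhds.fibreSum_eq]
    refine (norm_sum_le_of_le _ fun i _ => hC _ ?_).trans (by simp)
    have := hs.self_of_nhds.mem i
    exact ⟨this.1, by rw [mem_preimage, this.2]; exact hvε⟩

end IsProperOntoDisc

/-- Along the filter `l`, the function `g` is bounded and its conjugate is asymptotic to `h`. -/
def IsReflected (l : Filter ℂ) (g h : ℂ → ℂ) : Prop :=
  (∃ C : ℝ, ∀ᶠ z in l, ‖g z‖ ≤ C) ∧ Tendsto (fun z => conj (g z) - h z) l (𝓝 0)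

namespace IsReflected

variable {l : Filter ℂ} {g g₁ g₂ h h₁ h₂ : ℂ → ℂ}

theorem right_bounded (H : IsReflected l g h) : ∃ C : ℝ, ∀ᶠ z in l, ‖h z‖ ≤ C := by
  obtain ⟨⟨C, hC⟩, ht⟩ := H
  refine ⟨C + 1, ?_⟩
  have := (tendsto_zero_iff_norm_tendsto_zero.1 ht).eventually (gt_mem_nhds one_pos)
  filter_upwards [hC, this] with z h1 h2
  calc ‖h z‖ = ‖conj (g z) - (conj (g z) - h z)‖ := by rw [sub_sub_cancel]
    _ ≤ ‖conj (g z)‖ + ‖conj (g z) - h z‖ := norm_sub_le _ _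
    _ ≤ C + 1 := by rw [norm_conj]; linarith

theorem const (c : ℂ) : IsReflected l (fun _ => c) (fun _ => conj c) :=
  ⟨⟨‖c‖, Eventually.of_forall fun _ => le_rfl⟩, by simpa using tendsto_const_nhds⟩

theorem add (H₁ : IsReflected l g₁ h₁) (H₂ : IsReflected l g₂ h₂) :
    IsReflected l (fun z => g₁ z + g₂ z) (fun z => h₁ z + h₂ z) := by
  obtain ⟨⟨C₁, hC₁⟩, ht₁⟩ := H₁
  obtain ⟨⟨C₂, hC₂⟩, ht₂⟩ := H₂
  refine ⟨⟨C₁ + C₂, ?_⟩, ?_⟩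
  · filter_upwards [hC₁, hC₂] with z a b using norm_add_le_of_le a b
  · have := ht₁.add ht₂
    rw [add_zero] at this
    refine this.congr fun z => ?_
    rw [map_add]; ring

theorem mul (H₁ : IsReflected l g₁ h₁) (H₂ : IsReflected l g₂ h₂) :
    IsReflected l (fun z => g₁ z * g₂ z) (fun z => h₁ z * h₂ z) := by
  obtain ⟨D, hD⟩ := H₂.right_bounded
  obtain ⟨⟨C₁, hC₁⟩, ht₁⟩ := H₁
  obtain ⟨⟨C₂, hC₂⟩, ht₂⟩ := H₂
  refine ⟨⟨C₁ * C₂, ?_⟩, ?_⟩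
  · filter_upwards [hC₁, hC₂] with z a b
    rw [norm_mul]
    exact mul_le_mul a b (norm_nonneg _) ((norm_nonneg _).trans a)
  · have h1 : Tendsto (fun z => conj (g₁ z) * (conj (g₂ z) - h₂ z)) l (𝓝 0) := by
      refine squeeze_zero_norm' (a := fun z => C₁ * ‖conj (g₂ z) - h₂ z‖) ?_ ?_
      · filter_upwards [hC₁] with z a
        rw [norm_mul, norm_conj]
        gcongr
      · simpa using (tendsto_zero_iff_norm_tendsto_zero.1 ht₂).const_mul C₁
    have h2 : Tendsto (fun z => (conj (g₁ z) - h₁ z) * h₂ z) l (𝓝 0) := by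
      refine squeeze_zero_norm' (a := fun z => ‖conj (g₁ z) - h₁ z‖ * D) ?_ ?_
      · filter_upwards [hD] with z a
        rw [norm_mul]
        gcongr
      · simpa using (tendsto_zero_iff_norm_tendsto_zero.1 ht₁).mul_const D
    have := h1.add h2
    rw [add_zero] at this
    refine this.congr fun z => ?_
    rw [map_mul]; ring

theorem pow (H : IsReflected l g h) (n : ℕ) :
    IsReflected l (fun z => g z ^ n) (fun z => h z ^ n) := by
  induction n with
  | zero => simpa using const (l := l) 1
  | succ n ih => simpa only [pow_succ] using ih.mul H

theorem sum {ι : Type*} (s : Finset ι) {g h : ι → ℂ → ℂ}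
    (H : ∀ i ∈ s, IsReflected l (g i) (h i)) :
    IsReflected l (fun z => ∑ i ∈ s, g i z) (fun z => ∑ i ∈ s, h i z) := by
  classical
  induction s using Finset.induction_on with
  | empty => simpa using const (l := l) 0
  | insert a s ha ih =>
    simp only [Finset.sum_insert ha]
    exact (H a (Finset.mem_insert_self a s)).add (ih fun i hi => H i (Finset.mem_insert_of_mem hi))

theorem congr_right (H : IsReflected l g h₁) (hh : ∀ᶠ z in l, h₁ z = h₂ z) :
    IsReflected l g h₂ := by
  refine ⟨H.1, H.2.congr' ?_⟩
  filter_upwards [hh] with z b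
  rw [b]

theorem inv (H : IsReflected l g h) {δ : ℝ} (hδ : 0 < δ) (hg : ∀ᶠ z in l, δ ≤ ‖g z‖) :
    IsReflected l (fun z => (g z)⁻¹) (fun z => (h z)⁻¹) := by
  have hh : ∀ᶠ z in l, δ / 2 ≤ ‖h z‖ := by
    have := (tendsto_zero_iff_norm_tendsto_zero.1 H.2).eventually (gt_mem_nhds (half_pos hδ))
    filter_upwards [hg, this] with z h1 h2
    have h3 : ‖conj (g z)‖ - ‖h z‖ ≤ ‖conj (g z) - h z‖ := norm_sub_norm_le _ _
    rw [norm_conj] at h3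
    linarith
  refine ⟨⟨δ⁻¹, ?_⟩, ?_⟩
  · filter_upwards [hg] with z a
    rw [norm_inv]
    exact inv_anti₀ hδ a
  · refine squeeze_zero_norm' (a := fun z => δ⁻¹ * (δ / 2)⁻¹ * ‖conj (g z) - h z‖) ?_ ?_
    · filter_upwards [hg, hh] with z a b
      have hg0 : conj (g z) ≠ 0 := by
        intro h0
        rw [← norm_conj, h0, norm_zero] at a
        linarith
      have hh0 : h z ≠ 0 := by
        intro h0
        rw [h0, norm_zero] at b
        linarith
      rw [map_inv₀, inv_sub_inv hg0 hh0, norm_div, norm_mul, norm_conj, norm_sub_rev,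
        div_eq_inv_mul, mul_inv]
      gcongr
    · simpa using (tendsto_zero_iff_norm_tendsto_zero.1 H.2).const_mul (δ⁻¹ * (δ / 2)⁻¹)

end IsReflected

theorem differentiableAt_det {d : ℕ} {M : ℂ → Matrix (Fin d) (Fin d) ℂ} {w : ℂ}
    (hM : ∀ i j, DifferentiableAt ℂ (fun v => M v i j) w) :
    DifferentiableAt ℂ (fun v => (M v).det) w := by
  simp only [Matrix.det_apply']
  fun_prop

theorem differentiableAt_adjugate {d : ℕ} {M : ℂ → Matrix (Fin d) (Fin d) ℂ} {w : ℂ}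
    (hM : ∀ i j, DifferentiableAt ℂ (fun v => M v i j) w) (i j : Fin d) :
    DifferentiableAt ℂ (fun v => (M v).adjugate i j) w := by
  simp only [Matrix.adjugate_apply]
  refine differentiableAt_det fun k l => ?_
  by_cases h : k = j
  · simp [h]
  · simpa [Matrix.updateRow_ne h] using hM k l

/-- The Hankel matrix of a sequence of functions. -/
def hankel (F : ℕ → ℂ → ℂ) (d : ℕ) (w : ℂ) : Matrix (Fin d) (Fin d) ℂ :=
  Matrix.of fun k l => F (k + l) w

/-- The vector of normalized derivatives of a sequence of functions. -/
def hankelVec (F : ℕ → ℂ → ℂ) (d : ℕ) (w : ℂ) : Fin d → ℂ :=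
  fun k => deriv (F (k + 1)) w / (k + 1)

/-- Cramer's numerators of the linear system attached to `hankel` and `hankelVec`. -/
def hankelCoeff (F : ℕ → ℂ → ℂ) (d : ℕ) (l : Fin d) (w : ℂ) : ℂ :=
  ((hankel F d w).adjugate.mulVec (hankelVec F d w)) l

theorem differentiableOn_det_hankel {F : ℕ → ℂ → ℂ} {U : Set ℂ} (hU : IsOpen U)
    (hF : ∀ k, DifferentiableOn ℂ (F k) U) (d : ℕ) :
    DifferentiableOn ℂ (fun w => (hankel F d w).det) U := fun _ hw =>
  (differentiableAt_det fun i j =>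
    (hF (i + j)).differentiableAt (hU.mem_nhds hw)).differentiableWithinAt

theorem differentiableOn_hankelCoeff {F : ℕ → ℂ → ℂ} {U : Set ℂ} (hU : IsOpen U)
    (hF : ∀ k, DifferentiableOn ℂ (F k) U) {d : ℕ} (l : Fin d) :
    DifferentiableOn ℂ (hankelCoeff F d l) U := by
  intro w hw
  have h1 : ∀ i j, DifferentiableAt ℂ (fun w => (hankel F d w).adjugate i j) w :=
    differentiableAt_adjugate fun i j => (hF (i + j)).differentiableAt (hU.mem_nhds hw)
  have h2 (k : Fin d) : DifferentiableAt ℂ (fun w => hankelVec F d w k) w :=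
    (((hF (k + 1)).deriv hU).differentiableAt (hU.mem_nhds hw)).div_const _
  have : DifferentiableAt ℂ (fun w => ∑ k, (hankel F d w).adjugate l k * hankelVec F d w k) w := by
    fun_prop
  exact this.differentiableWithinAt

theorem hasDerivAt_conj_inv_conj {G : ℂ → ℂ} {w : ℂ} (hw : w ≠ 0)
    (hG : DifferentiableAt ℂ G (conj w)⁻¹) :
    HasDerivAt (fun v => conj (G (conj v)⁻¹)) (-(w ^ 2)⁻¹ * conj (deriv G (conj w)⁻¹)) w := by
  have h1 : HasDerivAt (conj ∘ G ∘ conj) (conj (deriv G (conj w)⁻¹)) w⁻¹ := by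
    have := hG.hasDerivAt.conj_conj
    rwa [map_inv₀, conj_conj] at this
  have h2 := h1.comp w (hasDerivAt_inv hw)
  rw [mul_comm]
  refine h2.congr_of_eventuallyEq (Eventually.of_forall fun v => ?_)
  simp

theorem hankel_mulVec_conj {F : ℕ → ℂ → ℂ} {d : ℕ} (w x a : ℂ) :
    ∑ l, (((hankel F d w).map conj).adjugate.mulVec
      (fun k => a * conj (hankelVec F d w k))) l * x ^ (l : ℕ) =
    a * conj (∑ l, hankelCoeff F d l w * conj x ^ (l : ℕ)) := by
  rw [map_sum, Finset.mul_sum]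
  refine Finset.sum_congr rfl fun l _ => ?_
  have h1 : ((hankel F d w).map conj).adjugate = (hankel F d w).adjugate.map conj :=
    ((starRingEnd ℂ).map_adjugate (hankel F d w)).symm
  rw [h1, hankelCoeff, Matrix.mulVec, Matrix.mulVec, dotProduct, dotProduct, map_mul, map_sum,
    map_pow, conj_conj, ← mul_assoc, Finset.mul_sum]
  congr 1
  refine Finset.sum_congr rfl fun k _ => ?_
  rw [Matrix.map_apply, map_mul]
  ring

theorem ContinuousAt.eq_of_eventually_eq_nhdsNE {g h : ℂ → ℂ} {z : ℂ} (hg : ContinuousAt g z)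
    (hh : ContinuousAt h z) (H : ∀ᶠ v in 𝓝[≠] z, g v = h v) : g z = h z :=
  tendsto_nhds_unique_of_eventuallyEq (hg.tendsto.mono_left nhdsWithin_le_nhds)
    (hh.tendsto.mono_left nhdsWithin_le_nhds) H

namespace IsProperOntoDisc

variable {Ω : Set ℂ} {f : ℂ → ℂ}

theorem exists_reflected_power_sums (hf : IsProperOntoDisc Ω f) (hΩ : IsOpen Ω)
    (hc : IsPreconnected Ω) (hb : Bornology.IsBounded Ω) {S : ℂ → ℂ} {r₀ : ℝ} (h0 : 0 < r₀)
    (h1 : r₀ < 1) (hS : DifferentiableOn ℂ S (Ω ∩ {z | r₀ < ‖f z‖}))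
    (hlim : Tendsto (fun z => conj z - S z) (boundaryFilter Ω f) (𝓝 0)) :
    ∃ R : ℝ, 1 < R ∧ ∃ F : ℕ → ℂ → ℂ, (∀ k, DifferentiableOn ℂ (F k) (ball 0 R)) ∧
      (∀ k, ∀ w ∈ regularValues Ω f, F k w = fibreSum Ω f (fun z => z ^ k) w) ∧
      ∃ ρ < 1, r₀ ≤ ρ ∧ R⁻¹ ≤ ρ ∧ ∀ k, ∀ w ∈ regularValues Ω f, ρ < ‖w‖ →
        conj (F k (conj w)⁻¹) = fibreSum Ω f (fun z => S z ^ k) w := by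
  obtain ⟨d, hd⟩ := hf.exists_isFibreEnum_uniform hΩ hc
  have hSz : IsReflected (boundaryFilter Ω f) (fun z => z) S := by
    refine ⟨?_, hlim⟩
    obtain ⟨C, hC⟩ := hb.exists_norm_le
    exact ⟨C, eventually_mem_boundaryFilter.mono hC⟩
  have hWo : IsOpen {w : ℂ | r₀ < ‖w‖ ∧ ‖w‖ < 1} :=
    (isOpen_lt continuous_const continuous_norm).inter (isOpen_lt continuous_norm continuous_const)
  have hZ (k : ℕ) := hf.exists_fibreSum_extension hΩ hc isOpen_ball Subset.rfl
    (g := fun z => z ^ k) (by fun_prop)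
  have hB (k : ℕ) := hf.exists_fibreSum_extension hΩ hc hWo (fun w hw => by simpa using hw.2)
    (g := fun z => S z ^ k) ((hS.pow k).mono fun z hz => ⟨hz.1, hz.2.1⟩)
  choose Z hZd hZe using hZ
  choose B hBd hBe using hB
  obtain ⟨R, hR1, hR2⟩ := exists_between ((one_lt_inv₀ h0).2 h1)
  have hext (k : ℕ) := exists_extension_of_reflection h0 hR1 hR2 (hZd k) (hBd k) (by
    intro ε hε
    have h2 := (tendsto_zero_iff_norm_tendsto_zero.1 (hSz.pow k).2).eventually
      (gt_mem_nhds (show 0 < ε / (d + 1) by positivity))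
    obtain ⟨ρ, hρ, hρ'⟩ := (eventually_boundaryFilter hf).1 h2
    refine ⟨max ρ r₀, max_lt hρ h1, fun w hw hw1 => ?_⟩
    have hrw : r₀ < ‖w‖ := (le_max_right _ _).trans_lt hw
    have hcont : ContinuousAt (fun v => ‖conj (Z k v) - B k v‖) w := by
      have a1 := ((hZd k).differentiableAt (isOpen_ball.mem_nhds (by simpa using hw1))).continuousAt
      have a2 := ((hBd k).differentiableAt (hWo.mem_nhds ⟨hrw, hw1⟩)).continuousAt
      exact ((continuous_conj.continuousAt.comp a1).sub a2).norm
    refine le_of_tendsto (hcont.tendsto.mono_left nhdsWithin_le_nhds : Tendsto _ (𝓝[≠] w) _) ?_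
    filter_upwards [hf.eventually_mem_regularValues hΩ hc hw1,
      nhdsWithin_le_nhds (hWo.mem_nhds (show w ∈ _ from ⟨hrw, hw1⟩)), nhdsWithin_le_nhds
      ((isOpen_lt continuous_const continuous_norm).mem_nhds (show max ρ r₀ < ‖w‖ from hw))]
      with v hvR hv hvρ
    rw [hZe k v ⟨hvR.1, hvR⟩, hBe k v ⟨hv, hvR⟩]
    obtain ⟨s, hs⟩ := hd v hvR
    have hs := hs.self_of_nhds
    rw [hs.fibreSum_eq, hs.fibreSum_eq, map_sum, ← Finset.sum_sub_distrib]
    refine (norm_sum_le_of_le _ fun i _ => (hρ' _ (hs.mem i).1 ?_).le).trans ?_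
    · rw [(hs.mem i).2]
      exact (le_max_left _ _).trans_lt hvρ
    · rw [Finset.sum_const, Finset.card_univ, Fintype.card_fin, nsmul_eq_mul, mul_div_assoc',
        div_le_iff₀ (by positivity)]
      nlinarith)
  choose F hFd hFZ hFB using hext
  refine ⟨R, hR1, F, hFd, fun k w hw => ?_, max r₀ R⁻¹, max_lt h1 (inv_lt_one_of_one_lt₀ hR1),
    le_max_left _ _, le_max_right _ _, fun k w hw hρ => ?_⟩
  · rw [hFZ k w (by simpa using hw.1), hZe k w ⟨hw.1, hw⟩]
  · have hw1 : ‖w‖ < 1 := by simpa using hw.1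
    rw [← hFB k w ((le_max_right _ _).trans_lt hρ) hw1,
      hBe k w ⟨⟨(le_max_left _ _).trans_lt hρ, hw1⟩, hw⟩]

theorem exists_hankel (hf : IsProperOntoDisc Ω f) (hΩ : IsOpen Ω)
    (hc : IsPreconnected Ω) (hb : Bornology.IsBounded Ω) {S : ℂ → ℂ} {r₀ : ℝ} (h0 : 0 < r₀)
    (h1 : r₀ < 1) (hS : DifferentiableOn ℂ S (Ω ∩ {z | r₀ < ‖f z‖}))
    (hlim : Tendsto (fun z => conj z - S z) (boundaryFilter Ω f) (𝓝 0)) :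
    ∃ (d : ℕ) (R : ℝ) (F : ℕ → ℂ → ℂ), 1 < R ∧ (∀ k, DifferentiableOn ℂ (F k) (ball 0 R)) ∧
      (∃ w ∈ ball (0 : ℂ) R, (hankel F d w).det ≠ 0) ∧
      (∀ z ∈ Ω, (∑ l, hankelCoeff F d l (f z) * z ^ (l : ℕ)) * deriv f z =
        (hankel F d (f z)).det) ∧
      ∀ᶠ z in boundaryFilter Ω f,
        conj (∑ l, hankelCoeff F d l (conj (f z))⁻¹ * conj (S z) ^ (l : ℕ)) * deriv f z =
          -(f z ^ 2 * deriv S z * conj (hankel F d (conj (f z))⁻¹).det) := by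
  obtain ⟨d, hd⟩ := hf.exists_isFibreEnum_uniform hΩ hc
  obtain ⟨R, hR1, F, hF, hFz, ρ, hρ1, hρ0, hρR, hFS⟩ :=
    hf.exists_reflected_power_sums hΩ hc hb h0 h1 hS hlim
  have hRo := hf.isOpen_regularValues hΩ hc
  have hsub : regularValues Ω f ⊆ ball 0 R := sdiff_subset.trans (ball_subset_ball hR1.le)
  have hΩR : ∀ z ∈ Ω, f z ∈ ball (0 : ℂ) R := fun z hz => by
    simpa using (hf.norm_lt hz).trans hR1
  have hfd : ∀ z ∈ Ω, DifferentiableAt ℂ f z := fun z hz =>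
    hf.1.differentiableAt (hΩ.mem_nhds hz)
  have hderiv : ∀ z ∈ Ω, ContinuousAt (deriv f) z := fun z hz =>
    ((hf.1.deriv hΩ).differentiableAt (hΩ.mem_nhds hz)).continuousAt
  have hCd : ∀ l : Fin d, ∀ w ∈ ball (0 : ℂ) R, ContinuousAt (hankelCoeff F d l) w := fun l w hw =>
    ((differentiableOn_hankelCoeff isOpen_ball hF l).differentiableAt
      (isOpen_ball.mem_nhds hw)).continuousAt
  have hDd : ∀ w ∈ ball (0 : ℂ) R, ContinuousAt (fun w => (hankel F d w).det) w := fun w hw =>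
    ((differentiableOn_det_hankel isOpen_ball hF d).differentiableAt
      (isOpen_ball.mem_nhds hw)).continuousAt
  refine ⟨d, R, F, hR1, hF, ?_, ?_, ?_⟩
  · obtain ⟨w, hw⟩ := (hf.eventually_mem_regularValues hΩ hc (w := 0) (by simp)).exists
    obtain ⟨s, hs⟩ := hd w hw
    refine ⟨w, hsub hw, det_hankel_ne_zero hs.self_of_nhds.1 _ fun k l => ?_⟩
    rw [hankel, Matrix.of_apply, hFz _ _ hw, hs.self_of_nhds.fibreSum_eq]
  · have main : ∀ z ∈ Ω, f z ∈ regularValues Ω f →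
        (∑ l, hankelCoeff F d l (f z) * z ^ (l : ℕ)) * deriv f z =
          (hankel F d (f z)).det := by
      intro z hz hw
      obtain ⟨s, hs⟩ := hd (f z) hw
      obtain ⟨j, hj⟩ := hs.self_of_nhds.exists_eq hz rfl
      have hz0 : deriv f z ≠ 0 := fun h => hw.2 ⟨z, ⟨hz, h⟩, rfl⟩
      have := vandermonde_mulVec_adjugate_hankel (fun i => s i (f z))
        (fun i => (deriv f (s i (f z)))⁻¹) (hankel F d (f z)) (hankelVec F d (f z))
        (fun k l => by
          rw [hankel, Matrix.of_apply, hFz _ _ hw, hs.self_of_nhds.fibreSum_eq])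
        (fun k => by
          have e1 : F (k + 1) =ᶠ[𝓝 (f z)] fibreSum Ω f (fun z => z ^ ((k : ℕ) + 1)) := by
            filter_upwards [hRo.mem_nhds hw] with v hv using hFz _ v hv
          have e2 := (IsFibreEnum.hasDerivAt_fibreSum hs
            (g := fun z => z ^ ((k : ℕ) + 1)) fun i => by fun_prop).deriv
          rw [hankelVec, e1.deriv_eq, e2, Finset.sum_div]
          refine Finset.sum_congr rfl fun i _ => ?_
          have : ((k : ℕ) : ℂ) + 1 ≠ 0 := Nat.cast_add_one_ne_zero _
          simp
          field_simp) j
      simp only [hj] at this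
      change (∑ l, ((hankel F d (f z)).adjugate.mulVec (hankelVec F d (f z))) l * z ^ (l : ℕ)) *
        deriv f z = _
      rw [this, mul_assoc, inv_mul_cancel₀ hz0, mul_one]
    intro z hz
    have hfc := (hfd z hz).continuousAt
    refine ContinuousAt.eq_of_eventually_eq_nhdsNE
      (g := fun z => (∑ l, hankelCoeff F d l (f z) * z ^ (l : ℕ)) * deriv f z)
      (h := fun z => (hankel F d (f z)).det) ?_
      (ContinuousAt.comp' (f := f) (g := fun w => (hankel F d w).det) (hDd _ (hΩR z hz)) hfc) ?_
    · refine ContinuousAt.mul ?_ (hderiv z hz)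
      refine tendsto_finsetSum _ fun l _ => ?_
      exact ((hCd l _ (hΩR z hz)).comp' hfc).mul (continuousAt_id.pow _)
    · filter_upwards [hf.eventually_map_mem_regularValues hΩ hc hz] with v hv
      exact main v hv.1 hv.2
  · rw [eventually_boundaryFilter hf]
    have hSo : IsOpen (Ω ∩ {z | r₀ < ‖f z‖}) :=
      hf.isOpen_inter_ball hΩ (isOpen_lt continuous_const continuous_norm)
    have hρpos : 0 < ρ := h0.trans_le hρ0
    have hstar : ∀ w : ℂ, ρ < ‖w‖ → (conj w)⁻¹ ∈ ball (0 : ℂ) R := fun w hw => by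
      rw [mem_ball_zero_iff, norm_inv_conj]
      exact inv_lt_of_inv_lt₀ (by linarith) (hρR.trans_lt hw)
    have main : ∀ z ∈ Ω, ρ < ‖f z‖ → f z ∈ regularValues Ω f →
        conj (∑ l, hankelCoeff F d l (conj (f z))⁻¹ * conj (S z) ^ (l : ℕ)) * deriv f z =
          -(f z ^ 2 * deriv S z * conj (hankel F d (conj (f z))⁻¹).det) := by
      intro z hz hzρ hw
      obtain ⟨s, hs⟩ := hd (f z) hw
      obtain ⟨j, hj⟩ := hs.self_of_nhds.exists_eq hz rfl
      have hz0 : deriv f z ≠ 0 := fun h => hw.2 ⟨z, ⟨hz, h⟩, rfl⟩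
      have hw0 : f z ≠ 0 := norm_pos_iff.1 (hρpos.trans hzρ)
      have hsS (i) : DifferentiableAt ℂ S (s i (f z)) := by
        have := hs.self_of_nhds.mem i
        refine hS.differentiableAt (hSo.mem_nhds ⟨this.1, ?_⟩)
        change r₀ < ‖f _‖
        rw [this.2]
        exact hρ0.trans_lt hzρ
      have := vandermonde_mulVec_adjugate_hankel (fun i => S (s i (f z)))
        (fun i => deriv S (s i (f z)) / deriv f (s i (f z)))
        ((hankel F d (conj (f z))⁻¹).map conj)
        (fun k => -(f z ^ 2)⁻¹ * conj (hankelVec F d (conj (f z))⁻¹ k))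
        (fun k l => by
          rw [Matrix.map_apply, hankel, Matrix.of_apply, hFS _ _ hw hzρ,
            hs.self_of_nhds.fibreSum_eq])
        (fun k => by
          have e1 : (fun w => conj (F (k + 1) (conj w)⁻¹)) =ᶠ[𝓝 (f z)]
              fibreSum Ω f (fun z => S z ^ ((k : ℕ) + 1)) := by
            filter_upwards [hRo.mem_nhds hw, (isOpen_lt continuous_const continuous_norm).mem_nhds
              (show ρ < ‖f z‖ from hzρ)] with v hv hvρ using hFS _ v hv hvρ
          have e2 := (IsFibreEnum.hasDerivAt_fibreSum hs
            (g := fun z => S z ^ ((k : ℕ) + 1)) fun i => (hsS i).pow _).deriv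
          have e3 := (hasDerivAt_conj_inv_conj hw0 ((hF (k + 1)).differentiableAt
            (isOpen_ball.mem_nhds (hstar _ hzρ)))).deriv
          rw [hankelVec, map_div₀, mul_div_assoc', ← e3, e1.deriv_eq, e2, map_add, map_one,
            map_natCast, Finset.sum_div]
          refine Finset.sum_congr rfl fun i _ => ?_
          have : ((k : ℕ) : ℂ) + 1 ≠ 0 := Nat.cast_add_one_ne_zero _
          rw [((hsS i).hasDerivAt.fun_pow _).deriv]
          simp
          field_simp) j
      rw [hankel_mulVec_conj] at this
      simp only [hj] at this
      have hdet : ((hankel F d (conj (f z))⁻¹).map conj).det =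
          conj (hankel F d (conj (f z))⁻¹).det :=
        ((starRingEnd ℂ).map_det (hankel F d (conj (f z))⁻¹)).symm
      rw [hdet] at this
      field_simp at this
      simp only [one_div] at this
      linear_combination -this
    refine ⟨ρ, hρ1, fun z hz hzρ => ?_⟩
    have hfc := (hfd z hz).continuousAt
    have hw0 : f z ≠ 0 := norm_pos_iff.1 (hρpos.trans hzρ)
    have hfs : ContinuousAt (fun z => (conj (f z))⁻¹) z :=
      (continuous_conj.continuousAt.comp' hfc).inv₀ (by simpa using hw0)
    have hzS : Ω ∩ {z | r₀ < ‖f z‖} ∈ 𝓝 z := hSo.mem_nhds ⟨hz, hρ0.trans_lt hzρ⟩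
    have hSc : ContinuousAt S z := (hS.differentiableAt hzS).continuousAt
    have hSc' : ContinuousAt (deriv S) z := ((hS.deriv hSo).differentiableAt hzS).continuousAt
    refine ContinuousAt.eq_of_eventually_eq_nhdsNE
      (g := fun z => conj (∑ l, hankelCoeff F d l (conj (f z))⁻¹ * conj (S z) ^ (l : ℕ)) *
        deriv f z)
      (h := fun z => -(f z ^ 2 * deriv S z * conj (hankel F d (conj (f z))⁻¹).det)) ?_ ?_ ?_
    · refine ContinuousAt.mul (continuous_conj.continuousAt.comp' ?_) (hderiv z hz)
      refine tendsto_finsetSum _ fun l _ => ?_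
      exact (ContinuousAt.comp' (f := fun z => (conj (f z))⁻¹) (hCd l _ (hstar _ hzρ)) hfs).mul
        ((continuous_conj.continuousAt.comp' hSc).pow _)
    · refine (((hfc.pow 2).mul hSc').mul (continuous_conj.continuousAt.comp' ?_)).neg
      exact ContinuousAt.comp' (f := fun z => (conj (f z))⁻¹)
        (g := fun w => (hankel F d w).det) (hDd _ (hstar _ hzρ)) hfs
    · have := (isOpen_lt continuous_const continuous_norm).mem_nhds (show ρ < ‖f z‖ from hzρ)
      filter_upwards [hf.eventually_map_mem_regularValues hΩ hc hz,
        nhdsWithin_le_nhds (hfc.preimage_mem_nhds this)] with v hv hvρ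
      exact main v hv.1 hvρ hv.2

end IsProperOntoDisc

theorem eval_listProd_X_sub_C (l : List ℂ) (w : ℂ) :
    (l.map fun a => Polynomial.X - Polynomial.C a).prod.eval w = (l.map fun a => w - a).prod := by
  rw [Polynomial.eval_list_prod, List.map_map]
  congr 1
  refine List.map_congr_left fun a _ => by simp

theorem listProd_X_sub_C_ne_zero (l : List ℂ) :
    (l.map fun a => Polynomial.X - Polynomial.C a).prod ≠ 0 := by
  refine List.prod_ne_zero fun h => ?_
  obtain ⟨a, -, ha⟩ := List.mem_map.1 h
  exact Polynomial.X_sub_C_ne_zero a ha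

theorem pow_mul_conj_listProd_inv_conj (l : List ℂ) {w : ℂ} (hw : w ≠ 0) :
    w ^ l.length * conj (l.map fun a => (conj w)⁻¹ - a).prod =
      (l.map fun a => 1 - Polynomial.C (conj a) * Polynomial.X).prod.eval w := by
  induction l with
  | nil => simp
  | cons a l ih =>
    rw [List.map_cons, List.map_cons, List.prod_cons, List.prod_cons, Polynomial.eval_mul, ← ih,
      List.length_cons, map_mul, map_sub, map_inv₀, conj_conj, pow_succ]
    have : (1 - Polynomial.C (conj a) * Polynomial.X).eval w = w * (w⁻¹ - conj a) := by
      simp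
      field_simp
    rw [this]
    ring

namespace IsProperOntoDisc

variable {Ω : Set ℂ} {f : ℂ → ℂ}

theorem tendsto_sub_inv_conj (hf : IsProperOntoDisc Ω f) :
    Tendsto (fun z => f z - (conj (f z))⁻¹) (boundaryFilter Ω f) (𝓝 0) := by
  rw [tendsto_zero_iff_norm_tendsto_zero]
  have h : Tendsto (fun z => ‖f z‖⁻¹ * |‖f z‖ ^ 2 - 1|) (boundaryFilter Ω f) (𝓝 0) := by
    have h1 := hf.tendsto_norm
    have := (h1.inv₀ one_ne_zero).mul ((h1.pow 2).sub_const 1).abs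
    simpa using this
  refine h.congr' ?_
  filter_upwards [hf.tendsto_norm.eventually (lt_mem_nhds one_pos)] with z hz
  have h0 : conj (f z) ≠ 0 := by simpa using norm_pos_iff.1 hz
  have : f z - (conj (f z))⁻¹ = (conj (f z))⁻¹ * ((‖f z‖ ^ 2 - 1 : ℝ) : ℂ) := by
    push_cast
    rw [← mul_conj']
    field_simp
  rw [this, norm_mul, norm_real, norm_inv_conj, Real.norm_eq_abs]

theorem isReflected_comp (hf : IsProperOntoDisc Ω f) {a : ℂ → ℂ} {R : ℝ} (hR : 1 < R)
    (ha : DifferentiableOn ℂ a (ball 0 R)) :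
    IsReflected (boundaryFilter Ω f) (fun z => a (f z)) (fun z => conj (a (conj (f z))⁻¹)) := by
  obtain ⟨R', hR', hRR⟩ := exists_between hR
  have hK : IsCompact (closedBall (0 : ℂ) R') := isCompact_closedBall 0 R'
  have hc : ContinuousOn a (closedBall 0 R') :=
    ha.continuousOn.mono (closedBall_subset_ball hRR)
  have hmem : ∀ᶠ z in boundaryFilter Ω f, f z ∈ closedBall (0 : ℂ) R' :=
    eventually_mem_boundaryFilter.mono fun z hz => by
      simpa using (hf.norm_lt hz).le.trans hR'.le
  constructor
  · obtain ⟨C, hC⟩ := hK.exists_bound_of_continuousOn hc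
    exact ⟨C, hmem.mono fun z hz => hC _ hz⟩
  · have hu := Metric.uniformContinuousOn_iff.1 (hK.uniformContinuousOn_of_continuous hc)
    rw [tendsto_zero_iff_norm_tendsto_zero, Metric.tendsto_nhds]
    intro ε hε
    obtain ⟨δ, hδ, h⟩ := hu ε hε
    have h1 := (tendsto_zero_iff_norm_tendsto_zero.1 hf.tendsto_sub_inv_conj).eventually
      (gt_mem_nhds hδ)
    have h2 : ∀ᶠ z in boundaryFilter Ω f, ‖f z‖⁻¹ < R' :=
      (hf.tendsto_norm.inv₀ one_ne_zero).eventually (gt_mem_nhds (by simpa using hR'))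
    filter_upwards [hmem, h1, h2] with z hz h3 h4
    have := h _ hz (conj (f z))⁻¹ (by simpa [norm_inv_conj] using h4.le)
      (by rwa [dist_eq_norm])
    rw [dist_eq_norm] at this
    rwa [← map_sub, norm_conj, dist_zero_right, norm_norm]

theorem exists_reflected_pair (hf : IsProperOntoDisc Ω f) (hΩ : IsOpen Ω)
    (hc : IsPreconnected Ω) (hb : Bornology.IsBounded Ω) {S : ℂ → ℂ} {r₀ : ℝ} (h0 : 0 < r₀)
    (h1 : r₀ < 1) (hS : DifferentiableOn ℂ S (Ω ∩ {z | r₀ < ‖f z‖}))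
    (hlim : Tendsto (fun z => conj z - S z) (boundaryFilter Ω f) (𝓝 0))
    (hq : IsEventuallyQuot Ω f (deriv S)) :
    ∃ (u v : ℂ → ℂ) (c : Polynomial ℂ), c ≠ 0 ∧ DifferentiableOn ℂ u Ω ∧
      (∀ z ∈ Ω, u z * deriv f z = c.eval (f z)) ∧
      IsReflected (boundaryFilter Ω f) u v ∧ IsEventuallyQuot Ω f v := by
  obtain ⟨d, R, F, hR, hF, hne, hrel, hrel'⟩ := hf.exists_hankel hΩ hc hb h0 h1 hS hlim
  obtain ⟨l, e, -, hed, hle, he0⟩ := exists_eq_prod_mul isOpen_ball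
    (convex_ball (0 : ℂ) R).isPreconnected (differentiableOn_det_hankel isOpen_ball hF d) hne
    (isCompact_closedBall 0 1) (closedBall_subset_ball hR)
  have hΩ1 : ∀ z ∈ Ω, f z ∈ closedBall (0 : ℂ) 1 := fun z hz => by
    simpa using (hf.norm_lt hz).le
  have hΩR : ∀ z ∈ Ω, f z ∈ ball (0 : ℂ) R := fun z hz => closedBall_subset_ball hR (hΩ1 z hz)
  obtain ⟨δ, hδ, hδe⟩ : ∃ δ > 0, ∀ w ∈ closedBall (0 : ℂ) 1, δ ≤ ‖e w‖ := by
    obtain ⟨x, hx, hmin⟩ := (isCompact_closedBall (0 : ℂ) 1).exists_isMinOn ⟨0, by simp⟩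
      (hed.continuousOn.mono (closedBall_subset_ball hR)).norm
    exact ⟨‖e x‖, norm_pos_iff.2 (he0 x hx), fun w hw => hmin hw⟩
  set c : Polynomial ℂ := (l.map fun a => Polynomial.X - Polynomial.C a).prod with hcdef
  set cr : Polynomial ℂ := (l.map fun a => 1 - Polynomial.C (conj a) * Polynomial.X).prod with hcr
  set u : ℂ → ℂ := fun z => (∑ k, hankelCoeff F d k (f z) * z ^ (k : ℕ)) * (e (f z))⁻¹ with hu
  set v : ℂ → ℂ := fun z => (∑ k, conj (hankelCoeff F d k (conj (f z))⁻¹) * S z ^ (k : ℕ)) *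
    (conj (e (conj (f z))⁻¹))⁻¹ with hv
  have hue : ∀ z ∈ Ω, u z * deriv f z = c.eval (f z) := by
    intro z hz
    have h2 := hrel z hz
    have h3 := he0 _ (hΩ1 z hz)
    rw [hle _ (hΩR z hz), ← eval_listProd_X_sub_C] at h2
    calc u z * deriv f z = (e (f z))⁻¹ *
          ((∑ k, hankelCoeff F d k (f z) * z ^ (k : ℕ)) * deriv f z) := by simp only [hu]; ring
      _ = c.eval (f z) := by rw [h2, mul_comm, mul_assoc, mul_inv_cancel₀ h3, mul_one]
  have hud : DifferentiableOn ℂ u Ω := by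
    refine DifferentiableOn.mul (DifferentiableOn.fun_sum fun k _ => ?_)
      ((hed.comp hf.1 hΩR).inv fun z hz => he0 _ (hΩ1 z hz))
    exact ((differentiableOn_hankelCoeff isOpen_ball hF k).comp hf.1 hΩR).mul
      (differentiableOn_id.pow _)
  have hzS : IsReflected (boundaryFilter Ω f) (fun z => z) S := by
    refine ⟨?_, hlim⟩
    obtain ⟨C, hC⟩ := hb.exists_norm_le
    exact ⟨C, eventually_mem_boundaryFilter.mono hC⟩
  have heR := hf.isReflected_comp hR hed
  have hδ' : ∀ᶠ z in boundaryFilter Ω f, δ ≤ ‖e (f z)‖ :=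
    eventually_mem_boundaryFilter.mono fun z hz => hδe _ (hΩ1 z hz)
  have huv : IsReflected (boundaryFilter Ω f) u v :=
    (IsReflected.sum Finset.univ fun k _ => (hf.isReflected_comp hR
      (differentiableOn_hankelCoeff isOpen_ball hF k)).mul (hzS.pow k)).mul (heR.inv hδ hδ')
  refine ⟨u, v, c, listProd_X_sub_C_ne_zero l, hud, hue, huv, ?_⟩
  obtain ⟨G, q, hG, hq0, hGq⟩ := hq
  refine ⟨fun z => -(u z * f z ^ 2 * cr.eval (f z) * G z), Polynomial.X ^ l.length * q * c,
    ?_, mul_ne_zero (mul_ne_zero (pow_ne_zero _ Polynomial.X_ne_zero) hq0)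
      (listProd_X_sub_C_ne_zero l), ?_⟩
  · have h2 : DifferentiableOn ℂ (fun z => cr.eval (f z)) Ω :=
      cr.differentiable.comp_differentiableOn hf.1
    exact (((hud.mul (hf.1.pow 2)).mul h2).mul hG).neg
  · have he' : ∀ᶠ z in boundaryFilter Ω f, e (conj (f z))⁻¹ ≠ 0 := by
      have := (tendsto_zero_iff_norm_tendsto_zero.1 heR.2).eventually (gt_mem_nhds hδ)
      filter_upwards [hδ', this] with z h2 h3 h4
      rw [h4, map_zero, sub_zero, norm_conj] at h3
      exact h2.not_gt h3
    have hstar : ∀ᶠ z in boundaryFilter Ω f, (conj (f z))⁻¹ ∈ ball (0 : ℂ) R := by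
      filter_upwards [(hf.tendsto_norm.inv₀ one_ne_zero).eventually
        (gt_mem_nhds (show (1 : ℝ)⁻¹ < R by simpa using hR))] with z hz
      simpa [norm_inv_conj] using hz
    filter_upwards [eventually_mem_boundaryFilter, he', hstar, hGq, hrel',
      hf.tendsto_norm.eventually (lt_mem_nhds one_pos)] with z hz h2 h3 h4 h5 h6
    have hf0 : f z ≠ 0 := norm_pos_iff.1 h6
    have h2' : conj (e (conj (f z))⁻¹) ≠ 0 := by simpa using h2
    have h7 : v z * deriv f z =
        -(f z ^ 2 * deriv S z * conj (l.map fun a => (conj (f z))⁻¹ - a).prod) := by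
      rw [hle _ h3, map_sum, map_mul] at h5
      simp only [map_mul, map_pow, conj_conj] at h5
      simp only [hv]
      rw [mul_right_comm, h5, neg_mul, mul_assoc, mul_assoc _ _ (_)⁻¹, mul_inv_cancel₀ h2', mul_one]
    have h8 := pow_mul_conj_listProd_inv_conj l hf0
    have h9 := hue z hz
    rw [Polynomial.eval_mul, Polynomial.eval_mul, Polynomial.eval_pow, Polynomial.eval_X, ← h9,
      h4, hcr, ← h8]
    linear_combination (-(f z ^ l.length * q.eval (f z) * u z)) * h7

end IsProperOntoDisc

theorem exists_ne_zero_divisible {Ω : Set ℂ} (hΩ : IsOpen Ω) (l : List ℂ) (hl : ∀ a ∈ l, a ∈ Ω)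
    {V : Type} [AddCommGroup V] [Module ℂ V] [FiniteDimensional ℂ V] (T : V →ₗ[ℂ] (ℂ → ℂ))
    (hT : ∀ p, DifferentiableOn ℂ (T p) Ω) (hdim : l.length < Module.finrank ℂ V) :
    ∃ p ≠ 0, ∃ g : ℂ → ℂ, DifferentiableOn ℂ g Ω ∧
      ∀ z ∈ Ω, T p z = (l.map fun a => z - a).prod * g z := by
  induction l generalizing V with
  | nil =>
    have : Nontrivial V := Module.nontrivial_of_finrank_pos (R := ℂ) hdim
    obtain ⟨p, hp⟩ := exists_ne (0 : V)
    exact ⟨p, hp, T p, hT p, by simp⟩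
  | cons a l ih =>
    have ha : a ∈ Ω := hl a (by simp)
    set φ : V →ₗ[ℂ] ℂ := (LinearMap.proj a).comp T with hφ
    have hφa (p : V) : φ p = T p a := rfl
    have hd (p : V) : DifferentiableAt ℂ (T p) a := (hT p).differentiableAt (hΩ.mem_nhds ha)
    have hker : l.length < Module.finrank ℂ (LinearMap.ker φ) := by
      have h1 := φ.finrank_range_add_finrank_ker
      have h2 := (LinearMap.range φ).finrank_le
      rw [Module.finrank_self] at h2
      rw [List.length_cons] at hdim
      omega
    set T' : LinearMap.ker φ →ₗ[ℂ] (ℂ → ℂ) :=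
      { toFun := fun p => dslope (T p) a
        map_add' := fun p q => by
          ext z
          by_cases h : z = a
          · subst h
            simp only [Pi.add_apply, dslope_same, Submodule.coe_add, map_add]
            exact deriv_add (hd p) (hd q)
          · simp only [Pi.add_apply, dslope_of_ne _ h, Submodule.coe_add, map_add, slope_def_field]
            ring
        map_smul' := fun c p => by
          ext z
          by_cases h : z = a
          · subst h
            simp only [Pi.smul_apply, dslope_same, Submodule.coe_smul, map_smul, RingHom.id_apply]
            exact deriv_const_smul c (hd p)
          · simp only [Pi.smul_apply, dslope_of_ne _ h, Submodule.coe_smul, map_smul,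
              slope_def_field, RingHom.id_apply, smul_eq_mul]
            ring } with hT'
    have hT'd (p) : DifferentiableOn ℂ (T' p) Ω :=
      (Complex.differentiableOn_dslope (hΩ.mem_nhds ha)).2 (hT p)
    obtain ⟨p, hp, g, hg, hpg⟩ := ih (fun b hb => hl b (by simp [hb])) T' hT'd hker
    refine ⟨p, fun h => hp (Subtype.ext h), g, hg, fun z hz => ?_⟩
    have h1 : T p z = (z - a) * T' p z := by
      have h2 := sub_smul_dslope (T p) a z
      have h3 : T p a = 0 := p.2
      rw [h3, sub_zero, smul_eq_mul] at h2
      exact h2.symm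
    rw [h1, hpg z hz, List.map_cons, List.prod_cons, mul_assoc]

namespace IsProperOntoDisc

variable {Ω : Set ℂ} {f : ℂ → ℂ}

theorem eqOn_zero_of_im_tendsto_zero (hf : IsProperOntoDisc Ω f) (hΩ : IsOpen Ω)
    (hc : IsPreconnected Ω) {Y : ℂ → ℂ} (hY : DifferentiableOn ℂ Y Ω)
    (him : Tendsto (fun z => (Y z).im) (boundaryFilter Ω f) (𝓝 0)) {a : ℂ} (ha : a ∈ Ω)
    (hYa : Y a = 0) : ∀ z ∈ Ω, Y z = 0 := by
  have key (σ : ℝ) : ∀ z ∈ Ω, 0 ≤ σ * (Y z).im := by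
    intro z hz
    have h1 : Tendsto (fun z => Real.exp (-(σ * (Y z).im))) (boundaryFilter Ω f) (𝓝 1) := by
      have := (Real.continuous_exp.tendsto _).comp (him.const_mul σ).neg
      simpa [Function.comp_def] using this
    have hn (z : ℂ) : ‖Complex.exp (σ * I * Y z)‖ = Real.exp (-(σ * (Y z).im)) := by
      rw [Complex.norm_exp]
      congr 1
      simp
    have := hf.norm_le_of_eventually hΩ (G := fun z => Complex.exp (σ * I * Y z)) (M := 1)
      (hY.const_mul _).cexp (fun ε hε => by
        filter_upwards [h1.eventually (gt_mem_nhds (show (1 : ℝ) < 1 + ε by linarith))] with v hv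
        rw [hn]
        exact hv.le) z hz
    rw [hn, Real.exp_le_one_iff] at this
    linarith
  have him0 : ∀ z ∈ Ω, (Y z).im = 0 := fun z hz => by
    have h1 := key 1 z hz
    have h2 := key (-1) z hz
    linarith
  rcases (hY.analyticOnNhd hΩ).is_constant_or_isOpen hc with ⟨w, hw⟩ | hopen
  · intro z hz
    rw [hw z hz, ← hw a ha, hYa]
  · obtain ⟨ε, hε, hball⟩ := Metric.isOpen_iff.1 (hopen Ω Subset.rfl hΩ) 0 ⟨a, ha, hYa⟩
    obtain ⟨z, hz, hzY⟩ := hball (show ((ε / 2 : ℝ) : ℂ) * I ∈ ball 0 ε by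
      rw [mem_ball_zero_iff, norm_mul, norm_I, mul_one, norm_real, Real.norm_eq_abs,
        abs_of_pos (half_pos hε)]
      exact half_lt_self hε)
    have := him0 z hz
    rw [hzY] at this
    simp at this
    linarith

theorem exists_poly_factor (hf : IsProperOntoDisc Ω f) (hΩ : IsOpen Ω) (hc : IsPreconnected Ω)
    {Q : Polynomial ℂ} (hQ : Q ≠ 0) :
    ∃ (l : List ℂ) (e : ℂ → ℂ), (∀ a ∈ l, a ∈ Ω) ∧ DifferentiableOn ℂ e Ω ∧
      (∀ z ∈ Ω, Q.eval (f z) = (l.map fun a => z - a).prod * e z) ∧ ∀ z ∈ Ω, e z ≠ 0 := by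
  have hfin : ({w : ℂ | Q.eval w = 0} ∩ ball 0 1).Finite :=
    (Polynomial.finite_setOfPred_isRoot hQ).subset inter_subset_left
  obtain ⟨ρ, hρ, hρ1⟩ : ∃ ρ < 1, ∀ w : ℂ, Q.eval w = 0 → ‖w‖ < 1 → ‖w‖ ≤ ρ := by
    obtain ⟨ρ, hρ, h0, h⟩ : ∃ ρ < 1, (0 : ℝ) ≤ ρ ∧
        ∀ w ∈ {w : ℂ | Q.eval w = 0} ∩ ball 0 1, ‖w‖ ≤ ρ := by
      rcases ({w : ℂ | Q.eval w = 0} ∩ ball 0 1).eq_empty_or_nonempty with h | h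
      · exact ⟨0, one_pos, le_rfl, by simp [h]⟩
      · obtain ⟨w, hw, hmax⟩ := hfin.exists_maximalFor norm _ h
        refine ⟨‖w‖, by simpa using hw.2, norm_nonneg w, fun v hv => ?_⟩
        by_contra! hlt
        exact hlt.not_ge (hmax hv hlt.le)
    exact ⟨ρ, hρ, fun w hw hw1 => h w ⟨hw, by simpa using hw1⟩⟩
  have hne : ∃ z ∈ Ω, Q.eval (f z) ≠ 0 := by
    obtain ⟨w, hw, hw0⟩ : ∃ w ∈ ball (0 : ℂ) 1, Q.eval w ≠ 0 := by
      by_contra! h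
      have hinf : (ball (0 : ℂ) 1).Infinite := infinite_of_mem_nhds 0 (ball_mem_nhds 0 one_pos)
      exact hinf (hfin.subset fun w hw => ⟨h w hw, hw⟩)
    obtain ⟨z, hz, rfl⟩ := hf.exists_eq (by simpa using hw)
    exact ⟨z, hz, hw0⟩
  obtain ⟨l, e, hl, hed, hle, he0⟩ := exists_eq_prod_mul hΩ hc
    (Q.differentiable.comp_differentiableOn hf.1) hne (hf.isCompact_preimage hρ) inter_subset_left
  refine ⟨l, e, fun a ha => (hl a ha).1, hed, hle, fun z hz h0 => ?_⟩
  have h1 : Q.eval (f z) = 0 := by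
    have := hle z hz
    rw [h0, mul_zero] at this
    exact this
  exact he0 z ⟨hz, by simpa using hρ1 _ h1 (hf.norm_lt hz)⟩ h0

theorem exists_algebraic_relation (hf : IsProperOntoDisc Ω f) (hΩ : IsOpen Ω)
    (hc : IsPreconnected Ω) {u v : ℂ → ℂ} (hu : DifferentiableOn ℂ u Ω)
    (huv : IsReflected (boundaryFilter Ω f) u v) (hv : IsEventuallyQuot Ω f v) :
    ∃ (N : ℕ) (p : Fin (N + 1) × Fin (N + 1) → ℂ), p ≠ 0 ∧
      ∀ z ∈ Ω, ∑ i, p i * (u z ^ (i.1 : ℕ) * f z ^ (i.2 : ℕ)) = 0 := by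
  obtain ⟨G, q, hG, hq, hGq⟩ := hv
  obtain ⟨l, e, hl, hed, hle, he0⟩ := hf.exists_poly_factor hΩ hc (Q := q * Polynomial.X)
    (mul_ne_zero hq Polynomial.X_ne_zero)
  set N := l.length
  set T : (Fin (N + 1) × Fin (N + 1) → ℂ) →ₗ[ℂ] (ℂ → ℂ) :=
    { toFun := fun p z => ∑ i, p i * (u z ^ (i.1 : ℕ) * f z ^ (i.2 : ℕ))
      map_add' := fun p p' => by
        ext z
        simp [add_mul, Finset.sum_add_distrib]
      map_smul' := fun c p => by
        ext z
        simp [Finset.mul_sum, mul_assoc] } with hT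
  have hTz (p z) : T p z = ∑ i, p i * (u z ^ (i.1 : ℕ) * f z ^ (i.2 : ℕ)) := rfl
  have hTd (p) : DifferentiableOn ℂ (T p) Ω :=
    DifferentiableOn.fun_sum fun i _ => ((hu.pow _).mul (hf.1.pow _)).const_mul _
  obtain ⟨p, hp, g, hg, hpg⟩ := exists_ne_zero_divisible hΩ (List.replicate (N + 1) l).flatten
    (fun a ha => by
      obtain ⟨l', hl', hal'⟩ := List.mem_flatten.1 ha
      rw [List.eq_of_mem_replicate hl'] at hal'
      exact hl a hal') T hTd (by
      simp only [List.length_flatten, List.map_replicate, List.sum_replicate,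
        Module.finrank_fintype_fun_eq_card, Fintype.card_prod, Fintype.card_fin, smul_eq_mul]
      exact Nat.mul_lt_mul_of_pos_left (Nat.lt_succ_self _) (Nat.succ_pos _))
  refine ⟨N, p, hp, ?_⟩
  set h : ℂ → ℂ := fun z => q.eval (f z) * f z with hh
  have hqd : DifferentiableOn ℂ (fun z => q.eval (f z)) Ω :=
    q.differentiable.comp_differentiableOn hf.1
  have hhd : DifferentiableOn ℂ h Ω := hqd.mul hf.1
  set Φ₁ : ℂ → ℂ := fun z => g z / e z ^ (N + 1) with hΦ₁
  have hΦ₁d : DifferentiableOn ℂ Φ₁ Ω := hg.div (hed.pow _) fun z hz => pow_ne_zero _ (he0 z hz)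
  have hΦ : ∀ z ∈ Ω, T p z = h z ^ (N + 1) * Φ₁ z := by
    intro z hz
    have h1 : h z = (l.map fun a => z - a).prod * e z := by
      rw [← hle z hz, Polynomial.eval_mul, Polynomial.eval_X]
    have h2 := pow_ne_zero (N + 1) (he0 z hz)
    rw [hpg z hz, h1, List.map_flatten, List.map_replicate, List.prod_flatten, List.map_replicate,
      List.prod_replicate]
    simp only [hΦ₁]
    rw [mul_pow, mul_assoc, mul_div_cancel₀ _ h2]
  set Ψ : ℂ → ℂ := fun z => ∑ i, conj (p i) * (v z ^ (i.1 : ℕ) * ((f z)⁻¹) ^ (i.2 : ℕ)) with hΨ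
  have hff : IsReflected (boundaryFilter Ω f) f (fun z => (f z)⁻¹) :=
    (hf.isReflected_comp one_lt_two differentiableOn_id).congr_right
      (Eventually.of_forall fun z => by simp)
  have hΦΨ : IsReflected (boundaryFilter Ω f) (T p) Ψ :=
    IsReflected.sum Finset.univ fun i _ =>
      (IsReflected.const (p i)).mul ((huv.pow _).mul (hff.pow _))
  set GΨ : ℂ → ℂ := fun z => ∑ i, conj (p i) * (G z ^ (i.1 : ℕ) *
    q.eval (f z) ^ (N - (i.1 : ℕ)) * f z ^ (N - (i.2 : ℕ))) with hGΨ
  have hGΨd : DifferentiableOn ℂ GΨ Ω := DifferentiableOn.fun_sum fun i _ =>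
    (((hG.pow _).mul (hqd.pow _)).mul (hf.1.pow _)).const_mul _
  have hGΨe : ∀ᶠ z in boundaryFilter Ω f, GΨ z = h z ^ N * Ψ z := by
    filter_upwards [hGq, hf.tendsto_norm.eventually (lt_mem_nhds one_pos)] with z h1 h2
    have hf0 : f z ≠ 0 := norm_pos_iff.1 h2
    simp only [hGΨ, hΨ, hh, h1, Finset.mul_sum]
    refine Finset.sum_congr rfl fun i _ => ?_
    have e1 : q.eval (f z) ^ N = q.eval (f z) ^ (i.1 : ℕ) * q.eval (f z) ^ (N - (i.1 : ℕ)) := by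
      rw [← pow_add, Nat.add_sub_cancel' (Nat.lt_succ_iff.1 i.1.2)]
    have e2 : f z ^ N = f z ^ (i.2 : ℕ) * f z ^ (N - (i.2 : ℕ)) := by
      rw [← pow_add, Nat.add_sub_cancel' (Nat.lt_succ_iff.1 i.2.2)]
    have e3 : f z ^ (i.2 : ℕ) * ((f z)⁻¹) ^ (i.2 : ℕ) = 1 := by
      rw [← mul_pow, mul_inv_cancel₀ hf0, one_pow]
    rw [mul_pow, mul_pow, e1, e2]
    linear_combination (-(conj (p i) * q.eval (f z) ^ (i.1 : ℕ) * v z ^ (i.1 : ℕ) *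
      q.eval (f z) ^ (N - (i.1 : ℕ)) * f z ^ (N - (i.2 : ℕ)))) * e3
  set Y : ℂ → ℂ := fun z => Φ₁ z * h z * GΨ z with hY
  have hYd : DifferentiableOn ℂ Y Ω := (hΦ₁d.mul hhd).mul hGΨd
  have hYe : ∀ᶠ z in boundaryFilter Ω f, Y z = T p z * Ψ z := by
    filter_upwards [hGΨe, eventually_mem_boundaryFilter] with z h1 h2
    rw [hΦ z h2]
    simp only [hY, h1]
    ring
  have hlim : Tendsto (fun z => T p z * conj (T p z) - Y z) (boundaryFilter Ω f) (𝓝 0) := by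
    obtain ⟨⟨C, hC⟩, ht⟩ := hΦΨ
    refine squeeze_zero_norm' (a := fun z => C * ‖conj (T p z) - Ψ z‖) ?_ ?_
    · filter_upwards [hC, hYe] with z a b
      rw [b, ← mul_sub, norm_mul]
      gcongr
    · simpa using (tendsto_zero_iff_norm_tendsto_zero.1 ht).const_mul C
  have him : Tendsto (fun z => (Y z).im) (boundaryFilter Ω f) (𝓝 0) := by
    have h1 := ((continuous_im.tendsto _).comp hlim).neg
    rw [zero_im, neg_zero] at h1
    refine h1.congr fun z => ?_
    rw [Function.comp, mul_conj, sub_im, ofReal_im, zero_sub, neg_neg]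
  obtain ⟨a, ha, hfa⟩ := hf.exists_eq (w := 0) (by simp)
  have hY0 := hf.eqOn_zero_of_im_tendsto_zero hΩ hc hYd him ha (by simp [hY, hh, hfa])
  intro z hz
  rw [← hTz, ← norm_le_zero_iff]
  refine hf.norm_le_of_eventually hΩ (hTd p) (fun ε hε => ?_) z hz
  have h1 := (tendsto_zero_iff_norm_tendsto_zero.1 hlim).eventually (gt_mem_nhds (pow_pos hε 2))
  filter_upwards [h1, eventually_mem_boundaryFilter] with x hx hxΩ
  rw [hY0 x hxΩ, sub_zero, norm_mul, norm_conj, ← sq] at hx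
  rw [zero_add]
  exact (lt_of_pow_lt_pow_left₀ 2 hε.le hx).le

end IsProperOntoDisc

theorem exists_mvPolynomial_of_relation {Ω : Set ℂ} {f f' u : ℂ → ℂ} {c : Polynomial ℂ}
    (hc : c ≠ 0) (hu : ∀ z ∈ Ω, u z * f' z = c.eval (f z)) {N : ℕ}
    {p : Fin (N + 1) × Fin (N + 1) → ℂ} (hp : p ≠ 0)
    (hrel : ∀ z ∈ Ω, ∑ i, p i * (u z ^ (i.1 : ℕ) * f z ^ (i.2 : ℕ)) = 0) :
    ∃ P : MvPolynomial (Fin 2) ℂ, P ≠ 0 ∧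
      ∀ z ∈ Ω, MvPolynomial.eval ![f' z, f z] P = 0 := by
  refine ⟨∑ i, MvPolynomial.C (p i) * MvPolynomial.X 0 ^ (N - (i.1 : ℕ)) *
    (Polynomial.aeval (MvPolynomial.X 1 : MvPolynomial (Fin 2) ℂ) c) ^ (i.1 : ℕ) *
      MvPolynomial.X 1 ^ (i.2 : ℕ), fun h0 => hp ?_, fun z hz => ?_⟩
  · have h1 := congrArg (MvPolynomial.aeval
      ![(Polynomial.X : Polynomial (Polynomial ℂ)), Polynomial.C Polynomial.X]) h0
    have haev : (Polynomial.aeval (Polynomial.C Polynomial.X : Polynomial (Polynomial ℂ))) c =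
        Polynomial.C c := by
      have := Polynomial.aeval_algHom_apply (Polynomial.CAlgHom : Polynomial ℂ →ₐ[ℂ] _)
        Polynomial.X c
      simpa using this
    have haev' : MvPolynomial.aeval
        ![(Polynomial.X : Polynomial (Polynomial ℂ)), Polynomial.C Polynomial.X]
        (Polynomial.aeval (MvPolynomial.X 1 : MvPolynomial (Fin 2) ℂ) c) = Polynomial.C c := by
      rw [← Polynomial.aeval_algHom_apply, MvPolynomial.aeval_X]
      exact haev
    have h2 : ∑ i, Polynomial.C (Polynomial.C (p i) * c ^ (i.1 : ℕ) * Polynomial.X ^ (i.2 : ℕ)) *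
        Polynomial.X ^ (N - (i.1 : ℕ)) = (0 : Polynomial (Polynomial ℂ)) := by
      rw [map_zero, map_sum] at h1
      rw [← h1]
      refine Finset.sum_congr rfl fun i _ => ?_
      simp only [map_mul, map_pow, haev', MvPolynomial.aeval_X, MvPolynomial.aeval_C,
        Matrix.cons_val_zero, Matrix.cons_val_one]
      rw [show algebraMap ℂ (Polynomial (Polynomial ℂ)) (p i) =
        Polynomial.C (Polynomial.C (p i)) from rfl]
      ring
    ext ⟨j, k⟩
    have h3 := congrArg (fun P => Polynomial.coeff P (N - (j : ℕ))) h2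
    simp only [Polynomial.finsetSum_coeff, Polynomial.coeff_C_mul_X_pow, Fintype.sum_prod_type,
      Polynomial.coeff_zero] at h3
    rw [Finset.sum_eq_single j] at h3
    · simp only [if_true] at h3
      have h4 : c ^ (j : ℕ) * ∑ k : Fin (N + 1),
          Polynomial.C (p (j, k)) * Polynomial.X ^ (k : ℕ) = 0 := by
        rw [← h3, Finset.mul_sum]
        exact Finset.sum_congr rfl fun k _ => by ring
      have h5 := (mul_eq_zero.1 h4).resolve_left (pow_ne_zero _ hc)
      have h6 := congrArg (fun P => Polynomial.coeff P (k : ℕ)) h5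
      simp only [Polynomial.finsetSum_coeff, Polynomial.coeff_C_mul_X_pow,
        Polynomial.coeff_zero] at h6
      rw [Finset.sum_eq_single k] at h6
      · simpa using h6
      · intro b _ hb
        rw [if_neg fun h => hb (Fin.ext h.symm)]
      · simp
    · intro b _ hb
      refine Finset.sum_eq_zero fun k _ => if_neg fun h => hb (Fin.ext ?_)
      have := b.2
      have := j.2
      omega
    · simp
  · have h1 := congrArg (fun x => x * f' z ^ N) (hrel z hz)
    simp only [zero_mul, Finset.sum_mul] at h1
    rw [← h1, map_sum]
    refine Finset.sum_congr rfl fun i _ => ?_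
    have h2 : MvPolynomial.eval ![f' z, f z]
        (Polynomial.aeval (MvPolynomial.X 1 : MvPolynomial (Fin 2) ℂ) c) = c.eval (f z) := by
      have h3 : (MvPolynomial.eval ![f' z, f z]).comp
          (algebraMap ℂ (MvPolynomial (Fin 2) ℂ)) = RingHom.id ℂ := by
        ext x
        simp [MvPolynomial.algebraMap_eq]
      rw [Polynomial.aeval_def, Polynomial.hom_eval₂, h3, MvPolynomial.eval_X]
      rfl
    have e1 : f' z ^ N = f' z ^ (i.1 : ℕ) * f' z ^ (N - (i.1 : ℕ)) := by
      rw [← pow_add, Nat.add_sub_cancel' (Nat.lt_succ_iff.1 i.1.2)]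
    simp only [map_mul, map_pow, h2, MvPolynomial.eval_C, MvPolynomial.eval_X, Matrix.cons_val_zero,
      Matrix.cons_val_one, ← hu z hz]
    rw [e1, mul_pow]
    ring

/-- on a generalized quadrature domain of finite area, every proper holomorphic
map `f` onto the unit disc is algebraically dependent with its derivative. -/
theorem stmt_17 (Ω : Set ℂ) (hΩ : IsFinConnDomain Ω) (hA : volume Ω < ⊤)
    (hq : IsGenQuadratureDomain Ω) :
    ∀ f : ℂ → ℂ, IsProperOntoDisc Ω f →
      ∃ P : MvPolynomial (Fin 2) ℂ, P ≠ 0 ∧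
        ∀ z ∈ Ω, MvPolynomial.eval ![deriv f z, f z] P = 0 := by
  intro f hf
  obtain ⟨hb, S, r, hr, -, hS, hlim, hSq⟩ := exists_schwarz_function hΩ hA hq hf
  have hc := hΩ.2.1.isPreconnected
  obtain ⟨u, v, c, hc0, hu, huf, huv, hv⟩ := hf.exists_reflected_pair hΩ.1 hc hb
    (r₀ := max r (1 / 2)) (by positivity) (max_lt hr (by norm_num))
    (hS.mono fun z hz => ⟨hz.1, show r < ‖f z‖ from
      (le_max_left _ _).trans_lt hz.2⟩) hlim hSq
  obtain ⟨N, p, hp, hrel⟩ := hf.exists_algebraic_relation hΩ.1 hc hu huv hv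
  exact exists_mvPolynomial_of_relation hc0 huf hp hrel
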